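/- There exists a constant C < ∞ such that for all integers n ≥ 1, all y ∈ Γ_{H(n)}, and all ỹ ∈ Γ_{H(16n)}, P(L(y, H(n))) ≤ C·P(L(ỹ, H(16n))). -/

import Mathlib

/-!
Critical site percolation on the triangular lattice realized on `ℤ²`.
A configuration assigns to each site `true` (open) or `false` (closed),
and `P` is the product Bernoulli(1/2) measure, axiomatized by
`IsBernoulliHalf` below (finite cylinder events have product probability).
-/

open MeasureTheory
open scoped ENNReal

/-- Sites of the lattice: vertices of `ℤ²`. -/
abbrev Site : Type := ℤ × ℤ

/-- A percolation configuration: `true` = open, `false` = closed. -/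
abbrev Config : Type := Site → Bool

/-- Adjacency for the triangular lattice realized on `ℤ²`:
the neighbors of `(x,y)` are `(x±1,y)`, `(x,y±1)`, `(x+1,y-1)`, `(x-1,y+1)`. -/
def Adj (a b : Site) : Prop :=
  (b.1 - a.1, b.2 - a.2) ∈
    ({(1, 0), (-1, 0), (0, 1), (0, -1), (1, -1), (-1, 1)} : Set (ℤ × ℤ))

/-- A (nonempty, self-avoiding) lattice path: a list of distinct sites in which
consecutive sites are neighbors. -/
def IsPath (p : List Site) : Prop := p ≠ [] ∧ p.Nodup ∧ p.Chain' Adj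

/-- A path all of whose vertices lie in the set `S`. -/
def PathIn (S : Set Site) (p : List Site) : Prop := IsPath p ∧ ∀ v ∈ p, v ∈ S

/-- All sites of `p` are open in `ω`. -/
def IsOpenOn (ω : Config) (p : List Site) : Prop := ∀ v ∈ p, ω v = true

/-- All sites of `p` are closed in `ω`. -/
def IsClosedOn (ω : Config) (p : List Site) : Prop := ∀ v ∈ p, ω v = false

/-- The first vertex of `p` lies in `A`. -/
def FirstIn (A : Set Site) (p : List Site) : Prop := ∃ a ∈ A, p.head? = some a

/-- The last vertex of `p` lies in `A`. -/
def LastIn (A : Set Site) (p : List Site) : Prop := ∃ a ∈ A, p.getLast? = some a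

/-- `μ` is the product Bernoulli(1/2) measure on configurations: a probability
measure for which every finite cylinder event has the product probability. -/
def IsBernoulliHalf (μ : Measure Config) : Prop :=
  IsProbabilityMeasure μ ∧
    ∀ (S : Finset Site) (f : Site → Bool),
      μ {ω | ∀ v ∈ S, ω v = f v} = (1 / 2 : ℝ≥0∞) ^ S.card

/-- The lattice rectangle `[x₀,x₁] × [y₀,y₁]`. -/
def rect (x₀ x₁ y₀ y₁ : ℤ) : Set Site :=
  {v | x₀ ≤ v.1 ∧ v.1 ≤ x₁ ∧ y₀ ≤ v.2 ∧ v.2 ≤ y₁}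

/-- The left side of a rectangle. -/
def rectLeft (x₀ x₁ y₀ y₁ : ℤ) : Set Site := {v ∈ rect x₀ x₁ y₀ y₁ | v.1 = x₀}

/-- The right side of a rectangle. -/
def rectRight (x₀ x₁ y₀ y₁ : ℤ) : Set Site := {v ∈ rect x₀ x₁ y₀ y₁ | v.1 = x₁}

/-- The top side of a rectangle. -/
def rectTop (x₀ x₁ y₀ y₁ : ℤ) : Set Site := {v ∈ rect x₀ x₁ y₀ y₁ | v.2 = y₁}

/-- The bottom side of a rectangle. -/
def rectBot (x₀ x₁ y₀ y₁ : ℤ) : Set Site := {v ∈ rect x₀ x₁ y₀ y₁ | v.2 = y₀}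

/-- A horizontal open crossing of the rectangle `[x₀,x₁] × [y₀,y₁]`:
an open path in the rectangle from its left side to its right side. -/
def HorizCrossing (x₀ x₁ y₀ y₁ : ℤ) (ω : Config) (p : List Site) : Prop :=
  PathIn (rect x₀ x₁ y₀ y₁) p ∧ IsOpenOn ω p ∧
    FirstIn (rectLeft x₀ x₁ y₀ y₁) p ∧ LastIn (rectRight x₀ x₁ y₀ y₁) p

/-- The set of sites of the rectangle lying on or beneath the path `q`: sites
that are on `q` or cannot be joined to the top side of the rectangle by a
lattice path avoiding `q`. -/
def OnOrBelow (x₀ x₁ y₀ y₁ : ℤ) (q : List Site) : Set Site :=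
  {v ∈ rect x₀ x₁ y₀ y₁ | v ∈ q ∨
    ¬ ∃ r : List Site, PathIn (rect x₀ x₁ y₀ y₁ \ {w | w ∈ q}) r ∧
        r.head? = some v ∧ LastIn (rectTop x₀ x₁ y₀ y₁) r}

/-- `p` is the lowest horizontal open crossing of the rectangle: it is a
horizontal open crossing lying on or beneath every horizontal open crossing. -/
def IsLowestCrossing (x₀ x₁ y₀ y₁ : ℤ) (ω : Config) (p : List Site) : Prop :=
  HorizCrossing x₀ x₁ y₀ y₁ ω p ∧
    ∀ q, HorizCrossing x₀ x₁ y₀ y₁ ω q → ∀ v ∈ p, v ∈ OnOrBelow x₀ x₁ y₀ y₁ q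

theorem adj_iff {a b : Site} : Adj a b ↔
    (-1 ≤ b.1 - a.1 ∧ b.1 - a.1 ≤ 1 ∧ -1 ≤ b.2 - a.2 ∧ b.2 - a.2 ≤ 1 ∧
      -1 ≤ b.1 - a.1 + (b.2 - a.2) ∧ b.1 - a.1 + (b.2 - a.2) ≤ 1 ∧
      ¬ (b.1 = a.1 ∧ b.2 = a.2)) := by
  simp only [Adj, Set.mem_insert_iff, Set.mem_singleton_iff, Prod.mk.injEq]
  omega

theorem Adj.symm {a b : Site} (h : Adj a b) : Adj b a := by
  rw [adj_iff] at *; omega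

/-- `Walk A s t`: there is a lattice walk from `s` to `t` all of whose sites lie in `A`. -/
inductive Walk (A : Set Site) : Site → Site → Prop
  | refl {v : Site} (h : v ∈ A) : Walk A v v
  | head {s m t : Site} (h : s ∈ A) (e : Adj s m) (w : Walk A m t) : Walk A s t

namespace Walk

variable {A B P : Set Site} {s t u : Site}

theorem mono (w : Walk A s t) (h : A ⊆ B) : Walk B s t := by
  induction w with
  | refl hv => exact .refl (h hv)
  | head hs e _ ih => exact .head (h hs) e ih

theorem start_mem (w : Walk A s t) : s ∈ A := by
  cases w <;> assumption

theorem end_mem (w : Walk A s t) : t ∈ A := by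
  induction w with
  | refl h => exact h
  | head _ _ _ ih => exact ih

theorem trans (w : Walk A s t) (w' : Walk A t u) : Walk A s u := by
  induction w with
  | refl _ => exact w'
  | head hs e _ ih => exact .head hs e (ih w')

theorem snoc (w : Walk A s t) (e : Adj t u) (hu : u ∈ A) : Walk A s u :=
  w.trans (.head w.end_mem e (.refl hu))

theorem symm (w : Walk A s t) : Walk A t s := by
  induction w with
  | refl h => exact .refl h
  | head hs e _ ih => exact ih.snoc e.symm hs

theorem exit (w : Walk A s t) (hs : s ∈ P) (ht : t ∉ P) :
    ∃ a b, Walk (A ∩ P) s a ∧ Adj a b ∧ b ∉ P ∧ Walk A b t := by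
  induction w with
  | refl _ => exact absurd hs ht
  | @head s m t h e w ih =>
    by_cases hm : m ∈ P
    · obtain ⟨a, b, h1, h2, h3, h4⟩ := ih hm ht
      exact ⟨a, b, .head ⟨h, hs⟩ e h1, h2, h3, h4⟩
    · exact ⟨s, m, .refl ⟨h, hs⟩, e, hm, w⟩

theorem last_exit (w : Walk A s t) (hs : s ∈ P) (ht : t ∉ P) :
    ∃ a b, Walk A s a ∧ a ∈ P ∧ Adj a b ∧ Walk (A \ P) b t := by
  obtain ⟨a, b, h1, h2, h3, h4⟩ := w.symm.exit (P := Pᶜ) ht (fun h => h hs)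
  exact ⟨b, a, h4.symm, not_not.1 h3, h2.symm, h1.symm⟩

/-- A walk in `A` started in `P` stays in `P` if `P` is closed under steps into `A`. -/
theorem inter_of_closed (w : Walk A s t) (hs : s ∈ P)
    (hP : ∀ a ∈ P, a ∈ A → ∀ b ∈ A, Adj a b → b ∈ P) : Walk (A ∩ P) s t := by
  by_contra hc
  have ht : t ∈ P := by
    by_contra ht
    obtain ⟨a, b, h1, h2, h3, h4⟩ := w.exit hs ht
    exact h3 (hP a h1.end_mem.2 h1.end_mem.1 b h4.start_mem h2)
  apply hc
  clear hc ht
  induction w with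
  | refl h => exact .refl ⟨h, hs⟩
  | head h e w ih => exact .head ⟨h, hs⟩ e (ih (hP _ hs h _ w.start_mem e))

theorem exists_path (w : Walk A s t) :
    ∃ p : List Site, PathIn A p ∧ p.head? = some s ∧ p.getLast? = some t := by
  induction w with
  | @refl v h =>
    exact ⟨[v], ⟨⟨by simp, by simp, List.isChain_singleton _⟩, by simpa using h⟩, by simp, by simp⟩
  | @head s m t h e w ih =>
    obtain ⟨p, ⟨⟨h1, h2, h3⟩, h4⟩, h5, h6⟩ := ih
    by_cases hp : s ∈ p
    · obtain ⟨l1, l2, rfl⟩ := List.append_of_mem hp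
      refine ⟨s :: l2, ⟨⟨by simp, h2.of_append_right, ?_⟩, ?_⟩, by simp, ?_⟩
      · exact List.IsChain.right_of_append h3
      · intro v hv; exact h4 v (by simp at hv ⊢; tauto)
      · rw [List.getLast?_append] at h6
        rw [List.getLast?_cons] at h6 ⊢
        simpa using h6
    · refine ⟨s :: p, ⟨⟨by simp, List.nodup_cons.2 ⟨hp, h2⟩, ?_⟩, ?_⟩, by simp, ?_⟩
      · cases p with
        | nil => exact List.isChain_singleton _
        | cons a l =>
          simp only [List.head?_cons, Option.some.injEq] at h5
          subst h5
          exact List.IsChain.cons_cons e h3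
      · intro v hv
        rcases List.mem_cons.1 hv with rfl | hv
        · exact h
        · exact h4 v hv
      · rw [List.getLast?_cons, h6]; rfl

theorem of_list {p : List Site} (hp : p.IsChain Adj) (h : ∀ v ∈ p, v ∈ A)
    (hs : p.head? = some s) (ht : p.getLast? = some t) : Walk A s t := by
  induction p generalizing s with
  | nil => simp at hs
  | cons a l ih =>
    simp only [List.head?_cons, Option.some.injEq] at hs
    subst hs
    cases l with
    | nil =>
      simp only [List.getLast?_singleton, Option.some.injEq] at ht
      subst ht; exact .refl (h _ (by simp))
    | cons b l =>
      rw [List.isChain_cons_cons] at hp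
      refine .head (h _ (by simp)) hp.1 (ih hp.2 (fun v hv => h v (List.mem_cons_of_mem _ hv))
        (by simp) ?_)
      rwa [List.getLast?_cons_cons] at ht

/-- Vertical walks. -/
theorem vert (x : ℤ) : ∀ {y y' : ℤ}, (∀ z, min y y' ≤ z → z ≤ max y y' → (x, z) ∈ A) →
    Walk A (x, y) (x, y') := by
  have key : ∀ (d : ℕ) (y : ℤ), (∀ z, y ≤ z → z ≤ y + d → (x, z) ∈ A) →
      Walk A (x, y) (x, y + d) := by
    intro d
    induction d with
    | zero => intro y h; simpa using Walk.refl (h y (by simp) (by simp))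
    | succ d ih =>
      intro y h
      refine (ih y (fun z h1 h2 => h z h1 (by push_cast; omega))).snoc ?_ (h _ (by omega) le_rfl)
      rw [adj_iff]; push_cast; simp
  intro y y' h
  rcases le_total y y' with hy | hy
  · obtain ⟨d, rfl⟩ := Int.le.dest hy
    exact key d y (fun z h1 h2 => h z (by omega) (by omega))
  · obtain ⟨d, rfl⟩ := Int.le.dest hy
    exact (key d y' (fun z h1 h2 => h z (by omega) (by omega))).symm

/-- Horizontal walks. -/
theorem horiz (y : ℤ) : ∀ {x x' : ℤ}, (∀ z, min x x' ≤ z → z ≤ max x x' → (z, y) ∈ A) →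
    Walk A (x, y) (x', y) := by
  have key : ∀ (d : ℕ) (x : ℤ), (∀ z, x ≤ z → z ≤ x + d → (z, y) ∈ A) →
      Walk A (x, y) (x + d, y) := by
    intro d
    induction d with
    | zero => intro x h; simpa using Walk.refl (h x (by simp) (by simp))
    | succ d ih =>
      intro x h
      refine (ih x (fun z h1 h2 => h z h1 (by push_cast; omega))).snoc ?_ (h _ (by omega) le_rfl)
      rw [adj_iff]; push_cast; simp
  intro x x' h
  rcases le_total x x' with hy | hy
  · obtain ⟨d, rfl⟩ := Int.le.dest hy
    exact key d x (fun z h1 h2 => h z (by omega) (by omega))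
  · obtain ⟨d, rfl⟩ := Int.le.dest hy
    exact (key d x' (fun z h1 h2 => h z (by omega) (by omega))).symm

theorem map {f : Site → Site} (hf : ∀ a b, Adj a b → Adj (f a) (f b)) (w : Walk A s t)
    (h : ∀ v ∈ A, f v ∈ B) : Walk B (f s) (f t) := by
  induction w with
  | refl hv => exact .refl (h _ hv)
  | head hs e _ ih => exact .head (h _ hs) (hf _ _ e) ih

end Walk

/-! ### Intersection pairing of lattice walks -/

/-- Step `a — b` crosses the column gap `v.1 | v.1 + 1` with left endpoint below `v`. -/
def stepBelow (a b v : Site) : ZMod 2 :=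
  if (a.1 = v.1 ∧ b.1 = v.1 + 1 ∧ a.2 < v.2) ∨ (b.1 = v.1 ∧ a.1 = v.1 + 1 ∧ b.2 < v.2)
  then 1 else 0

/-- Step `a — b` crosses the column gap `w.1 - 1 | w.1` with right endpoint above `w`. -/
def stepAbove (a b w : Site) : ZMod 2 :=
  if (a.1 = w.1 - 1 ∧ b.1 = w.1 ∧ w.2 < b.2) ∨ (b.1 = w.1 - 1 ∧ a.1 = w.1 ∧ w.2 < a.2)
  then 1 else 0

/-- A walk together with the functions counting (mod 2) its passages below resp. above
a site. -/
inductive Curve (A : Set Site) : Site → Site → (Site → ZMod 2) → (Site → ZMod 2) → Prop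
  | refl {v : Site} (h : v ∈ A) : Curve A v v 0 0
  | head {s m t : Site} {N M : Site → ZMod 2} (h : s ∈ A) (e : Adj s m) (c : Curve A m t N M) :
      Curve A s t (stepBelow s m + N) (stepAbove s m + M)

theorem Walk.curve {A : Set Site} {s t : Site} (w : Walk A s t) : ∃ N M, Curve A s t N M := by
  induction w with
  | refl h => exact ⟨_, _, .refl h⟩
  | head h e _ ih => obtain ⟨N, M, c⟩ := ih; exact ⟨_, _, .head h e c⟩

theorem ZMod.two_self (a : ZMod 2) : a + a = 0 := CharTwo.add_self_eq_zero a

namespace Curve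

variable {A B : Set Site} {s t u v : Site} {N M N' M' : Site → ZMod 2}

theorem walk (c : Curve A s t N M) : Walk A s t := by
  induction c with
  | refl h => exact .refl h
  | head h e _ ih => exact .head h e ih

set_option maxHeartbeats 2000000 in
theorem step_step {a b c d : Site} (h : Adj a b) (h' : Adj c d) (h1 : a ≠ c) (h2 : a ≠ d)
    (h3 : b ≠ c) (h4 : b ≠ d) :
    stepBelow a b c + stepBelow a b d = stepAbove c d a + stepAbove c d b := by
  obtain ⟨a1, a2⟩ := a
  obtain ⟨b1, b2⟩ := b
  obtain ⟨c1, c2⟩ := c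
  obtain ⟨d1, d2⟩ := d
  simp only [adj_iff, ne_eq, Prod.mk.injEq] at *
  unfold stepBelow stepAbove
  dsimp only
  split_ifs <;> first | rfl | (exfalso; omega)

theorem step_pair {a b : Site} (h : Adj a b) (ha : a ∉ B) (hb : b ∉ B)
    (c : Curve B u v N' M') : stepBelow a b u + stepBelow a b v = M' a + M' b := by
  induction c with
  | refl _ => simp [ZMod.two_self]
  | @head s m t N M hs e c ih =>
    have hm := c.walk.start_mem
    have := step_step h e (by rintro rfl; exact ha hs) (by rintro rfl; exact ha hm)
      (by rintro rfl; exact hb hs) (by rintro rfl; exact hb hm)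
    simp only [Pi.add_apply]
    calc _ = (stepBelow a b s + stepBelow a b m) + (stepBelow a b m + stepBelow a b t) := by
          linear_combination (norm := ring_nf) - ZMod.two_self (stepBelow a b m)
      _ = _ := by rw [this, ih]; ring

theorem pair (c : Curve A s t N M) (c' : Curve B u v N' M') (h : Disjoint A B) :
    N u + N v = M' s + M' t := by
  have hd : ∀ x ∈ A, x ∉ B := fun x hx hx' => Set.disjoint_left.1 h hx hx'
  induction c with
  | refl _ => simp [ZMod.two_self]
  | @head s m t N M hs e c ih =>
    have := step_pair e (hd _ hs) (hd _ c.walk.start_mem) c'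
    simp only [Pi.add_apply]
    calc _ = (stepBelow s m u + stepBelow s m v) + (N u + N v) := by ring
      _ = (M' s + M' t) + (M' m + M' m) := by rw [this, ih]; ring
      _ = _ := by rw [ZMod.two_self, add_zero]

theorem below_zero (c : Curve A s t N M)
    (h : (∀ p ∈ A, p.1 = v.1 → v.2 ≤ p.2) ∨ ∀ p ∈ A, p.1 ≤ v.1) : N v = 0 := by
  induction c with
  | refl _ => rfl
  | @head s m t N M hs e c ih =>
    have hm := c.walk.start_mem
    simp only [Pi.add_apply, ih, add_zero, stepBelow]
    rw [if_neg]
    rcases h with h | h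
    · have := h _ hs; have := h _ hm; omega
    · have := h _ hs; have := h _ hm; omega

theorem above_zero (c : Curve A s t N M)
    (h : (∀ p ∈ A, p.1 = v.1 → p.2 ≤ v.2) ∨ ∀ p ∈ A, v.1 ≤ p.1) : M v = 0 := by
  induction c with
  | refl _ => rfl
  | @head s m t N M hs e c ih =>
    have hm := c.walk.start_mem
    simp only [Pi.add_apply, ih, add_zero, stepAbove]
    rw [if_neg]
    rcases h with h | h
    · have := h _ hs; have := h _ hm; omega
    · have := h _ hs; have := h _ hm; omega

theorem below_eq (c : Curve A s t N M) (h : ∀ p ∈ A, p.1 = v.1 → p.2 < v.2) :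
    N v = (if s.1 ≤ v.1 then 1 else 0) + (if t.1 ≤ v.1 then 1 else 0) := by
  induction c with
  | refl _ => simp [ZMod.two_self]
  | @head s m t N M hs e c ih =>
    have h1 := h _ hs
    have h2 := h _ c.walk.start_mem
    rw [adj_iff] at e
    simp only [Pi.add_apply, ih, stepBelow]
    split_ifs <;> first | rfl | (exfalso; omega)

theorem above_eq (c : Curve A s t N M) (h : ∀ p ∈ A, p.1 = v.1 → v.2 < p.2) :
    M v = (if s.1 < v.1 then 1 else 0) + (if t.1 < v.1 then 1 else 0) := by
  induction c with
  | refl _ => simp [ZMod.two_self]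
  | @head s m t N M hs e c ih =>
    have h1 := h _ hs
    have h2 := h _ c.walk.start_mem
    rw [adj_iff] at e
    simp only [Pi.add_apply, ih, stepAbove]
    split_ifs <;> first | rfl | (exfalso; omega)

theorem mono (c : Curve A s t N M) (h : A ⊆ B) : Curve B s t N M := by
  induction c with
  | refl hv => exact .refl (h hv)
  | head hs e _ ih => exact .head (h hs) e ih

theorem trans (c : Curve A s t N M) (c' : Curve A t u N' M') : Curve A s u (N + N') (M + M') := by
  induction c with
  | refl _ => simpa using c'
  | head hs e _ ih => rw [add_assoc, add_assoc]; exact .head hs e (ih c')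

end Curve

/-- A left-right walk and a top-bottom walk in a rectangle meet. -/
theorem rect_cross {x₀ x₁ y₀ y₁ : ℤ} {A B : Set Site} {s t u v : Site}
    (hA : A ⊆ rect x₀ x₁ y₀ y₁) (hB : B ⊆ rect x₀ x₁ y₀ y₁)
    (w : Walk A s t) (w' : Walk B u v) (hs : s.1 = x₀) (ht : t.1 = x₁) (hu : u.2 = y₁)
    (hv : v.2 = y₀) : ∃ z, z ∈ A ∧ z ∈ B := by
  by_contra hc
  push Not at hc
  have hu' := hB w'.start_mem
  have hv' := hB w'.end_mem
  set A' : Set Site := A ∪ {(x₁ + 1, t.2)} with hA'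
  have hd : Disjoint A' B := by
    rw [Set.disjoint_left]
    rintro z (hz | rfl) hz'
    · exact hc z hz hz'
    · have := (hB hz').2.1; simp at this
  have wA : Walk A' s (x₁ + 1, t.2) := (w.mono Set.subset_union_left).snoc
    (by rw [adj_iff]; simp [ht]) (Or.inr rfl)
  obtain ⟨N, M, c⟩ := wA.curve
  obtain ⟨N', M', c'⟩ := w'.curve
  have := c.pair c' hd
  rw [c.below_eq (v := u), c.below_zero (v := v), c'.above_zero (v := s), c'.above_zero] at this
  · rw [if_pos, if_neg] at this
    · revert this; decide
    · have := hu'.2.1; dsimp; omega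
    · rw [hs]; exact hu'.1
  · left; intro p hp; have := (hB hp).2.1; simp; omega
  · right; intro p hp; rw [hs]; exact (hB hp).1
  · left
    rintro p (hp | rfl)
    · have := (hA hp).2.2.1; omega
    · have := hv'.2.1; simp; omega
  · rintro p (hp | rfl) h
    · have h1 := (hA hp).2.2.2
      rcases lt_or_eq_of_le h1 with h1 | h1
      · omega
      · exact absurd w'.start_mem (by
          have : p = u := Prod.ext h (by omega)
          rw [← this]; exact hc p hp)
    · have := hu'.2.1; simp at h; omega

section Hex

open Classical in
/-- Indicator (mod 2) of the event that one of `u`, `v` is in `C` and the other in `D`. -/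
noncomputable def interface (C D : Set Site) (u v : Site) : ZMod 2 :=
  if (u ∈ C ∧ v ∈ D) ∨ (v ∈ C ∧ u ∈ D) then 1 else 0

theorem interface_triangle {C D : Set Site} {u v w : Site} (hd : ∀ z ∈ C, z ∉ D)
    (h : (u ∈ C ∨ v ∈ C ∨ w ∈ C) → (u ∈ D ∨ v ∈ D ∨ w ∈ D) →
      (u ∈ C ∨ u ∈ D) ∧ (v ∈ C ∨ v ∈ D) ∧ (w ∈ C ∨ w ∈ D)) :
    interface C D u v + interface C D v w + interface C D w u = 0 := by
  have hu := hd u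
  have hv := hd v
  have hw := hd w
  unfold interface
  by_cases u ∈ C <;> by_cases v ∈ C <;> by_cases w ∈ C <;> by_cases u ∈ D <;> by_cases v ∈ D <;>
    by_cases w ∈ D <;> simp_all [ZMod.two_self]

theorem interface_comm {C D : Set Site} (u v : Site) : interface C D u v = interface C D v u := by
  unfold interface; congr 1; exact propext or_comm

theorem boundary_sum (h v : ℕ → ℕ → ZMod 2) (m n : ℕ)
    (hs : ∀ i < m, ∀ j < n, h i j + v (i + 1) j + h i (j + 1) + v i j = 0) :
    (∑ i ∈ Finset.range m, h i 0) + (∑ i ∈ Finset.range m, h i n) =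
      (∑ j ∈ Finset.range n, v 0 j) + ∑ j ∈ Finset.range n, v m j := by
  induction n with
  | zero => simp [ZMod.two_self]
  | succ n ih =>
    have ih := ih fun i hi j hj => hs i hi j (hj.trans n.lt_succ_self)
    have key : ∀ k ≤ m, (∑ i ∈ Finset.range k, h i n) + (∑ i ∈ Finset.range k, h i (n + 1)) =
        v 0 n + v k n := by
      intro k
      induction k with
      | zero => simp [ZMod.two_self]
      | succ k ihk =>
        intro hk
        have h1 := ihk (by omega)
        have h2 := hs k (by omega) n (by omega)
        rw [Finset.sum_range_succ, Finset.sum_range_succ]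
        have h3 := ZMod.two_self (v (k + 1) n)
        have h4 := ZMod.two_self (v k n)
        linear_combination h1 + h2 - h3
    have key := key m le_rfl
    rw [Finset.sum_range_succ, Finset.sum_range_succ]
    linear_combination ih + key - ZMod.two_self (∑ i ∈ Finset.range m, h i n)

/-- Hex lemma in a rectangle: for every colouring there is a left-right walk in `O` or a
top-bottom walk in the complement of `O`. -/
theorem hex_rect {x₀ x₁ y₀ y₁ : ℤ} (hx : x₀ ≤ x₁) (hy : y₀ ≤ y₁) (O : Set Site) :
    (∃ s t, Walk (rect x₀ x₁ y₀ y₁ ∩ O) s t ∧ s.1 = x₀ ∧ t.1 = x₁) ∨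
      ∃ s t, Walk (rect x₀ x₁ y₀ y₁ ∩ Oᶜ) s t ∧ s.2 = y₁ ∧ t.2 = y₀ := by
  by_contra hc
  push Not at hc
  obtain ⟨hc1, hc2⟩ := hc
  set R := rect x₀ x₁ y₀ y₁ with hR
  set C : Set Site := {u | u.1 = x₀ - 1 ∨ ∃ s, s.1 = x₀ ∧ Walk (R ∩ O) s u} with hC
  set D : Set Site := {u | (u.2 = y₀ - 1 ∧ x₀ ≤ u.1) ∨ ∃ s, s.2 = y₀ ∧ Walk (R ∩ Oᶜ) s u} with hD
  have hdisj : ∀ z ∈ C, z ∉ D := by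
    rintro z (hz | ⟨s, _, ws⟩) (hz' | ⟨s', _, ws'⟩)
    · omega
    · have := ws'.end_mem.1.1; omega
    · have := ws.end_mem.1.2.2.1; omega
    · exact ws'.end_mem.2 ws.end_mem.2
  have reg : ∀ w : Site, x₀ - 1 ≤ w.1 → w.1 ≤ x₁ → y₀ - 1 ≤ w.2 → w.2 ≤ y₁ →
      w ∈ C ∨ w ∈ D ∨ w ∈ R := by
    intro w h1 h2 h3 h4
    by_cases hw : w.1 = x₀ - 1
    · exact Or.inl (Or.inl hw)
    by_cases hw' : w.2 = y₀ - 1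
    · exact Or.inr (Or.inl (Or.inl ⟨hw', by omega⟩))
    · exact Or.inr (Or.inr ⟨by omega, h2, by omega, h4⟩)
  have close : ∀ u v w : Site, u ∈ C → v ∈ D → Adj u w → Adj v w → w ∈ C ∨ w ∈ D ∨ w ∈ R →
      w ∈ C ∨ w ∈ D := by
    intro u v w hu hv huw hvw hw
    rcases hw with hw | hw | hw
    · exact Or.inl hw
    · exact Or.inr hw
    by_cases hO : w ∈ O
    · left
      right
      rcases hu with hu | ⟨s, hs, ws⟩
      · have := hw.1
        rw [adj_iff] at huw
        exact ⟨w, by omega, .refl ⟨hw, hO⟩⟩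
      · exact ⟨s, hs, ws.snoc huw ⟨hw, hO⟩⟩
    · right
      right
      rcases hv with hv | ⟨s, hs, ws⟩
      · have := hw.2.2.1
        rw [adj_iff] at hvw
        exact ⟨w, by omega, .refl ⟨hw, hO⟩⟩
      · exact ⟨s, hs, ws.snoc hvw ⟨hw, hO⟩⟩
  have tri : ∀ u v w : Site, Adj u v → Adj v w → Adj w u → (u ∈ C ∨ u ∈ D ∨ u ∈ R) →
      (v ∈ C ∨ v ∈ D ∨ v ∈ R) → (w ∈ C ∨ w ∈ D ∨ w ∈ R) →
      interface C D u v + interface C D v w + interface C D w u = 0 := by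
    intro u v w e1 e2 e3 hu hv hw
    apply interface_triangle hdisj
    rintro (h | h | h) (h' | h' | h')
    · exact absurd h' (hdisj _ h)
    · exact ⟨Or.inl h, Or.inr h', close u v w h h' e3.symm e2 hw⟩
    · exact ⟨Or.inl h, close u w v h h' e1 e2.symm hv, Or.inr h'⟩
    · exact ⟨Or.inr h', Or.inl h, close v u w h h' e2 e3.symm hw⟩
    · exact absurd h' (hdisj _ h)
    · exact ⟨close v w u h h' e1.symm e3 hu, Or.inl h, Or.inr h'⟩
    · exact ⟨Or.inr h', close w u v h h' e2.symm e1 hv, Or.inl h⟩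
    · exact ⟨close w v u h h' e3 e1.symm hu, Or.inr h', Or.inl h⟩
    · exact absurd h' (hdisj _ h)
  obtain ⟨m, hm⟩ := Int.le.dest hx
  obtain ⟨n, hn⟩ := Int.le.dest hy
  set pt : ℕ → ℕ → Site := fun i j => (x₀ - 1 + i, y₀ - 1 + j) with hpt
  have hreg : ∀ i ≤ m + 1, ∀ j ≤ n + 1, pt i j ∈ C ∨ pt i j ∈ D ∨ pt i j ∈ R := by
    intro i hi j hj
    apply reg <;> simp only [hpt] <;> omega
  have sum := boundary_sum (fun i j => interface C D (pt i j) (pt (i + 1) j))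
    (fun i j => interface C D (pt i j) (pt i (j + 1))) (m + 1) (n + 1) (by
      intro i hi j hj
      have a1 : Adj (pt i j) (pt (i + 1) j) := by rw [adj_iff]; simp only [hpt]; push_cast; omega
      have a2 : Adj (pt (i + 1) j) (pt i (j + 1)) := by rw [adj_iff]; simp only [hpt]; push_cast; omega
      have a3 : Adj (pt i (j + 1)) (pt i j) := by rw [adj_iff]; simp only [hpt]; push_cast; omega
      have a4 : Adj (pt (i + 1) j) (pt (i + 1) (j + 1)) := by rw [adj_iff]; simp only [hpt]; push_cast; omega
      have a5 : Adj (pt (i + 1) (j + 1)) (pt i (j + 1)) := by rw [adj_iff]; simp only [hpt]; push_cast; omega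
      have t1 := tri _ _ _ a1 a2 a3 (hreg _ (by omega) _ (by omega))
        (hreg _ (by omega) _ (by omega)) (hreg _ (by omega) _ (by omega))
      have t2 := tri _ _ _ a4 a5 a2.symm (hreg _ (by omega) _ (by omega))
        (hreg _ (by omega) _ (by omega)) (hreg _ (by omega) _ (by omega))
      have c1 := interface_comm (C := C) (D := D) (pt i (j + 1)) (pt (i + 1) j)
      have c2 := interface_comm (C := C) (D := D) (pt i (j + 1)) (pt (i + 1) (j + 1))
      have c3 := interface_comm (C := C) (D := D) (pt i (j + 1)) (pt i j)
      have := ZMod.two_self (interface C D (pt (i + 1) j) (pt i (j + 1)))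
      linear_combination t1 + t2 - c1 + c2 - c3 - this)
  have zero : ∀ {u v : Site}, u ∉ C → v ∉ C → interface C D u v = 0 := by
    intro u v h h'; simp [interface, h, h']
  have zero' : ∀ {u v : Site}, u ∉ D → v ∉ D → interface C D u v = 0 := by
    intro u v h h'; simp [interface, h, h']
  have corner : pt 0 0 ∈ C := Or.inl (by simp [hpt])
  have bot : ∀ i, pt (i + 1) 0 ∈ D := fun i => Or.inl (by simp [hpt])
  have left : ∀ j, pt 0 j ∈ C := fun j => Or.inl (by simp [hpt])
  have right : ∀ j, pt (m + 1) j ∉ C := by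
    rintro j (h | ⟨s, hs, ws⟩)
    · simp [hpt] at h; omega
    · exact hc1 _ _ ws hs (by simp [hpt]; omega)
  have top : ∀ i, pt i (n + 1) ∉ D := by
    rintro i (h | ⟨s, hs, ws⟩)
    · simp [hpt] at h; omega
    · exact hc2 _ _ ws.symm (by simp [hpt]; omega) hs
  rw [Finset.sum_range_succ', Finset.sum_eq_zero, Finset.sum_eq_zero, Finset.sum_eq_zero,
    Finset.sum_eq_zero] at sum
  · have : interface C D (pt 0 0) (pt (0 + 1) 0) = 1 := by
      simp only [interface]
      rw [if_pos (Or.inl ⟨corner, bot 0⟩)]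
    rw [this] at sum
    revert sum; decide
  · intro j _; exact zero (right j) (right _)
  · intro j _; exact zero' (hdisj _ (left j)) (hdisj _ (left _))
  · intro j _; exact zero' (top j) (top _)
  · intro i _; exact zero (fun h => hdisj _ h (bot _)) (fun h => hdisj _ h (bot _))

end Hex

section Prob

open ProbabilityTheory

/-- The event `E` depends only on the sites of `Λ`. -/
def DepOn (Λ : Set Site) (E : Set Config) : Prop :=
  ∀ ω ω' : Config, (∀ v ∈ Λ, ω v = ω' v) → ω ∈ E → ω' ∈ E

theorem DepOn.mono {Λ Λ' : Set Site} {E : Set Config} (h : DepOn Λ E) (hs : Λ ⊆ Λ') :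
    DepOn Λ' E := fun ω ω' hω => h ω ω' fun v hv => hω v (hs hv)

theorem DepOn.inter {Λ : Set Site} {E F : Set Config} (h : DepOn Λ E) (h' : DepOn Λ F) :
    DepOn Λ (E ∩ F) := fun ω ω' hω hE => ⟨h ω ω' hω hE.1, h' ω ω' hω hE.2⟩

theorem DepOn.compl {Λ : Set Site} {E : Set Config} (h : DepOn Λ E) : DepOn Λ Eᶜ :=
  fun ω ω' hω hE hE' => hE (h ω' ω (fun v hv => (hω v hv).symm) hE')

/-- Extension of a partial configuration by closed sites. -/
def extendConfig (Λ : Finset Site) (f : Λ → Bool) : Config := fun v => if h : v ∈ Λ then f ⟨v, h⟩ else false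

theorem DepOn.mem_iff {Λ : Finset Site} {E : Set Config} (h : DepOn ↑Λ E) (ω : Config) :
    ω ∈ E ↔ extendConfig Λ (Λ.restrict ω) ∈ E := by
  constructor
  · exact h _ _ fun v hv => by simp [extendConfig, Finset.mem_coe.1 hv]
  · exact h _ _ fun v hv => by simp [extendConfig, Finset.mem_coe.1 hv]

theorem DepOn.measurableSet {Λ : Finset Site} {E : Set Config} (h : DepOn ↑Λ E) :
    MeasurableSet E := by
  have : E = Λ.restrict ⁻¹' {f | extendConfig Λ f ∈ E} := by ext ω; exact h.mem_iff ω
  rw [this]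
  exact (Finset.measurable_restrict Λ) (Set.toFinite _).measurableSet

open Classical in
theorem IsBernoulliHalf.measure_eq {μ : Measure Config} (hμ : IsBernoulliHalf μ)
    {Λ : Finset Site} {E : Set Config} (h : DepOn ↑Λ E) :
    μ E = (Finset.univ.filter fun f : Λ → Bool => extendConfig Λ f ∈ E).card * (1 / 2 : ℝ≥0∞) ^ Λ.card := by
  have h1 : E = ⋃ f ∈ Finset.univ.filter (fun f : Λ → Bool => extendConfig Λ f ∈ E),
      (Λ.restrict : Config → Λ → Bool) ⁻¹' {f} := by
    ext ω
    simp only [Finset.mem_filter, Finset.mem_univ, true_and, Set.mem_iUnion, Set.mem_preimage,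
      Set.mem_singleton_iff, exists_prop, exists_eq_right']
    exact h.mem_iff ω
  conv_lhs => rw [h1]
  rw [measure_biUnion_finset]
  · rw [Finset.sum_congr rfl, Finset.sum_const, nsmul_eq_mul]
    intro f _
    rw [← hμ.2 Λ (extendConfig Λ f)]
    congr 1
    ext ω
    simp only [Set.mem_preimage, Set.mem_singleton_iff, Set.mem_ofPred_eq, funext_iff,
      Subtype.forall, Finset.restrict]
    refine forall₂_congr fun v hv => ?_
    simp [extendConfig, hv]
  · intro f _ g _ hfg
    exact Disjoint.preimage _ (by simpa using hfg)
  · intro f _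
    exact (Finset.measurable_restrict Λ) (measurableSet_singleton f)

/-- Critical site percolation measure. -/
noncomputable def perc : Measure Config :=
  Measure.infinitePi fun _ : Site => (PMF.uniformOfFintype Bool).toMeasure

instance : IsProbabilityMeasure perc := by unfold perc; infer_instance

theorem isBernoulliHalf_perc : IsBernoulliHalf perc := by
  refine ⟨inferInstance, fun S f => ?_⟩
  have : {ω : Config | ∀ v ∈ S, ω v = f v} = Set.pi S fun v => {f v} := by
    ext ω; simp [Set.mem_pi]
  rw [this, perc, Measure.infinitePi_pi _ (fun _ _ => measurableSet_singleton _)]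
  rw [Finset.prod_congr rfl, Finset.prod_const]
  intro v _
  rw [PMF.toMeasure_apply_singleton _ _ (measurableSet_singleton _)]
  simp

theorem IsBernoulliHalf.eq_perc {μ : Measure Config} (hμ : IsBernoulliHalf μ) : μ = perc := by
  have := hμ.1
  refine Measure.eq_infinitePi _ fun s t ht => ?_
  have hd : DepOn ↑s (Set.pi s t : Set Config) := by
    intro ω ω' h hω v hv
    rw [← h v hv]; exact hω v hv
  rw [← Measure.infinitePi_pi _ (fun i _ => ht i), hμ.measure_eq hd]
  exact (isBernoulliHalf_perc.measure_eq hd).symm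

/-- Probability of an event. -/
noncomputable def pr (E : Set Config) : ℝ := perc.real E

theorem pr_nonneg (E : Set Config) : 0 ≤ pr E := measureReal_nonneg

theorem pr_le_one (E : Set Config) : pr E ≤ 1 := measureReal_le_one

theorem pr_mono {E F : Set Config} (h : E ⊆ F) : pr E ≤ pr F := measureReal_mono h

theorem pr_union_le (E F : Set Config) : pr (E ∪ F) ≤ pr E + pr F := measureReal_union_le _ _

theorem pr_compl {Λ : Finset Site} {E : Set Config} (h : DepOn ↑Λ E) : pr Eᶜ = 1 - pr E := by
  have := probReal_compl_eq_one_sub (μ := perc) h.measurableSet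
  exact this

open Classical in
theorem pr_eq_card {Λ : Finset Site} {E : Set Config} (h : DepOn ↑Λ E) :
    pr E = (Finset.univ.filter fun f : Λ → Bool => extendConfig Λ f ∈ E).card * (1 / 2 : ℝ) ^ Λ.card := by
  rw [pr, measureReal_def, IsBernoulliHalf.measure_eq isBernoulliHalf_perc h]
  simp

theorem pr_indep {Λ Λ' : Finset Site} {E F : Set Config} (hE : DepOn ↑Λ E) (hF : DepOn ↑Λ' F)
    (h : Disjoint Λ Λ') : pr (E ∩ F) = pr E * pr F := by
  have hI : iIndepFun (fun (v : Site) (ω : Config) => ω v) perc :=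
    iIndepFun_infinitePi (P := fun _ : Site => (PMF.uniformOfFintype Bool).toMeasure)
      (X := fun _ b => b) (fun _ => measurable_id)
  have := hI.indepFun_finset Λ Λ' h (fun v => measurable_pi_apply v)
  have h2 := this.measure_inter_preimage_eq_mul {f | extendConfig Λ f ∈ E} {f | extendConfig Λ' f ∈ F}
    (Set.toFinite _).measurableSet (Set.toFinite _).measurableSet
  have e1 : E = (fun ω (i : Λ) => ω i) ⁻¹' {f | extendConfig Λ f ∈ E} := by
    ext ω; exact hE.mem_iff ω
  have e2 : F = (fun ω (i : Λ') => ω i) ⁻¹' {f | extendConfig Λ' f ∈ F} := by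
    ext ω; exact hF.mem_iff ω
  rw [← e1, ← e2] at h2
  simp only [pr, measureReal_def, h2, ENNReal.toReal_mul]

open Classical in
/-- Harris' inequality. -/
theorem pr_inter_ge {Λ : Finset Site} {E F : Set Config} (hE : DepOn ↑Λ E) (hF : DepOn ↑Λ F)
    (mE : IsUpperSet E) (mF : IsUpperSet F) : pr E * pr F ≤ pr (E ∩ F) := by
  have mono : ∀ {G : Set Config}, IsUpperSet G →
      Monotone fun f : Λ → Bool => if extendConfig Λ f ∈ G then (1 : ℝ) else 0 := by
    intro G hG f g hfg
    have : extendConfig Λ f ≤ extendConfig Λ g := by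
      intro v; unfold extendConfig; split_ifs with hv
      · exact hfg _
      · exact le_rfl
    dsimp only
    split_ifs with h1 h2 h2
    · exact le_rfl
    · exact absurd (hG this h1) h2
    · exact zero_le_one
    · exact le_rfl
  have key := fkg (α := Λ → Bool) (β := ℝ) (μ := fun _ => 1)
    (f := fun f => if extendConfig Λ f ∈ E then (1 : ℝ) else 0)
    (g := fun f => if extendConfig Λ f ∈ F then (1 : ℝ) else 0) (fun _ => zero_le_one)
    (fun f => by dsimp only; split_ifs <;> simp) (fun f => by dsimp only; split_ifs <;> simp)
    (mono mE) (mono mF) (fun _ _ => le_rfl)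
  have hEF : ∀ f : Λ → Bool, (if extendConfig Λ f ∈ E then (1 : ℝ) else 0) *
      (if extendConfig Λ f ∈ F then (1 : ℝ) else 0) = if extendConfig Λ f ∈ E ∩ F then (1 : ℝ) else 0 := by
    intro f; by_cases extendConfig Λ f ∈ E <;> by_cases extendConfig Λ f ∈ F <;> simp_all
  simp only [hEF, one_mul, Finset.sum_boole] at key
  rw [pr_eq_card hE, pr_eq_card hF, pr_eq_card (hE.inter hF)]
  rw [show (∑ _f : Λ → Bool, (1 : ℝ)) = 2 ^ Λ.card by simp] at key
  have h2 : (0 : ℝ) < (1 / 2) ^ Λ.card := by positivity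
  have h3 : (2 : ℝ) ^ Λ.card * (1 / 2) ^ Λ.card = 1 := by rw [← mul_pow]; norm_num
  generalize (1 / 2 : ℝ) ^ Λ.card = p at *
  have aux : ∀ a b c : ℝ, a * b ≤ 2 ^ Λ.card * c → a * p * (b * p) ≤ c * p := by
    intro a b c h
    have := mul_le_mul_of_nonneg_right h (mul_nonneg h2.le h2.le)
    linear_combination this + c * p * h3
  convert aux _ _ _ key
  rfl

theorem pr_cylinder (S : Finset Site) (f : Config) :
    pr {ω | ∀ v ∈ S, ω v = f v} = (1 / 2 : ℝ) ^ S.card := by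
  rw [pr, measureReal_def, isBernoulliHalf_perc.2]; simp

theorem pr_map_equiv (φ : Site ≃ Site) {Λ : Finset Site} {E : Set Config} (hE : DepOn ↑Λ E) :
    pr {ω | (fun v => ω (φ v)) ∈ E} = pr E := by
  have hm : Measurable fun (ω : Config) v => ω (φ v) :=
    measurable_pi_lambda _ fun v => measurable_pi_apply _
  have hB : IsBernoulliHalf (perc.map fun (ω : Config) v => ω (φ v)) := by
    refine ⟨Measure.isProbabilityMeasure_map hm.aemeasurable, fun S f => ?_⟩
    have hd : DepOn ↑S {ω : Config | ∀ v ∈ S, ω v = f v} :=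
      fun ω ω' h hω v hv => (h v hv).symm.trans (hω v hv)
    rw [Measure.map_apply hm hd.measurableSet]
    have := isBernoulliHalf_perc.2 (S.map φ.toEmbedding) fun v => f (φ.symm v)
    rw [Finset.card_map] at this
    rw [← this]
    congr 1
    ext ω
    simp only [Set.mem_preimage, Set.mem_ofPred_eq, Finset.mem_map_equiv]
    exact ⟨fun h v hv => by simpa using h _ hv, fun h v hv => by simpa using h (φ v) (by simpa using hv)⟩
  have := hB.eq_perc
  conv_rhs => rw [pr, ← this, measureReal_def, Measure.map_apply hm hE.measurableSet]
  rfl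

theorem pr_flip {Λ : Finset Site} {E : Set Config} (hE : DepOn ↑Λ E) :
    pr {ω | (fun v => !ω v) ∈ E} = pr E := by
  have hm : Measurable fun (ω : Config) v => !ω v :=
    measurable_pi_lambda _ fun v => (measurable_of_finite not).comp (measurable_pi_apply v)
  have hB : IsBernoulliHalf (perc.map fun (ω : Config) v => !ω v) := by
    refine ⟨Measure.isProbabilityMeasure_map hm.aemeasurable, fun S f => ?_⟩
    have hd : DepOn ↑S {ω : Config | ∀ v ∈ S, ω v = f v} :=
      fun ω ω' h hω v hv => (h v hv).symm.trans (hω v hv)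
    rw [Measure.map_apply hm hd.measurableSet]
    rw [← isBernoulliHalf_perc.2 S fun v => !f v]
    congr 1
    ext ω
    simp only [Set.mem_preimage, Set.mem_ofPred_eq]
    refine forall₂_congr fun v _ => ?_
    cases ω v <;> cases f v <;> simp
  have := hB.eq_perc
  conv_rhs => rw [pr, ← this, measureReal_def, Measure.map_apply hm hE.measurableSet]
  rfl

theorem pr_sum_le_of_disjoint {ι : Type*} (s : Finset ι) {E : ι → Set Config} {G : Set Config}
    (hm : ∀ i ∈ s, MeasurableSet (E i)) (hd : ∀ i ∈ s, ∀ j ∈ s, i ≠ j → Disjoint (E i) (E j))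
    (hG : ∀ i ∈ s, E i ⊆ G) : ∑ i ∈ s, pr (E i) ≤ pr G := by
  unfold pr
  rw [← measureReal_biUnion_finset (fun i hi j hj hij => hd i hi j hj hij) hm]
  exact measureReal_mono (Set.iUnion₂_subset hG)

theorem pr_le_sum {ι : Type*} (s : Finset ι) {E : ι → Set Config} {G : Set Config}
    (hG : G ⊆ ⋃ i ∈ s, E i) : pr G ≤ ∑ i ∈ s, pr (E i) :=
  (measureReal_mono hG (measure_ne_top _ _)).trans (measureReal_biUnion_finset_le s E)

/-- If the number of `E i` that occur is always at most the number of `F j` that occur, the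
expected numbers are ordered. -/
theorem sum_pr_le_sum_pr {ι κ : Type*} (s : Finset ι) (t : Finset κ) {E : ι → Set Config}
    {F : κ → Set Config} (hE : ∀ i ∈ s, MeasurableSet (E i)) (hF : ∀ j ∈ t, MeasurableSet (F j))
    (h : ∀ ω, ∑ i ∈ s, (E i).indicator (1 : Config → ℝ≥0∞) ω ≤
      ∑ j ∈ t, (F j).indicator (1 : Config → ℝ≥0∞) ω) :
    ∑ i ∈ s, pr (E i) ≤ ∑ j ∈ t, pr (F j) := by
  have key : ∀ {κ : Type _} (t : Finset κ) {F : κ → Set Config},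
      (∀ j ∈ t, MeasurableSet (F j)) →
      ∫⁻ ω, ∑ j ∈ t, (F j).indicator (1 : Config → ℝ≥0∞) ω ∂perc = ∑ j ∈ t, perc (F j) := by
    intro κ t F hF
    rw [lintegral_finsetSum t fun j hj => measurable_one.indicator (hF j hj)]
    exact Finset.sum_congr rfl fun j hj => lintegral_indicator_one (hF j hj)
  have h1 := lintegral_mono (μ := perc) h
  rw [key t hF] at h1
  rw [show ∫⁻ ω, ∑ i ∈ s, (E i).indicator (1 : Config → ℝ≥0∞) ω ∂perc = ∑ i ∈ s, perc (E i) by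
    rw [lintegral_finsetSum s fun j hj => measurable_one.indicator (hE j hj)]
    exact Finset.sum_congr rfl fun j hj => lintegral_indicator_one (hE j hj)] at h1
  simp only [pr, measureReal_def]
  rw [← ENNReal.toReal_sum fun i _ => measure_ne_top _ _,
    ← ENNReal.toReal_sum fun i _ => measure_ne_top _ _]
  exact ENNReal.toReal_mono (ENNReal.sum_ne_top.2 fun i _ => measure_ne_top _ _) h1

end Prob

section Clusters

theorem DepOn.toFinset {D : Set Site} {E : Set Config} (h : DepOn D E) (hD : D.Finite) :
    DepOn ↑hD.toFinset E := by simpa using h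

theorem DepOn.measurable {D : Set Site} {E : Set Config} (h : DepOn D E) (hD : D.Finite) :
    MeasurableSet E := (h.toFinset hD).measurableSet

theorem pr_inter_of_disjoint {D D' : Set Site} {E F : Set Config} (hD : D.Finite) (hD' : D'.Finite)
    (hE : DepOn D E) (hF : DepOn D' F) (h : Disjoint D D') : pr (E ∩ F) = pr E * pr F :=
  pr_indep (hE.toFinset hD) (hF.toFinset hD') (by simpa [Set.Finite.disjoint_toFinset] using h)

theorem pr_inter_of_upper {D : Set Site} {E F : Set Config} (hD : D.Finite)
    (hE : DepOn D E) (hF : DepOn D F) (mE : IsUpperSet E) (mF : IsUpperSet F) :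
    pr E * pr F ≤ pr (E ∩ F) :=
  pr_inter_ge (hE.toFinset hD) (hF.toFinset hD) mE mF

/-- There is a walk of colour `b` in `D` from `I` to `J`. -/
def Link (b : Bool) (D I J : Set Site) : Set Config :=
  {ω | ∃ s ∈ I, ∃ t ∈ J, Walk (D ∩ {v | ω v = b}) s t}

theorem Walk.congr_config {b : Bool} {D : Set Site} {ω ω' : Config} {s t : Site}
    (w : Walk (D ∩ {v | ω v = b}) s t) (h : ∀ v ∈ D, ω v = ω' v) :
    Walk (D ∩ {v | ω' v = b}) s t :=
  w.mono fun v hv => ⟨hv.1, (h v hv.1).symm.trans hv.2⟩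

theorem Link.depOn (b : Bool) (D I J : Set Site) : DepOn D (Link b D I J) := by
  rintro ω ω' h ⟨s, hs, t, ht, w⟩
  exact ⟨s, hs, t, ht, w.congr_config h⟩

theorem Link.mono {b : Bool} {D I J D' I' J' : Set Site} (hD : D ⊆ D') (hI : ∀ v ∈ D, v ∈ I → v ∈ I')
    (hJ : ∀ v ∈ D, v ∈ J → v ∈ J') : Link b D I J ⊆ Link b D' I' J' := by
  rintro ω ⟨s, hs, t, ht, w⟩
  exact ⟨s, hI s w.start_mem.1 hs, t, hJ t w.end_mem.1 ht, w.mono fun v hv => ⟨hD hv.1, hv.2⟩⟩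

theorem Link.symm {b : Bool} {D I J : Set Site} {ω : Config} (h : ω ∈ Link b D I J) :
    ω ∈ Link b D J I := by
  obtain ⟨s, hs, t, ht, w⟩ := h
  exact ⟨t, ht, s, hs, w.symm⟩

theorem Link.upper (D I J : Set Site) : IsUpperSet (Link true D I J) := by
  rintro ω ω' h ⟨s, hs, t, ht, w⟩
  refine ⟨s, hs, t, ht, w.mono fun v hv => ⟨hv.1, ?_⟩⟩
  have := h v
  have h2 : ω v = true := hv.2
  rw [h2] at this
  exact top_le_iff.1 this

theorem pr_link_flip {b : Bool} {D I J : Set Site} (hD : D.Finite) :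
    pr (Link b D I J) = pr (Link (!b) D I J) := by
  rw [← pr_flip ((Link.depOn b D I J).toFinset hD)]
  congr 1
  simp [Link]

theorem pr_link_bool (b b' : Bool) {D I J : Set Site} (hD : D.Finite) :
    pr (Link b D I J) = pr (Link b' D I J) := by
  rcases Bool.eq_or_eq_not b b' with rfl | rfl
  · rfl
  · rw [pr_link_flip hD, Bool.not_not]

theorem pr_link_map (φ : Site ≃ Site) (hφ : ∀ a b, Adj a b → Adj (φ a) (φ b)) {b : Bool}
    {D I J D' I' J' : Set Site} (hf : D.Finite) (hD : ∀ v ∈ D, φ v ∈ D')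
    (hI : ∀ v ∈ D, v ∈ I → φ v ∈ I') (hJ : ∀ v ∈ D, v ∈ J → φ v ∈ J') :
    pr (Link b D I J) ≤ pr (Link b D' I' J') := by
  rw [← pr_map_equiv φ ((Link.depOn b D I J).toFinset hf)]
  apply pr_mono
  rintro ω ⟨s, hs, t, ht, w⟩
  exact ⟨φ s, hI s w.start_mem.1 hs, φ t, hJ t w.end_mem.1 ht,
    w.map hφ fun v hv => ⟨hD v hv.1, hv.2⟩⟩

/-- Harris' inequality for two links of the same colour. -/
theorem pr_link_inter {b : Bool} {D I J D' I' J' : Set Site} (hD : D.Finite) (hD' : D'.Finite) :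
    pr (Link b D I J) * pr (Link b D' I' J') ≤ pr (Link b D I J ∩ Link b D' I' J') := by
  have hdep : ∀ b, DepOn (D ∪ D') (Link b D I J ∩ Link b D' I' J') := fun b =>
    ((Link.depOn b D I J).mono Set.subset_union_left).inter
      ((Link.depOn b D' I' J').mono Set.subset_union_right)
  have h1 : pr (Link true D I J) * pr (Link true D' I' J') ≤
      pr (Link true D I J ∩ Link true D' I' J') :=
    pr_inter_of_upper (hD.union hD') ((Link.depOn _ D I J).mono Set.subset_union_left)
      ((Link.depOn _ D' I' J').mono Set.subset_union_right) (Link.upper _ _ _) (Link.upper _ _ _)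
  cases b
  · rw [← pr_flip ((hdep false).toFinset (hD.union hD')), pr_link_bool false true hD,
      pr_link_bool false true hD']
    convert h1 using 2
    ext ω
    have : {v | (!ω v) = false} = {v | ω v = true} := by ext v; simp
    simp [Link]
  · exact h1

/-- The sites joined to `I` by walks of colour `b` in `D`. -/
def cluster (b : Bool) (D I : Set Site) (ω : Config) : Set Site :=
  {v | ∃ s ∈ I, Walk (D ∩ {v | ω v = b}) s v}

/-- The sites explored when the cluster of `I` in `D` is found to be `S`. -/
def explored (D I S : Set Site) : Set Site := S ∪ {v ∈ D | v ∈ I ∨ ∃ a ∈ S, Adj a v}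

theorem cluster_subset (b : Bool) (D I : Set Site) (ω : Config) : cluster b D I ω ⊆ D := by
  rintro v ⟨s, _, w⟩
  exact w.end_mem.1

theorem cluster_color {b : Bool} {D I : Set Site} {ω : Config} {v : Site}
    (h : v ∈ cluster b D I ω) : ω v = b := by
  obtain ⟨s, _, w⟩ := h
  exact w.end_mem.2

theorem cluster_step {b : Bool} {D I : Set Site} {ω : Config} {v u : Site}
    (h : v ∈ cluster b D I ω) (e : Adj v u) (hu : u ∈ D) (hb : ω u = b) :
    u ∈ cluster b D I ω := by
  obtain ⟨s, hs, w⟩ := h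
  exact ⟨s, hs, w.snoc e ⟨hu, hb⟩⟩

theorem cluster_seed {b : Bool} {D I : Set Site} {ω : Config} {v : Site}
    (h : v ∈ I) (hu : v ∈ D) (hb : ω v = b) : v ∈ cluster b D I ω :=
  ⟨v, h, .refl ⟨hu, hb⟩⟩

theorem cluster_walk {b : Bool} {D I : Set Site} {ω : Config} {v : Site}
    (h : v ∈ cluster b D I ω) : ∃ s ∈ I, Walk (cluster b D I ω) s v := by
  obtain ⟨s, hs, w⟩ := h
  refine ⟨s, hs, (w.inter_of_closed (P := cluster b D I ω) ?_ ?_).mono Set.inter_subset_right⟩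
  · exact ⟨s, hs, .refl w.start_mem⟩
  · intro a ha _ c hc e
    exact cluster_step ha e hc.1 hc.2

theorem explored_color {b : Bool} {D I : Set Site} {ω : Config} {v : Site}
    (h : v ∈ explored D I (cluster b D I ω)) (hv : v ∉ cluster b D I ω) : ω v = !b := by
  rcases h with h | ⟨hD, h⟩
  · exact absurd h hv
  · by_contra hc
    have hb : ω v = b := by cases hb : ω v <;> cases b <;> simp_all
    rcases h with h | ⟨a, ha, e⟩
    · exact hv (cluster_seed h hD hb)
    · exact hv (cluster_step ha e hD hb)

theorem explored_subset {b : Bool} {D I : Set Site} {ω : Config} :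
    explored D I (cluster b D I ω) ⊆ D := by
  rintro v (h | h)
  · exact cluster_subset _ _ _ _ h
  · exact h.1

theorem cluster_depOn (b : Bool) (D I S : Set Site) :
    DepOn (explored D I S) {ω | cluster b D I ω = S} := by
  intro ω ω' h hS
  simp only [Set.mem_ofPred_eq] at hS ⊢
  have hc : ∀ v ∈ S, ω v = b := fun v hv => cluster_color (hS ▸ hv)
  apply Set.Subset.antisymm
  · rintro v ⟨s, hs, w⟩
    have hsS : s ∈ S := by
      have := w.start_mem
      rw [← hS]
      refine cluster_seed hs this.1 ?_
      rw [h s (Or.inr ⟨this.1, Or.inl hs⟩)]; exact this.2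
    refine ((w.inter_of_closed hsS ?_).end_mem).2
    intro a ha _ c hc e
    rw [← hS] at ha ⊢
    refine cluster_step ha e hc.1 ?_
    rw [h c (Or.inr ⟨hc.1, Or.inr ⟨a, hS ▸ ha, e⟩⟩)]; exact hc.2
  · intro v hv
    rw [← hS] at hv
    obtain ⟨s, hs, w⟩ := cluster_walk hv
    refine ⟨s, hs, w.mono fun u hu => ⟨cluster_subset _ _ _ _ hu, ?_⟩⟩
    rw [hS] at hu
    change ω' u = b
    rw [← h u (Or.inl hu)]; exact hc u hu

/-- Conditioning on an explored cluster. -/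
theorem explore {b : Bool} {D I : Set Site} (hD : D.Finite) {good : Set (Set Site)}
    {F : Set Site → Set Config} {Y : Set Site → Set Site} {G : Set Config} {c : ℝ} (hc0 : 0 ≤ c)
    (hF : ∀ ω, cluster b D I ω ∈ good →
      (Y (cluster b D I ω)).Finite ∧ DepOn (Y (cluster b D I ω)) (F (cluster b D I ω)) ∧
      Disjoint (explored D I (cluster b D I ω)) (Y (cluster b D I ω)) ∧
      c ≤ pr (F (cluster b D I ω)))
    (hG : ∀ ω, cluster b D I ω ∈ good → ω ∈ F (cluster b D I ω) → ω ∈ G) :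
    c * pr {ω | cluster b D I ω ∈ good} ≤ pr G := by
  classical
  set 𝒮 := hD.finite_subsets.toFinset.filter fun S => S ∈ good ∧ ∃ ω, cluster b D I ω = S with h𝒮
  have hmem : ∀ S ∈ 𝒮, S ∈ good ∧ ∃ ω, cluster b D I ω = S := by
    intro S hS; simp only [h𝒮, Finset.mem_filter] at hS; exact hS.2
  have hfin : ∀ S ∈ 𝒮, (explored D I S).Finite := by
    intro S hS
    obtain ⟨_, ω, rfl⟩ := hmem S hS
    exact hD.subset explored_subset
  calc c * pr {ω | cluster b D I ω ∈ good}
      ≤ c * ∑ S ∈ 𝒮, pr {ω | cluster b D I ω = S} := by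
        refine mul_le_mul_of_nonneg_left (pr_le_sum _ ?_) hc0
        intro ω hω
        simp only [Set.mem_iUnion]
        refine ⟨cluster b D I ω, ?_, rfl⟩
        simp only [h𝒮, Finset.mem_filter, Set.Finite.mem_toFinset]
        exact ⟨cluster_subset _ _ _ _, hω, ω, rfl⟩
    _ = ∑ S ∈ 𝒮, pr {ω | cluster b D I ω = S} * c := by rw [mul_comm, Finset.sum_mul]
    _ ≤ ∑ S ∈ 𝒮, pr ({ω | cluster b D I ω = S} ∩ F S) := by
        refine Finset.sum_le_sum fun S hS => ?_
        have hf := hfin S hS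
        obtain ⟨hg, ω, rfl⟩ := hmem S hS
        obtain ⟨h1, h2, h3, h4⟩ := hF ω hg
        rw [pr_inter_of_disjoint hf h1 (cluster_depOn _ _ _ _) h2 h3]
        exact mul_le_mul_of_nonneg_left h4 (pr_nonneg _)
    _ ≤ pr G := by
        refine pr_sum_le_of_disjoint _ ?_ ?_ ?_
        · intro S hS
          have hf := hfin S hS
          obtain ⟨hg, ω, rfl⟩ := hmem S hS
          obtain ⟨h1, h2, _⟩ := hF ω hg
          exact ((cluster_depOn _ _ _ _).measurable hf).inter (h2.measurable h1)
        · intro S _ S' _ hne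
          rw [Set.disjoint_left]
          rintro ω ⟨h1, _⟩ ⟨h2, _⟩
          exact hne (h1.symm.trans h2)
        · rintro S hS ω ⟨h1, h2⟩
          obtain rfl : cluster b D I ω = S := h1
          exact hG ω (hmem _ hS).1 h2

/-- There are `s` sites of `I` lying in distinct clusters of colour `b` in `D`, all of
which reach `J`. -/
def manyClusters (b : Bool) (D J I : Set Site) (s : ℕ) : Set Config :=
  {ω | ∃ T : Finset Site, T.card = s ∧ (∀ i ∈ T, i ∈ I) ∧
    (∀ i ∈ T, ∃ j ∈ J, Walk (D ∩ {v | ω v = b}) i j) ∧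
    ∀ i ∈ T, ∀ i' ∈ T, i ≠ i' → ¬ Walk (D ∩ {v | ω v = b}) i i'}

theorem manyClusters_depOn (b : Bool) (D J I : Set Site) (s : ℕ) :
    DepOn D (manyClusters b D J I s) := by
  rintro ω ω' h ⟨T, h1, h2, h3, h4⟩
  refine ⟨T, h1, h2, ?_, ?_⟩
  · intro i hi
    obtain ⟨j, hj, w⟩ := h3 i hi
    exact ⟨j, hj, w.congr_config h⟩
  · intro i hi i' hi' hne w
    exact h4 i hi i' hi' hne (w.congr_config fun v hv => (h v hv).symm)

theorem Walk.avoid_cluster {b : Bool} {D I : Set Site} {ω : Config} {s t : Site}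
    (w : Walk (D ∩ {v | ω v = b}) s t) (hs : s ∉ cluster b D I ω) :
    Walk ((D \ explored D I (cluster b D I ω)) ∩ {v | ω v = b}) s t := by
  refine (w.inter_of_closed (P := (cluster b D I ω)ᶜ) hs ?_).mono ?_
  · intro a ha ha' c hc e h
    exact ha (cluster_step h e.symm ha'.1 ha'.2)
  · rintro v ⟨⟨h1, h2⟩, h3⟩
    refine ⟨⟨h1, fun h => ?_⟩, h2⟩
    have h4 := explored_color h h3
    have h5 : ω v = b := h2
    rw [h5] at h4; cases b <;> simp at h4

end Clusters

section Counting

theorem manyClusters_step {b : Bool} {D J : Set Site} {i₀ : Site} {I : Set Site} {s : ℕ}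
    {ω : Config} (h : ω ∈ manyClusters b D J (insert i₀ I) (s + 1)) :
    ω ∈ manyClusters b (D \ explored D {i₀} (cluster b D {i₀} ω)) J I
      (open Classical in if (cluster b D {i₀} ω ∩ J).Nonempty then s else s + 1) := by
  classical
  obtain ⟨T, h1, h2, h3, h4⟩ := h
  set S := cluster b D {i₀} ω with hS
  have main : ∀ T' ⊆ T, (∀ i ∈ T', i ∉ S) →
      ω ∈ manyClusters b (D \ explored D {i₀} S) J I T'.card := by
    intro T' hT' hn
    refine ⟨T', rfl, ?_, ?_, ?_⟩
    · intro i hi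
      rcases h2 i (hT' hi) with rfl | h
      · obtain ⟨j, _, w⟩ := h3 _ (hT' hi)
        exact absurd (cluster_seed (Set.mem_singleton _) w.start_mem.1 w.start_mem.2) (hn _ hi)
      · exact h
    · intro i hi
      obtain ⟨j, hj, w⟩ := h3 i (hT' hi)
      exact ⟨j, hj, w.avoid_cluster (hn i hi)⟩
    · intro i hi i' hi' hne w
      exact h4 i (hT' hi) i' (hT' hi') hne (w.mono fun v hv => ⟨hv.1.1, hv.2⟩)
  have sub : ∀ i ∈ T, i ∈ S → ∀ i' ∈ T, i' ∈ S → i = i' := by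
    rintro i hi ⟨_, rfl, w⟩ i' hi' ⟨_, rfl, w'⟩
    by_contra hne
    exact h4 i hi i' hi' hne (w.symm.trans w')
  by_cases hex : ∃ i ∈ T, i ∈ S
  · obtain ⟨i, hi, hiS⟩ := hex
    obtain ⟨j, hj, w⟩ := h3 i hi
    have hjS : j ∈ S := by
      obtain ⟨_, rfl, w'⟩ := hiS
      exact ⟨_, rfl, w'.trans w⟩
    rw [if_pos ⟨j, hjS, hj⟩]
    have := main (T.erase i) (Finset.erase_subset _ _) (by
      intro i' hi' h
      exact (Finset.mem_erase.1 hi').1 (sub i' (Finset.mem_of_mem_erase hi') h i hi hiS))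
    rwa [Finset.card_erase_of_mem hi, h1] at this
  · push Not at hex
    split_ifs with hne
    · obtain ⟨i, hi⟩ : T.Nonempty := by rw [← Finset.card_pos]; omega
      have := main (T.erase i) (Finset.erase_subset _ _)
        fun i' hi' => hex i' (Finset.mem_of_mem_erase hi')
      rwa [Finset.card_erase_of_mem hi, h1] at this
    · have := main T subset_rfl hex
      rwa [h1] at this

theorem pr_manyClusters_le (b : Bool) (J : Set Site) (I : Finset Site) :
    ∀ (D : Set Site) (s : ℕ), D.Finite → pr (manyClusters b D J I s) ≤ pr (Link b D I J) ^ s := by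
  classical
  induction I using Finset.induction_on with
  | empty =>
    intro D s _
    rcases Nat.eq_zero_or_pos s with rfl | hs
    · simpa using pr_le_one _
    · have : manyClusters b D J (↑(∅ : Finset Site)) s = ∅ := by
        ext ω
        simp only [Set.mem_empty_iff_false, iff_false]
        rintro ⟨T, h1, h2, _⟩
        obtain ⟨i, hi⟩ : T.Nonempty := by rw [← Finset.card_pos]; omega
        simpa using h2 i hi
      rw [this]
      simp [pr]
  | insert i₀ I _ ih =>
    intro D s hD
    rcases Nat.eq_zero_or_pos s with rfl | hs
    · simpa using pr_le_one _
    obtain ⟨s, rfl⟩ : ∃ s', s = s' + 1 := ⟨s - 1, by omega⟩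
    set lam := pr (Link b D ↑(insert i₀ I) J) with hlam
    have hl0 : 0 ≤ lam := pr_nonneg _
    set 𝒮 := hD.finite_subsets.toFinset with h𝒮
    let A : Set Site → Set Config := fun S => {ω | cluster b D {i₀} ω = S}
    let Y : Set Site → Set Site := fun S => D \ explored D {i₀} S
    let K : Set Site → Set Config := fun S =>
      manyClusters b (Y S) J I (if (S ∩ J).Nonempty then s else s + 1)
    let G : Set Site → Set Config := fun S =>
      if (S ∩ J).Nonempty then Set.univ else Link b (Y S) I J
    have hA : ∀ S ∈ 𝒮, DepOn (explored D {i₀} S) (A S) := fun S _ => cluster_depOn _ _ _ _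
    have hX : ∀ S ∈ 𝒮, (explored D {i₀} S).Finite := by
      intro S hS
      have : S ⊆ D := by simpa [h𝒮] using hS
      exact hD.subset (Set.union_subset this (Set.sep_subset _ _))
    have hY : ∀ S, (Y S).Finite := fun S => hD.subset Set.sdiff_subset
    have hdisj : ∀ S, Disjoint (explored D {i₀} S) (Y S) := fun S => Set.disjoint_sdiff_right
    have hGd : ∀ S, DepOn (Y S) (G S) := by
      intro S
      simp only [G]
      split_ifs
      · intro _ _ _ _; trivial
      · exact Link.depOn _ _ _ _
    have hK : ∀ S ∈ 𝒮, pr (K S) ≤ lam ^ s * pr (G S) := by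
      intro S hS
      have h1 := ih (Y S) (if (S ∩ J).Nonempty then s else s + 1) (hY S)
      have h2 : pr (Link b (Y S) I J) ≤ lam :=
        pr_mono (Link.mono Set.sdiff_subset (fun v _ hv => by simp at hv ⊢; exact Or.inr hv)
          fun _ _ => id)
      refine h1.trans ?_
      simp only [G]
      split_ifs
      · have : pr Set.univ = 1 := by simp [pr]
        rw [this, mul_one]
        exact pow_le_pow_left₀ (pr_nonneg _) h2 s
      · rw [pow_succ]
        exact mul_le_mul_of_nonneg_right (pow_le_pow_left₀ (pr_nonneg _) h2 s) (pr_nonneg _)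
    calc pr (manyClusters b D J ↑(insert i₀ I) (s + 1))
        ≤ ∑ S ∈ 𝒮, pr (A S ∩ K S) := by
          apply pr_le_sum
          intro ω hω
          simp only [Set.mem_iUnion]
          refine ⟨cluster b D {i₀} ω, ?_, rfl, ?_⟩
          · simpa [h𝒮] using cluster_subset _ _ _ _
          · rw [Finset.coe_insert] at hω
            simpa only [K, Y] using manyClusters_step hω
      _ ≤ ∑ S ∈ 𝒮, lam ^ s * pr (A S ∩ G S) := by
          refine Finset.sum_le_sum fun S hS => ?_
          rw [pr_inter_of_disjoint (hX S hS) (hY S) (hA S hS) (manyClusters_depOn _ _ _ _ _)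
            (hdisj S), pr_inter_of_disjoint (hX S hS) (hY S) (hA S hS) (hGd S) (hdisj S)]
          calc _ ≤ pr (A S) * (lam ^ s * pr (G S)) :=
                mul_le_mul_of_nonneg_left (hK S hS) (pr_nonneg _)
            _ = _ := by ring
      _ = lam ^ s * ∑ S ∈ 𝒮, pr (A S ∩ G S) := by rw [Finset.mul_sum]
      _ ≤ lam ^ s * lam := by
          refine mul_le_mul_of_nonneg_left ?_ (pow_nonneg hl0 s)
          refine pr_sum_le_of_disjoint _ ?_ ?_ ?_
          · intro S hS
            exact ((hA S hS).measurable (hX S hS)).inter ((hGd S).measurable (hY S))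
          · intro S _ S' _ hne
            rw [Set.disjoint_left]
            rintro ω ⟨h1, _⟩ ⟨h2, _⟩
            exact hne (h1.symm.trans h2)
          · rintro S _ ω ⟨h1, h2⟩
            obtain rfl : cluster b D {i₀} ω = S := h1
            simp only [G] at h2
            split_ifs at h2 with hne
            · obtain ⟨j, ⟨_, rfl, w⟩, hj⟩ := hne
              exact ⟨_, by simp, j, hj, w⟩
            · exact Link.mono Set.sdiff_subset (fun v _ hv => by simp at hv ⊢; exact Or.inr hv)
                (fun _ _ => id) h2
      _ = lam ^ (s + 1) := (pow_succ _ _).symm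

/-- If the events `T h` that occur pick sites in distinct clusters reaching `J`, their
expected number is bounded in terms of the probability that some site reaches `J`. -/
theorem sum_pr_le_of_clusters {ι : Type*} (H : Finset ι) {T : ι → Set Config}
    {b : Bool} {D I J : Set Site} (hD : D.Finite) (hI : I.Finite)
    (hT : ∀ h ∈ H, MeasurableSet (T h))
    (hsep : ∀ ω, ∃ f : ι → Site,
      (∀ h ∈ H, ω ∈ T h → f h ∈ I ∧ ∃ j ∈ J, Walk (D ∩ {v | ω v = b}) (f h) j) ∧
      ∀ h ∈ H, ∀ h' ∈ H, ω ∈ T h → ω ∈ T h' → h ≠ h' →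
        ¬ Walk (D ∩ {v | ω v = b}) (f h) (f h'))
    {lam : ℝ} (hlam : pr (Link b D I J) ≤ lam) (hlt : lam < 1) :
    ∑ h ∈ H, pr (T h) ≤ (1 - lam)⁻¹ := by
  classical
  have h0 : 0 ≤ lam := (pr_nonneg _).trans hlam
  have hb : ∀ s, pr (manyClusters b D J I s) ≤ lam ^ s := by
    intro s
    have := pr_manyClusters_le b J hI.toFinset D s hD
    simp only [Set.Finite.coe_toFinset] at this
    exact this.trans (pow_le_pow_left₀ (pr_nonneg _) hlam s)
  calc ∑ h ∈ H, pr (T h) ≤ ∑ s ∈ Finset.range H.card, pr (manyClusters b D J I (s + 1)) := by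
        refine sum_pr_le_sum_pr _ _ hT (fun s _ => (manyClusters_depOn _ _ _ _ _).measurable hD) ?_
        intro ω
        obtain ⟨f, h1, h2⟩ := hsep ω
        set H' := H.filter fun h => ω ∈ T h with hH'
        have e1 : ∑ i ∈ H, (T i).indicator (1 : Config → ℝ≥0∞) ω = H'.card := by
          simp [Set.indicator_apply, hH']
        have hle : H'.card ≤ H.card := Finset.card_filter_le _ _
        have e2 : ∑ s ∈ Finset.range H'.card,
            (manyClusters b D J I (s + 1)).indicator (1 : Config → ℝ≥0∞) ω = H'.card := by
          rw [Finset.sum_congr rfl (g := fun _ => (1 : ℝ≥0∞)), Finset.sum_const, Finset.card_range]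
          · simp
          intro s hs
          rw [Set.indicator_of_mem, Pi.one_apply]
          obtain ⟨H'', hs1, hs2⟩ := Finset.exists_subset_card_eq (n := s + 1) (s := H')
            (by simpa using hs)
          have hm : ∀ h ∈ H'', h ∈ H ∧ ω ∈ T h := fun h hh => by
            simpa [hH'] using hs1 hh
          have inj : Set.InjOn f H'' := by
            intro h hh h' hh' he
            by_contra hne
            refine h2 h (hm h hh).1 h' (hm h' hh').1 (hm h hh).2 (hm h' hh').2 hne ?_
            obtain ⟨_, j, _, w⟩ := h1 h (hm h hh).1 (hm h hh).2
            rw [← he]; exact .refl w.start_mem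
          refine ⟨H''.image f, ?_, ?_, ?_, ?_⟩
          · rw [Finset.card_image_of_injOn inj, hs2]
          · intro i hi
            obtain ⟨h, hh, rfl⟩ := Finset.mem_image.1 hi
            exact (h1 h (hm h hh).1 (hm h hh).2).1
          · intro i hi
            obtain ⟨h, hh, rfl⟩ := Finset.mem_image.1 hi
            exact (h1 h (hm h hh).1 (hm h hh).2).2
          · intro i hi i' hi' hne
            obtain ⟨h, hh, rfl⟩ := Finset.mem_image.1 hi
            obtain ⟨h', hh', rfl⟩ := Finset.mem_image.1 hi'
            exact h2 h (hm h hh).1 h' (hm h' hh').1 (hm h hh).2 (hm h' hh').2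
              fun e => hne (by rw [e])
        rw [e1, ← e2]
        exact Finset.sum_le_sum_of_subset (Finset.range_mono hle)
    _ ≤ ∑ s ∈ Finset.range H.card, lam ^ (s + 1) := Finset.sum_le_sum fun s _ => hb _
    _ ≤ ∑ s ∈ Finset.range H.card, lam ^ s :=
        Finset.sum_le_sum fun s _ => pow_le_pow_of_le_one h0 hlt.le s.le_succ
    _ ≤ (1 - lam)⁻¹ := by
        rw [← tsum_geometric_of_lt_one h0 hlt]
        exact (summable_geometric_of_lt_one h0 hlt).sum_le_tsum _ fun s _ => pow_nonneg h0 s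

end Counting

section Crossings

theorem Walk.cut_le {f : Site → ℤ} (hf : ∀ a b, Adj a b → f b ≤ f a + 1) {A : Set Site}
    {s t : Site} {c : ℤ} (w : Walk A s t) (hs : f s ≤ c) (ht : c ≤ f t) :
    ∃ a, f a = c ∧ Walk (A ∩ {v | f v ≤ c}) s a := by
  by_cases h : f s = c
  · exact ⟨s, h, .refl ⟨w.start_mem, hs⟩⟩
  · obtain ⟨a, b, h1, h2, h3, h4⟩ := w.exit (P := {v | f v < c})
      (lt_of_le_of_ne hs h) (by simpa using ht)
    have h5 := hf _ _ h2
    have h6 : f a < c := h1.end_mem.2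
    have h7 : ¬ f b < c := h3
    have h8 : b ∈ A ∩ {v | f v ≤ c} := ⟨h4.start_mem, show f b ≤ c by omega⟩
    have h9 : Walk (A ∩ {v | f v ≤ c}) s a := h1.mono fun v hv => ⟨hv.1, show f v ≤ c from le_of_lt (show f v < c from hv.2)⟩
    exact ⟨b, by omega, h9.snoc h2 h8⟩

theorem Walk.cut_ge {f : Site → ℤ} (hf : ∀ a b, Adj a b → f b ≤ f a + 1) {A : Set Site}
    {s t : Site} {c : ℤ} (w : Walk A s t) (hs : f s ≤ c) (ht : c ≤ f t) :
    ∃ a, f a = c ∧ Walk (A ∩ {v | c ≤ f v}) a t := by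
  obtain ⟨a, h1, h2⟩ := w.symm.cut_le (f := fun v => - f v) (c := -c)
    (fun a b h => by have := hf _ _ h.symm; omega) (by omega) (by omega)
  refine ⟨a, by omega, (h2.symm).mono fun v hv => ⟨hv.1, ?_⟩⟩
  have : - f v ≤ - c := hv.2
  change c ≤ f v
  omega

/-- A left-right walk and a top-bottom walk meet, after a change of coordinates. -/
theorem cross_map {φ : Site → Site} (hφ : ∀ a b, Adj a b → Adj (φ a) (φ b))
    (hi : Function.Injective φ) {x₀ x₁ y₀ y₁ : ℤ} {A B : Set Site} {s t u v : Site}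
    (hA : ∀ z ∈ A, φ z ∈ rect x₀ x₁ y₀ y₁) (hB : ∀ z ∈ B, φ z ∈ rect x₀ x₁ y₀ y₁)
    (w : Walk A s t) (w' : Walk B u v) (hs : (φ s).1 = x₀) (ht : (φ t).1 = x₁)
    (hu : (φ u).2 = y₁) (hv : (φ v).2 = y₀) : ∃ z, z ∈ A ∧ z ∈ B := by
  obtain ⟨z, ⟨a, ha, rfl⟩, b, hb, e⟩ := rect_cross (A := φ '' A) (B := φ '' B)
    (by rintro _ ⟨z, hz, rfl⟩; exact hA z hz) (by rintro _ ⟨z, hz, rfl⟩; exact hB z hz)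
    (w.map hφ fun v hv => ⟨v, hv, rfl⟩) (w'.map hφ fun v hv => ⟨v, hv, rfl⟩) hs ht hu hv
  exact ⟨a, ha, hi e ▸ hb⟩

/-- Every site visited by a walk is joined to its endpoints along the walk. -/
theorem Walk.exists_support {A : Set Site} {s t : Site} (w : Walk A s t) :
    ∃ B ⊆ A, Walk B s t ∧ ∀ z ∈ B, Walk A s z ∧ Walk A z t := by
  refine ⟨A ∩ {z | Walk A s z}, Set.inter_subset_left, ?_, ?_⟩
  · refine w.inter_of_closed (.refl w.start_mem) ?_
    intro a ha _ b hb e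
    exact Walk.snoc ha e hb
  · rintro z ⟨_, hz⟩
    exact ⟨hz, hz.symm.trans w⟩

theorem rect_finite (x₀ x₁ y₀ y₁ : ℤ) : (rect x₀ x₁ y₀ y₁).Finite :=
  ((Set.finite_Icc x₀ x₁).prod (Set.finite_Icc y₀ y₁)).subset
    fun _ h => ⟨⟨h.1, h.2.1⟩, h.2.2.1, h.2.2.2⟩

def shift (a b : ℤ) : Site ≃ Site where
  toFun v := (v.1 + a, v.2 + b)
  invFun v := (v.1 - a, v.2 - b)
  left_inv v := by ext <;> simp
  right_inv v := by ext <;> simp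

/-- The reflection exchanging the two coordinates. -/
def swap : Site ≃ Site where
  toFun v := (v.2, v.1)
  invFun v := (v.2, v.1)
  left_inv _ := rfl
  right_inv _ := rfl

/-- The reflection fixing the column `0`. -/
def mirror : Site ≃ Site where
  toFun v := (-v.1, v.1 + v.2)
  invFun v := (-v.1, v.1 + v.2)
  left_inv v := by ext <;> simp
  right_inv v := by ext <;> simp

theorem adj_shift (a b : ℤ) (u v : Site) (h : Adj u v) : Adj (shift a b u) (shift a b v) := by
  rw [adj_iff] at *; simp only [shift, Equiv.coe_fn_mk]; omega

theorem adj_swap (u v : Site) (h : Adj u v) : Adj (swap u) (swap v) := by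
  rw [adj_iff] at *; simp only [swap, Equiv.coe_fn_mk]; omega

theorem adj_mirror (u v : Site) (h : Adj u v) : Adj (mirror u) (mirror v) := by
  rw [adj_iff] at *; simp only [mirror, Equiv.coe_fn_mk]; omega

def LR (b : Bool) (x₀ x₁ y₀ y₁ : ℤ) : Set Config :=
  Link b (rect x₀ x₁ y₀ y₁) {v | v.1 = x₀} {v | v.1 = x₁}

def TB (b : Bool) (x₀ x₁ y₀ y₁ : ℤ) : Set Config :=
  Link b (rect x₀ x₁ y₀ y₁) {v | v.2 = y₁} {v | v.2 = y₀}

theorem pr_TB (b : Bool) (x₀ x₁ y₀ y₁ : ℤ) : pr (TB b x₀ x₁ y₀ y₁) = pr (LR b y₀ y₁ x₀ x₁) := by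
  have hs : ∀ {D I J : Set Site}, Link b D I J = Link b D J I :=
    Set.Subset.antisymm (fun _ => Link.symm) fun _ => Link.symm
  apply le_antisymm
  · unfold TB
    rw [hs]
    exact pr_link_map swap adj_swap (rect_finite _ _ _ _)
      (fun v hv => ⟨hv.2.2.1, hv.2.2.2, hv.1, hv.2.1⟩) (fun _ _ h => h) fun _ _ h => h
  · unfold TB
    rw [hs (I := {v | v.2 = y₁})]
    exact pr_link_map swap adj_swap (rect_finite _ _ _ _)
      (fun v hv => ⟨hv.2.2.1, hv.2.2.2, hv.1, hv.2.1⟩) (fun _ _ h => h) fun _ _ h => h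

theorem LR_or_TB {x₀ x₁ y₀ y₁ : ℤ} (hx : x₀ ≤ x₁) (hy : y₀ ≤ y₁) (b : Bool) (ω : Config) :
    ω ∈ LR b x₀ x₁ y₀ y₁ ∨ ω ∈ TB (!b) x₀ x₁ y₀ y₁ := by
  have e : {v | ω v = b}ᶜ = {v | ω v = !b} := by
    ext v; cases h : ω v <;> cases b <;> simp [h]
  rcases hex_rect hx hy {v | ω v = b} with ⟨s, t, w, h1, h2⟩ | ⟨s, t, w, h1, h2⟩
  · exact Or.inl ⟨s, h1, t, h2, w⟩
  · rw [e] at w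
    exact Or.inr ⟨s, h1, t, h2, w⟩

theorem LR_not_TB {x₀ x₁ y₀ y₁ : ℤ} {b : Bool} {ω : Config} (h : ω ∈ LR b x₀ x₁ y₀ y₁) :
    ω ∉ TB (!b) x₀ x₁ y₀ y₁ := by
  rintro ⟨u, hu, v, hv, w'⟩
  obtain ⟨s, hs, t, ht, w⟩ := h
  obtain ⟨z, h1, h2⟩ := rect_cross Set.inter_subset_left Set.inter_subset_left w w' hs ht hu hv
  have h3 : ω z = b := h1.2
  have h4 : ω z = !b := h2.2
  rw [h3] at h4; cases b <;> simp at h4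

theorem pr_LR_square (b : Bool) (x₀ y₀ : ℤ) {n : ℤ} (hn : 0 ≤ n) :
    pr (LR b x₀ (x₀ + n) y₀ (y₀ + n)) = 1 / 2 := by
  have hc : (LR b x₀ (x₀ + n) y₀ (y₀ + n))ᶜ = TB (!b) x₀ (x₀ + n) y₀ (y₀ + n) := by
    ext ω
    exact ⟨fun h => (LR_or_TB (by omega) (by omega) b ω).resolve_left h,
      fun h h' => LR_not_TB h' h⟩
  have hf := rect_finite x₀ (x₀ + n) y₀ (y₀ + n)
  have hd : DepOn (rect x₀ (x₀ + n) y₀ (y₀ + n)) (LR b x₀ (x₀ + n) y₀ (y₀ + n)) :=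
    Link.depOn _ _ _ _
  have h1 := pr_compl (hd.toFinset hf)
  have h2 : pr (TB (!b) x₀ (x₀ + n) y₀ (y₀ + n)) = pr (LR b x₀ (x₀ + n) y₀ (y₀ + n)) := by
    rw [pr_TB, LR, pr_link_bool (!b) b (rect_finite _ _ _ _)]
    apply le_antisymm
    · exact pr_link_map (shift (x₀ - y₀) (y₀ - x₀)) (adj_shift _ _) (rect_finite _ _ _ _)
        (fun v hv => by simp only [rect, shift, Equiv.coe_fn_mk, Set.mem_ofPred_eq] at *; omega)
        (fun v _ hv => by simp only [shift, Equiv.coe_fn_mk, Set.mem_ofPred_eq] at *; omega)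
        (fun v _ hv => by simp only [shift, Equiv.coe_fn_mk, Set.mem_ofPred_eq] at *; omega)
    · exact pr_link_map (shift (y₀ - x₀) (x₀ - y₀)) (adj_shift _ _) (rect_finite _ _ _ _)
        (fun v hv => by simp only [rect, shift, Equiv.coe_fn_mk, Set.mem_ofPred_eq] at *; omega)
        (fun v _ hv => by simp only [shift, Equiv.coe_fn_mk, Set.mem_ofPred_eq] at *; omega)
        (fun v _ hv => by simp only [shift, Equiv.coe_fn_mk, Set.mem_ofPred_eq] at *; omega)
  rw [hc, h2] at h1
  linarith

end Crossings

section Chevron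

theorem Curve.below_zero_left {A : Set Site} {s t v : Site} {N M : Site → ZMod 2}
    (c : Curve A s t N M) (h : ∀ p ∈ A, v.1 < p.1) : N v = 0 := by
  induction c with
  | refl _ => rfl
  | @head s m t N M hs e c ih =>
    have hm := c.walk.start_mem
    simp only [Pi.add_apply, ih, add_zero, stepBelow]
    rw [if_neg]
    have := h _ hs; have := h _ hm; omega

theorem Curve.above_zero_right {A : Set Site} {s t v : Site} {N M : Site → ZMod 2}
    (c : Curve A s t N M) (h : ∀ p ∈ A, p.1 < v.1) : M v = 0 := by
  induction c with
  | refl _ => rfl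
  | @head s m t N M hs e c ih =>
    have hm := c.walk.start_mem
    simp only [Pi.add_apply, ih, add_zero, stepAbove]
    rw [if_neg]
    have := h _ hs; have := h _ hm; omega

theorem explored_walk {b : Bool} {D I : Set Site} {ω : Config} {v : Site}
    (h : v ∈ explored D I (cluster b D I ω)) :
    ∃ s ∈ I, s ∈ D ∧ Walk (explored D I (cluster b D I ω)) v s := by
  have key : ∀ u ∈ cluster b D I ω,
      ∃ s ∈ I, s ∈ D ∧ Walk (explored D I (cluster b D I ω)) u s := by
    intro u hu
    obtain ⟨s, hs, w⟩ := cluster_walk hu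
    exact ⟨s, hs, cluster_subset _ _ _ _ w.start_mem, w.symm.mono fun _ => Or.inl⟩
  rcases h with h | ⟨hD, h | ⟨a, ha, e⟩⟩
  · exact key v h
  · exact ⟨v, h, hD, .refl (Or.inr ⟨hD, Or.inl h⟩)⟩
  · obtain ⟨s, hs, hsD, w⟩ := key a ha
    exact ⟨s, hs, hsD, .head (Or.inr ⟨hD, Or.inr ⟨a, ha, e⟩⟩) e.symm w⟩

/-- Two rhombi of side `n` sharing the column `0` and exchanged by `mirror`. -/
def chev (n : ℤ) : Set Site :=
  {v | -n ≤ v.1 ∧ v.1 ≤ n ∧ 0 ≤ v.2 + max v.1 0 ∧ v.2 + max v.1 0 ≤ n}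

theorem chev_finite (n : ℤ) : (chev n).Finite :=
  (rect_finite (-n) n (-n) n).subset fun v hv => by
    simp only [chev, rect, Set.mem_ofPred_eq] at *; omega

def chevFresh (n : ℤ) (X : Set Site) : Set Site := {v ∈ chev n | v ∉ X ∧ mirror v ∉ X}

theorem chev_exclusive {n : ℤ} (hn : 1 ≤ n) {ω₀ ω : Config} {X : Set Site}
    (hX : X = explored (rect (-n) 0 0 n) {v | v.2 = 0}
      (cluster false (rect (-n) 0 0 n) {v | v.2 = 0} ω₀))
    (h1 : ω ∈ Link false (chevFresh n X) {v | v.1 ≤ 0 ∧ v.2 = n}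
      {a | ∃ b, Adj a b ∧ mirror b ∈ X ∧ 1 ≤ b.1})
    (h2 : ω ∈ Link true (chevFresh n X) {v | 0 ≤ v.1 ∧ v.1 + v.2 = n}
      {a | ∃ b, Adj a b ∧ b ∈ X ∧ b.1 ≤ -1}) : False := by
  have hB : ∀ z ∈ X, z ∈ rect (-n) 0 0 n := fun z hz => by rw [hX] at hz; exact explored_subset hz
  have hbot : ∀ x : ℤ, -n ≤ x → x ≤ 0 → (x, 0) ∈ X := fun x h h' => by
    rw [hX]
    exact Or.inr ⟨by simp only [rect, Set.mem_ofPred_eq]; omega, Or.inl rfl⟩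
  have ext : ∀ b ∈ X, b.1 ≤ -1 → ∃ x : ℤ, -n ≤ x ∧ x ≤ -1 ∧ Walk X b (x, 0) := by
    intro b hb hb1
    rw [hX] at hb
    obtain ⟨⟨x, y⟩, hs, hD, w⟩ := explored_walk hb
    rw [← hX] at w
    obtain rfl : y = 0 := hs
    by_cases hx : x ≤ -1
    · exact ⟨x, hD.1, hx, w⟩
    · have : x = 0 := by have := hD.2.1; simp only at this; omega
      subst this
      exact ⟨-1, by omega, le_rfl, w.snoc (by rw [adj_iff]; simp) (hbot _ (by omega) (by omega))⟩
  obtain ⟨s, ⟨hs1, hs2⟩, a, ⟨b, hab, hb, hb1⟩, we⟩ := h1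
  obtain ⟨u, ⟨hu1, hu2⟩, a', ⟨b', hab', hb', hb1'⟩, wf⟩ := h2
  obtain ⟨x, hx1, hx2, w1⟩ := ext b' hb' hb1'
  obtain ⟨x', hx1', hx2', w2⟩ := ext (mirror b) hb (by simp only [mirror, Equiv.coe_fn_mk]; omega)
  have w2' : Walk (mirror ⁻¹' X) b (-x', x') := by
    have := w2.map (B := mirror ⁻¹' X) adj_mirror (fun v hv => by
      rw [Set.mem_preimage]; convert hv; simp [mirror])
    convert this using 1
    · simp [mirror]
    · simp [mirror]
  have we' : Walk (chevFresh n X ∩ {v | ω v = false} ∪ {b}) s b :=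
    (we.mono Set.subset_union_left).snoc hab (Or.inr rfl)
  have wf' : Walk (chevFresh n X ∩ {v | ω v = true} ∪ {b'}) u b' :=
    (wf.mono Set.subset_union_left).snoc hab' (Or.inr rfl)
  have hmB : ∀ z ∈ mirror ⁻¹' X, 0 ≤ z.1 ∧ z.1 ≤ n ∧ 0 ≤ z.1 + z.2 ∧ z.1 + z.2 ≤ n := by
    intro z hz
    have := hB _ hz
    simp only [rect, mirror, Equiv.coe_fn_mk, Set.mem_ofPred_eq] at this
    omega
  have hmb := hmB b hb
  have hBb := hB b' hb'
  simp only [rect, Set.mem_ofPred_eq] at hBb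
  obtain ⟨N1, M1, c1⟩ := we'.curve
  obtain ⟨N2, M2, c2⟩ := w2'.curve
  obtain ⟨N3, M3, c3⟩ := wf'.curve
  obtain ⟨N4, M4, c4⟩ := w1.curve
  have d13 : Disjoint (chevFresh n X ∩ {v | ω v = false} ∪ {b})
      (chevFresh n X ∩ {v | ω v = true} ∪ {b'}) := by
    rw [Set.disjoint_left]
    rintro z (⟨hz, hz1⟩ | rfl) (⟨hz', hz2⟩ | rfl)
    · have e1 : ω z = false := hz1
      have e2 : ω z = true := hz2
      simp [e1] at e2
    · exact hz.2.1 hb'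
    · exact hz'.2.2 hb
    · omega
  have d14 : Disjoint (chevFresh n X ∩ {v | ω v = false} ∪ {b}) X := by
    rw [Set.disjoint_left]
    rintro z (⟨hz, hz1⟩ | rfl) hz'
    · exact hz.2.1 hz'
    · have := (hB _ hz').2.1; omega
  have d23 : Disjoint (mirror ⁻¹' X) (chevFresh n X ∩ {v | ω v = true} ∪ {b'}) := by
    rw [Set.disjoint_left]
    rintro z hz (⟨hz', hz1⟩ | rfl)
    · exact hz'.2.2 hz
    · have := (hmB _ hz).1; omega
  have p13 := c1.pair c3 d13
  have p14 := c1.pair c4 d14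
  have p23 := c2.pair c3 d23
  have z1 : N2 b' = 0 := c2.below_zero_left fun p hp => by have := (hmB p hp).1; omega
  have z2 : N2 (x, 0) = 0 := c2.below_zero_left fun p hp => by have := (hmB p hp).1; simp only; omega
  have z3 : M4 b = 0 := c4.above_zero_right fun p hp => by have := (hB p hp).2.1; omega
  have z4 : M4 (-x', x') = 0 := c4.above_zero_right fun p hp => by
    have := (hB p hp).2.1; simp only; omega
  set P := chevFresh n X ∩ {v | ω v = false} ∪ {b} ∪ mirror ⁻¹' X with hP
  set Q := chevFresh n X ∩ {v | ω v = true} ∪ {b'} ∪ X with hQ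
  have cP : Curve P s (-x', x') (N1 + N2) (M1 + M2) :=
    (c1.mono Set.subset_union_left).trans (c2.mono Set.subset_union_right)
  have cQ : Curve Q u (x, 0) (N3 + N4) (M3 + M4) :=
    (c3.mono Set.subset_union_left).trans (c4.mono Set.subset_union_right)
  have hPc : P ⊆ chev n := by
    rintro z ((⟨hz, _⟩ | rfl) | hz)
    · exact hz.1
    · simp only [chev, Set.mem_ofPred_eq]; omega
    · have := hmB z hz; simp only [chev, Set.mem_ofPred_eq]; omega
  have hQc : Q ⊆ chev n := by
    rintro z ((⟨hz, _⟩ | rfl) | hz)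
    · exact hz.1
    · simp only [chev, Set.mem_ofPred_eq]; omega
    · have := hB z hz; simp only [chev, rect, Set.mem_ofPred_eq] at *; omega
  have hut : u ∉ P := by
    have hu := wf.start_mem
    rintro ((⟨_, hz⟩ | h) | h)
    · have e1 : ω u = false := hz
      have e2 : ω u = true := hu.2
      simp [e1] at e2
    · have : u = b := h
      rw [this] at hu
      exact hu.1.2.2 hb
    · exact hu.1.2.2 h
  have htQ : (-x', x') ∉ Q := by
    have ht : (-x', x') ∈ mirror ⁻¹' X := w2'.end_mem
    rintro ((⟨hz, _⟩ | h) | h)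
    · exact hz.2.2 ht
    · have : (-x', x') = b' := h
      rw [← this] at hb1'; simp only at hb1'; omega
    · have := (hB _ h).2.1; simp only at this; omega
  have e1 : (N1 + N2) u = 1 + if -x' ≤ u.1 then 1 else 0 := by
    rw [cP.below_eq, if_pos (by omega)]
    intro p hp hpu
    have := hPc hp
    simp only [chev, Set.mem_ofPred_eq] at this
    have hne : p.2 ≠ u.2 := fun h => hut (Prod.ext hpu h ▸ hp)
    omega
  have e2 : (N1 + N2) (x, 0) = 0 := by
    apply cP.below_zero
    left
    intro p hp hpu
    have := hPc hp
    simp only [chev, Set.mem_ofPred_eq] at this hpu ⊢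
    omega
  have e3 : (M3 + M4) s = 0 := by
    apply cQ.above_zero
    left
    intro p hp hpu
    have := hQc hp
    simp only [chev, Set.mem_ofPred_eq] at this hpu ⊢
    omega
  have e4 : (M3 + M4) (-x', x') = (if u.1 < -x' then 1 else 0) + 1 := by
    rw [cQ.above_eq]
    · congr 1; rw [if_pos]; simp only; omega
    intro p hp hpu
    have := hQc hp
    simp only [chev, Set.mem_ofPred_eq] at this hpu ⊢
    have hne : p.2 ≠ x' := fun h => htQ (by
      have : p = (-x', x') := Prod.ext hpu h
      exact this ▸ hp)
    omega
  have tot : (N1 + N2) u + (N1 + N2) (x, 0) + ((M3 + M4) s + (M3 + M4) (-x', x')) = 0 := by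
    simp only [Pi.add_apply]
    rw [z4, z2]
    linear_combination (exp := 1) p13 + p14 + p23 + ZMod.two_self (M3 s) + ZMod.two_self (M3 b) +
      ZMod.two_self (M4 s) + ZMod.two_self (M3 (-x', x')) - ZMod.two_self (N1 b') - z1 + z3
  rw [e1, e2, e3, e4] at tot
  split_ifs at tot <;> first | omega | (revert tot; decide)

theorem chev_half {n : ℤ} (hn : 1 ≤ n) {ω₀ : Config} {X : Set Site}
    (hX : X = explored (rect (-n) 0 0 n) {v | v.2 = 0}
      (cluster false (rect (-n) 0 0 n) {v | v.2 = 0} ω₀)) :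
    pr (Link false (chevFresh n X) {v | v.1 ≤ 0 ∧ v.2 = n}
      {a | ∃ b, Adj a b ∧ mirror b ∈ X ∧ 1 ≤ b.1}) ≤ 1 / 2 := by
  have hf : (chevFresh n X).Finite := (chev_finite n).subset fun _ h => h.1
  set E := Link false (chevFresh n X) {v | v.1 ≤ 0 ∧ v.2 = n}
      {a | ∃ b, Adj a b ∧ mirror b ∈ X ∧ 1 ≤ b.1} with hE
  set F := Link true (chevFresh n X) {v | 0 ≤ v.1 ∧ v.1 + v.2 = n}
      {a | ∃ b, Adj a b ∧ b ∈ X ∧ b.1 ≤ -1} with hF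
  have hmm : ∀ v, mirror (mirror v) = v := mirror.left_inv
  have h1 : pr E ≤ pr F := by
    rw [hE, pr_link_bool false true hf]
    refine pr_link_map mirror adj_mirror hf ?_ ?_ ?_
    · rintro v ⟨hv, h, h'⟩
      refine ⟨?_, h', by rwa [hmm]⟩
      simp only [chev, mirror, Equiv.coe_fn_mk, Set.mem_ofPred_eq] at *; omega
    · rintro v _ ⟨h, h'⟩
      simp only [mirror, Equiv.coe_fn_mk, Set.mem_ofPred_eq]; omega
    · rintro v _ ⟨b, h, h', h''⟩
      refine ⟨mirror b, adj_mirror _ _ h, h', ?_⟩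
      simp only [mirror, Equiv.coe_fn_mk]; omega
  have h2 : E ⊆ Fᶜ := fun ω h h' => chev_exclusive hn hX h h'
  have h3 := pr_compl ((Link.depOn _ _ _ _ : DepOn _ F).toFinset hf)
  have := pr_mono h2
  linarith

theorem pr_chev_quarter {n : ℤ} (hn : 1 ≤ n) :
    1 / 4 ≤ pr (Link true (chev n) {v | v.1 = -n}
      {v | v.1 = n ∨ (0 ≤ v.1 ∧ v.1 + v.2 = n)}) := by
  set B := rect (-n) 0 0 n with hB
  set I : Set Site := {v | v.2 = 0} with hI
  set E : Set Site → Set Config := fun S => Link false (chevFresh n (explored B I S))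
    {v | v.1 ≤ 0 ∧ v.2 = n} {a | ∃ b, Adj a b ∧ mirror b ∈ explored B I S ∧ 1 ≤ b.1} with hE
  have hff : ∀ X, (chevFresh n X).Finite := fun X => (chev_finite n).subset fun _ h => h.1
  have hgood : 1 / 2 ≤ pr {ω | cluster false B I ω ∈ {S : Set Site | ∀ v ∈ S, v.2 ≠ n}} := by
    have := pr_LR_square true (-n) 0 (n := n) (by omega)
    rw [neg_add_cancel, zero_add] at this
    rw [← this]
    apply pr_mono
    intro ω hω v hv hvn
    refine LR_not_TB hω ?_
    obtain ⟨s, hs, w⟩ := hv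
    exact ⟨v, hvn, s, hs, w.symm⟩
  have := explore (b := false) (D := B) (I := I) (rect_finite _ _ _ _)
    (good := {S : Set Site | ∀ v ∈ S, v.2 ≠ n}) (F := fun S => (E S)ᶜ)
    (Y := fun S => chevFresh n (explored B I S)) (c := 1 / 2)
    (G := Link true (chev n) {v | v.1 = -n} {v | v.1 = n ∨ (0 ≤ v.1 ∧ v.1 + v.2 = n)})
    (by norm_num) ?_ ?_
  · linarith
  · intro ω _
    refine ⟨hff _, (Link.depOn _ _ _ _).compl, ?_, ?_⟩
    · rw [Set.disjoint_left]; exact fun z h h' => h'.2.1 h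
    · rw [pr_compl ((Link.depOn _ _ _ _ : DepOn _ (E _)).toFinset (hff _))]
      have h : pr (E (cluster false B I ω)) ≤ 1 / 2 := chev_half hn (ω₀ := ω) rfl
      linarith
  intro ω hgood hω
  set S := cluster false B I ω with hS
  set X := explored B I S with hX
  by_contra hG
  apply hω
  have hXB : ∀ z ∈ X, z ∈ B := fun z hz => explored_subset hz
  have hXS : ∀ z ∈ X, ω z = false → z ∈ S := fun z hz hc => by
    by_contra h
    have := explored_color hz h
    rw [hc] at this; simp at this
  rcases hex_rect (x₀ := -n) (x₁ := n) (y₀ := -n) (y₁ := n) (by omega) (by omega)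
    {v | (v ∈ chev n ∧ ω v = true) ∨ n < v.2 + max v.1 0} with
    ⟨s, t, w, hs, ht⟩ | ⟨s, t, w, hs, ht⟩
  · exfalso
    apply hG
    obtain ⟨a, b, h1, h2, h3, h4⟩ := w.exit (P := {v | v.2 + max v.1 0 ≤ n ∧ v.1 < n})
      (by have := w.start_mem.1; simp only [rect, Set.mem_ofPred_eq] at *; omega)
      (by simp only [Set.mem_ofPred_eq]; omega)
    have h5 : Walk (chev n ∩ {v | ω v = true}) s a := h1.mono (by
      rintro z ⟨⟨_, h | h⟩, h', _⟩
      · exact h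
      · have h : n < z.2 + max z.1 0 := h
        omega)
    obtain ⟨h6, h7⟩ := h4.start_mem
    have h8 := h5.end_mem.1
    have h9 := h2
    rw [adj_iff] at h9
    by_cases hb : b.2 + max b.1 0 ≤ n
    · have hb1 : b.1 = n := by
        simp only [rect, Set.mem_ofPred_eq] at h3 h6; omega
      refine ⟨s, hs, b, Or.inl hb1, h5.snoc h2 ?_⟩
      rcases h7 with h | h
      · exact h
      · have h : n < b.2 + max b.1 0 := h
        omega
    · refine ⟨s, hs, a, Or.inr ?_, h5⟩
      simp only [rect, chev, Set.mem_ofPred_eq] at *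
      omega
  · have hclosed : ∀ z, z ∈ rect (-n) n (-n) n ∩
        {v | (v ∈ chev n ∧ ω v = true) ∨ n < v.2 + max v.1 0}ᶜ →
        z.2 + max z.1 0 ≤ n ∧ (z ∈ chev n → ω z = false) := by
      rintro z ⟨_, hz⟩
      simp only [Set.mem_compl_iff, Set.mem_ofPred_eq, not_or, not_and, not_lt,
        Bool.not_eq_true] at hz
      exact ⟨hz.2, hz.1⟩
    have hm0 : ∀ z : Site, z.1 = 0 → mirror z = z := fun z hz => by
      ext <;> simp [mirror, hz]
    have hs1 : s ∈ chev n := by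
      have h1 := (hclosed s w.start_mem).1
      have h2 := w.start_mem.1
      simp only [rect, chev, Set.mem_ofPred_eq] at *; omega
    have hsX : s ∉ X := fun h =>
      hgood s (hXS s h ((hclosed s w.start_mem).2 hs1)) hs
    obtain ⟨a, b, h1, h2, h3, h4⟩ := w.exit (P := chevFresh n X)
      (by
        refine ⟨hs1, hsX, fun h => ?_⟩
        have h5 := hXB _ h
        have h6 := (hclosed s w.start_mem).1
        have h7 : s.1 = 0 := by
          simp only [hB, rect, mirror, Equiv.coe_fn_mk, Set.mem_ofPred_eq] at h5; omega
        rw [hm0 s h7] at h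
        exact hsX h)
      (by
        rintro ⟨h5, _, h6⟩
        apply h6
        have h7 := w.end_mem.1
        refine Or.inr ⟨?_, Or.inl ?_⟩ <;>
        · simp only [hB, hI, rect, chev, mirror, Equiv.coe_fn_mk, Set.mem_ofPred_eq] at *; omega)
    obtain ⟨ha, haQ, haX, haX'⟩ := h1.end_mem
    have hac := (hclosed a ha).2 haQ
    have hb' := hclosed b h4.start_mem
    have hbr := h4.start_mem.1
    have h9 := h2
    rw [adj_iff] at h9
    have hbc : b ∈ chev n := by
      by_contra hbc
      have hbot : ∀ z : Site, z ∈ B → z.2 = 0 → z ∈ X := fun z hz hz' => Or.inr ⟨hz, Or.inl hz'⟩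
      have f1 : ¬ (a ∈ B ∧ a.2 = 0) := fun h => haX (hbot a h.1 h.2)
      have f2 : ¬ (mirror a ∈ B ∧ (mirror a).2 = 0) := fun h => haX' (hbot _ h.1 h.2)
      simp only [hB, rect, chev, mirror, Equiv.coe_fn_mk, Set.mem_ofPred_eq] at *
      omega
    have hbX : b ∉ X := by
      intro hbX
      have hbS := hXS b hbX (hb'.2 hbc)
      have f1 := hXB b hbX
      by_cases haB : a ∈ B
      · exact haX (Or.inl (cluster_step hbS h2.symm haB hac))
      · have f2 : b.1 = 0 := by
          simp only [hB, rect, chev, Set.mem_ofPred_eq] at *; omega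
        have f3 := adj_mirror _ _ h2.symm
        rw [hm0 b f2] at f3
        refine haX' (Or.inr ⟨?_, Or.inr ⟨b, hbS, f3⟩⟩)
        simp only [hB, rect, chev, mirror, Equiv.coe_fn_mk, Set.mem_ofPred_eq] at *; omega
    have hmb : mirror b ∈ X := by
      by_contra h
      exact h3 ⟨hbc, hbX, h⟩
    refine ⟨s, ⟨?_, hs⟩, a, ⟨b, h2, hmb, ?_⟩, h1.mono ?_⟩
    · have := (hclosed s w.start_mem).1; omega
    · have f1 := hXB _ hmb
      by_contra hlt
      have f2 : b.1 = 0 := by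
        simp only [hB, rect, mirror, Equiv.coe_fn_mk, Set.mem_ofPred_eq] at f1; omega
      rw [hm0 b f2] at hmb
      exact hbX hmb
    · rintro z ⟨hz, hz'⟩
      exact ⟨hz', (hclosed z hz).2 hz'.1⟩

end Chevron

section RSW

theorem pr_chev_cross {n : ℤ} (hn : 1 ≤ n) :
    1 / 64 ≤ pr (Link true (chev n) {v | v.1 = -n} {v | v.1 = n}) := by
  have hf := chev_finite n
  set p := pr (Link true (chev n) {v | v.1 = -n} {v | v.1 = n}) with hp
  set q := pr (Link true (chev n) {v | v.1 = -n} {v | 0 ≤ v.1 ∧ v.1 + v.2 = n}) with hq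
  have h1 : 1 / 4 ≤ p + q := by
    refine (pr_chev_quarter hn).trans ((pr_mono ?_).trans (pr_union_le _ _))
    rintro ω ⟨s, hs, t, ht | ht, w⟩
    · exact Or.inl ⟨s, hs, t, ht, w⟩
    · exact Or.inr ⟨s, hs, t, ht, w⟩
  have h2 : q ≤ pr (Link true (chev n) {v | v.1 = n} {v | v.1 ≤ 0 ∧ v.2 = n}) := by
    refine pr_link_map mirror adj_mirror hf ?_ ?_ ?_
    · intro v hv; simp only [chev, mirror, Equiv.coe_fn_mk, Set.mem_ofPred_eq] at *; omega
    · intro v _ hv; simp only [mirror, Equiv.coe_fn_mk, Set.mem_ofPred_eq] at *; omega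
    · intro v _ hv; simp only [mirror, Equiv.coe_fn_mk, Set.mem_ofPred_eq] at *; omega
  have h3 : q * q ≤ p := by
    refine (mul_le_mul_of_nonneg_left h2 (pr_nonneg _)).trans ((pr_link_inter hf hf).trans
      (pr_mono ?_))
    rintro ω ⟨⟨s, hs, t, ⟨ht1, ht2⟩, w⟩, u, hu, v, ⟨hv1, hv2⟩, w'⟩
    obtain ⟨A, hA, wA, sA⟩ := w.exists_support
    obtain ⟨B, hB, wB, sB⟩ := w'.exists_support
    by_cases hd : Disjoint A B
    · exfalso
      obtain ⟨N, M, c⟩ := wA.curve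
      obtain ⟨N', M', c'⟩ := wB.curve
      have hA' : ∀ z ∈ A, z ∈ chev n := fun z hz => (hA hz).1
      have hB' : ∀ z ∈ B, z ∈ chev n := fun z hz => (hB hz).1
      simp only [chev, Set.mem_ofPred_eq] at hA' hB' hs hu
      have hvA : v ∉ A := fun h => Set.disjoint_left.1 hd h wB.end_mem
      have htv : t ≠ v := fun h => hvA (h ▸ wA.end_mem)
      have e1 : N u = 0 := c.below_zero (Or.inr fun z hz => by have := hA' z hz; omega)
      have e2 : M' s = 0 := c'.above_zero (Or.inr fun z hz => by have := hB' z hz; omega)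
      have e3 : M' t = 0 := c'.above_zero (Or.inl fun z hz h => by have := hB' z hz; omega)
      have hts : t.1 = v.1 → t.2 = v.2 → False := fun h h' => htv (Prod.ext h h')
      have hvn := hB' _ wB.end_mem
      have hvt : v.1 < t.1 := by
        by_contra h
        exact hts (by omega) (by omega)
      have e4 : N v = 1 + 0 := by
        rw [c.below_eq, if_pos (by omega), if_neg (by omega)]
        intro z hz h
        have := hA' z hz
        have : z.2 ≠ v.2 := fun h' => hvA (Prod.ext h h' ▸ hz)
        omega
      have := c.pair c' hd
      rw [e1, e2, e3, e4] at this
      revert this; decide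
    · obtain ⟨z, hz, hz'⟩ := Set.not_disjoint_iff.1 hd
      exact ⟨s, hs, u, hu, (sA z hz).1.trans (sB z hz').1.symm⟩
  have h0 : 0 ≤ q := pr_nonneg _
  by_contra h
  push Not at h
  nlinarith

/-- Rotation by sixty degrees. -/
def rot : Site ≃ Site where
  toFun v := (-v.2, v.1 + v.2)
  invFun v := (v.1 + v.2, -v.1)
  left_inv v := by ext <;> simp
  right_inv v := by ext <;> simp

theorem adj_rot (u v : Site) (h : Adj u v) : Adj (rot u) (rot v) := by
  rw [adj_iff] at *; simp only [rot, Equiv.coe_fn_mk]; omega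

theorem adj_rot_symm (u v : Site) (h : Adj u v) : Adj (rot.symm u) (rot.symm v) := by
  rw [adj_iff] at *; simp only [rot, Equiv.coe_fn_symm_mk]; omega

def chain₁ (m : ℤ) : Set Site := {v | 0 ≤ v.1 ∧ v.1 ≤ 2 * m ∧ 0 ≤ v.2 + max (v.1 - m) 0 ∧
  v.2 + max (v.1 - m) 0 ≤ m}

def chain₂ (m : ℤ) : Set Site := {v | m ≤ v.1 + v.2 ∧ v.1 + v.2 ≤ 3 * m ∧
  0 ≤ 2 * m - v.1 + max (v.1 + v.2 - 2 * m) 0 ∧ 2 * m - v.1 + max (v.1 + v.2 - 2 * m) 0 ≤ m}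

def chain₃ (m : ℤ) : Set Site := {v | -m ≤ v.2 ∧ v.2 ≤ m ∧
  0 ≤ v.1 + v.2 - 2 * m + max (-v.2) 0 ∧ v.1 + v.2 - 2 * m + max (-v.2) 0 ≤ m}

def chain₄ (m : ℤ) : Set Site := {v | 2 * m ≤ v.1 ∧ v.1 ≤ 4 * m ∧
  0 ≤ v.2 + m + max (v.1 - 3 * m) 0 ∧ v.2 + m + max (v.1 - 3 * m) 0 ≤ m}

theorem chain_cross {m : ℤ} (hm : 1 ≤ m) {O : Set Site} {s₁ t₁ s₂ t₂ s₃ t₃ s₄ t₄ : Site}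
    (w₁ : Walk (chain₁ m ∩ O) s₁ t₁) (hs₁ : s₁.1 = 0) (ht₁ : t₁.1 = 2 * m)
    (w₂ : Walk (chain₂ m ∩ O) s₂ t₂) (hs₂ : s₂.1 + s₂.2 = m) (ht₂ : t₂.1 + t₂.2 = 3 * m)
    (w₃ : Walk (chain₃ m ∩ O) s₃ t₃) (hs₃ : s₃.2 = m) (ht₃ : t₃.2 = -m)
    (w₄ : Walk (chain₄ m ∩ O) s₄ t₄) (hs₄ : s₄.1 = 2 * m) (ht₄ : t₄.1 = 4 * m) :
    Walk (rect 0 (4 * m) (-2 * m) m ∩ O) s₁ t₄ := by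
  obtain ⟨B₁, b₁, v₁, r₁⟩ := w₁.exists_support
  obtain ⟨B₂, b₂, v₂, r₂⟩ := w₂.exists_support
  obtain ⟨B₃, b₃, v₃, r₃⟩ := w₃.exists_support
  obtain ⟨B₄, b₄, v₄, r₄⟩ := w₄.exists_support
  have g₁ : ∀ z ∈ B₁, z ∈ chain₁ m := fun z hz => (b₁ hz).1
  have g₂ : ∀ z ∈ B₂, z ∈ chain₂ m := fun z hz => (b₂ hz).1
  have g₃ : ∀ z ∈ B₃, z ∈ chain₃ m := fun z hz => (b₃ hz).1
  have g₄ : ∀ z ∈ B₄, z ∈ chain₄ m := fun z hz => (b₄ hz).1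
  have hx : ∀ a b : Site, Adj a b → b.1 ≤ a.1 + 1 := fun a b h => by rw [adj_iff] at h; omega
  have hy : ∀ a b : Site, Adj a b → -b.2 ≤ -a.2 + 1 := fun a b h => by rw [adj_iff] at h; omega
  have hxy : ∀ a b : Site, Adj a b → b.1 + b.2 ≤ a.1 + a.2 + 1 := fun a b h => by
    rw [adj_iff] at h; omega
  simp only [chain₁, chain₂, chain₃, chain₄, Set.mem_ofPred_eq] at g₁ g₂ g₃ g₄
  obtain ⟨a₁, ha₁, k₁⟩ := v₁.cut_ge (f := fun v => v.1) (c := m) hx (by omega) (by omega)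
  obtain ⟨a₂, ha₂, k₂⟩ := v₂.cut_le (f := fun v => v.1 + v.2) (c := 2 * m) hxy (by omega) (by omega)
  obtain ⟨a₂', ha₂', k₂'⟩ :=
    v₂.cut_ge (f := fun v => v.1 + v.2) (c := 2 * m) hxy (by omega) (by omega)
  obtain ⟨a₃, ha₃, k₃⟩ := v₃.cut_le (f := fun v => -v.2) (c := 0) hy (by omega) (by omega)
  obtain ⟨a₃', ha₃', k₃'⟩ := v₃.cut_ge (f := fun v => -v.2) (c := 0) hy (by omega) (by omega)
  obtain ⟨a₄, ha₄, k₄⟩ := v₄.cut_le (f := fun v => v.1) (c := 3 * m) hx (by omega) (by omega)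
  obtain ⟨z₁, hz₁, hz₁'⟩ := cross_map (φ := fun v => (v.1, -v.1 - v.2)) (x₀ := m) (x₁ := 2 * m)
    (y₀ := -2 * m) (y₁ := -m) (fun a b h => by rw [adj_iff] at *; dsimp only; omega)
    (fun a b h => by simp only [Prod.mk.injEq] at h; ext <;> omega)
    (fun z hz => by
      have := g₁ z hz.1; have := hz.2; simp only [rect, Set.mem_ofPred_eq] at *; omega)
    (fun z hz => by
      have := g₂ z hz.1; have := hz.2; simp only [rect, Set.mem_ofPred_eq] at *; omega)
    k₁ k₂ ha₁ ht₁ (by dsimp only; omega) (by dsimp only; omega)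
  obtain ⟨z₂, hz₂, hz₂'⟩ := cross_map (φ := fun v => (v.2, -v.1 - v.2)) (x₀ := 0) (x₁ := m)
    (y₀ := -3 * m) (y₁ := -2 * m) (fun a b h => by rw [adj_iff] at *; dsimp only; omega)
    (fun a b h => by simp only [Prod.mk.injEq] at h; ext <;> omega)
    (fun z hz => by
      have := g₃ z hz.1; have := hz.2; simp only [rect, Set.mem_ofPred_eq] at *; omega)
    (fun z hz => by
      have := g₂ z hz.1; have := hz.2; simp only [rect, Set.mem_ofPred_eq] at *; omega)
    k₃.symm k₂' (by dsimp only; omega) (by dsimp only; omega) (by dsimp only; omega)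
    (by dsimp only; omega)
  obtain ⟨z₃, hz₃, hz₃'⟩ := rect_cross (x₀ := 2 * m) (x₁ := 3 * m) (y₀ := -m) (y₁ := 0)
    (fun z hz => by
      have := g₄ z hz.1; have := hz.2; simp only [rect, Set.mem_ofPred_eq] at *; omega)
    (fun z hz => by
      have := g₃ z hz.1; have := hz.2; simp only [rect, Set.mem_ofPred_eq] at *; omega)
    k₄ k₃' (by omega) (by omega) (by omega) (by omega)
  have m₁ : chain₁ m ∩ O ⊆ rect 0 (4 * m) (-2 * m) m ∩ O := fun z hz => ⟨by
    have := hz.1; simp only [rect, chain₁, Set.mem_ofPred_eq] at *; omega, hz.2⟩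
  have m₂ : chain₂ m ∩ O ⊆ rect 0 (4 * m) (-2 * m) m ∩ O := fun z hz => ⟨by
    have := hz.1; simp only [rect, chain₂, Set.mem_ofPred_eq] at *; omega, hz.2⟩
  have m₃ : chain₃ m ∩ O ⊆ rect 0 (4 * m) (-2 * m) m ∩ O := fun z hz => ⟨by
    have := hz.1; simp only [rect, chain₃, Set.mem_ofPred_eq] at *; omega, hz.2⟩
  have m₄ : chain₄ m ∩ O ⊆ rect 0 (4 * m) (-2 * m) m ∩ O := fun z hz => ⟨by
    have := hz.1; simp only [rect, chain₄, Set.mem_ofPred_eq] at *; omega, hz.2⟩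
  exact ((r₁ _ hz₁.1).1.mono m₁).trans <| (((r₂ _ hz₁'.1).1.symm.trans (r₂ _ hz₂'.1).1).mono m₂).trans
    <| (((r₃ _ hz₂.1).1.symm.trans (r₃ _ hz₃'.1).1).mono m₃).trans ((r₄ _ hz₃.1).2.mono m₄)

theorem pr_inter₄ {D : Set Site} (hD : D.Finite) {E₁ E₂ E₃ E₄ : Set Config}
    (h₁ : DepOn D E₁) (h₂ : DepOn D E₂) (h₃ : DepOn D E₃) (h₄ : DepOn D E₄)
    (m₁ : IsUpperSet E₁) (m₂ : IsUpperSet E₂) (m₃ : IsUpperSet E₃) (m₄ : IsUpperSet E₄) {c : ℝ}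
    (hc : 0 ≤ c) (c₁ : c ≤ pr E₁) (c₂ : c ≤ pr E₂) (c₃ : c ≤ pr E₃) (c₄ : c ≤ pr E₄) :
    c ^ 4 ≤ pr ((E₁ ∩ E₂) ∩ (E₃ ∩ E₄)) := by
  have e1 := pr_inter_of_upper hD h₁ h₂ m₁ m₂
  have e2 := pr_inter_of_upper hD h₃ h₄ m₃ m₄
  have e3 := pr_inter_of_upper hD (h₁.inter h₂) (h₃.inter h₄) (m₁.inter m₂) (m₃.inter m₄)
  have f1 : c * c ≤ pr (E₁ ∩ E₂) := (mul_le_mul c₁ c₂ hc (pr_nonneg _)).trans e1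
  have f2 : c * c ≤ pr (E₃ ∩ E₄) := (mul_le_mul c₃ c₄ hc (pr_nonneg _)).trans e2
  calc c ^ 4 = (c * c) * (c * c) := by ring
    _ ≤ _ := mul_le_mul f1 f2 (mul_nonneg hc hc) (pr_nonneg _)
    _ ≤ _ := e3

theorem pr_LR_start {m : ℤ} (hm : 1 ≤ m) :
    (1 / 64) ^ 4 ≤ pr (LR true 0 (4 * m) (-2 * m) m) := by
  have hch := pr_chev_cross hm
  have hf := chev_finite m
  have c₁ : 1 / 64 ≤ pr (Link true (chain₁ m) {v | v.1 = 0} {v | v.1 = 2 * m}) := by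
    refine hch.trans (pr_link_map (shift m 0) (adj_shift _ _) hf ?_ ?_ ?_) <;> intro v <;>
      simp only [chev, chain₁, shift, Equiv.coe_fn_mk, Set.mem_ofPred_eq] <;> omega
  have c₂ : 1 / 64 ≤ pr (Link true (chain₂ m) {v | v.1 + v.2 = m} {v | v.1 + v.2 = 3 * m}) := by
    refine hch.trans (pr_link_map (rot.trans (shift (2 * m) 0))
      (fun u v h => adj_shift _ _ _ _ (adj_rot _ _ h)) hf ?_ ?_ ?_) <;> intro v <;>
      simp only [chev, chain₂, shift, rot, Equiv.trans_apply, Equiv.coe_fn_mk,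
        Set.mem_ofPred_eq] <;> omega
  have c₃ : 1 / 64 ≤ pr (Link true (chain₃ m) {v | v.2 = m} {v | v.2 = -m}) := by
    refine hch.trans (pr_link_map (rot.symm.trans (shift (2 * m) 0))
      (fun u v h => adj_shift _ _ _ _ (adj_rot_symm _ _ h)) hf ?_ ?_ ?_) <;> intro v <;>
      simp only [chev, chain₃, shift, rot, Equiv.trans_apply, Equiv.coe_fn_mk,
        Equiv.coe_fn_symm_mk, Set.mem_ofPred_eq] <;> omega
  have c₄ : 1 / 64 ≤ pr (Link true (chain₄ m) {v | v.1 = 2 * m} {v | v.1 = 4 * m}) := by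
    refine hch.trans (pr_link_map (shift (3 * m) (-m)) (adj_shift _ _) hf ?_ ?_ ?_) <;> intro v <;>
      simp only [chev, chain₄, shift, Equiv.coe_fn_mk, Set.mem_ofPred_eq] <;> omega
  have d : ∀ {D I J}, D ⊆ rect 0 (4 * m) (-2 * m) m →
      DepOn (rect 0 (4 * m) (-2 * m) m) (Link true D I J) := fun h => (Link.depOn _ _ _ _).mono h
  refine (pr_inter₄ (rect_finite _ _ _ _) (d ?_) (d ?_) (d ?_) (d ?_) (Link.upper _ _ _)
    (Link.upper _ _ _) (Link.upper _ _ _) (Link.upper _ _ _) (by norm_num) c₁ c₂ c₃ c₄).trans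
    (pr_mono ?_)
  · intro v; simp only [rect, chain₁, Set.mem_ofPred_eq]; omega
  · intro v; simp only [rect, chain₂, Set.mem_ofPred_eq]; omega
  · intro v; simp only [rect, chain₃, Set.mem_ofPred_eq]; omega
  · intro v; simp only [rect, chain₄, Set.mem_ofPred_eq]; omega
  · rintro ω ⟨⟨⟨s₁, hs₁, t₁, ht₁, w₁⟩, s₂, hs₂, t₂, ht₂, w₂⟩, ⟨s₃, hs₃, t₃, ht₃, w₃⟩,
      s₄, hs₄, t₄, ht₄, w₄⟩
    exact ⟨s₁, hs₁, t₄, ht₄, chain_cross hm w₁ hs₁ ht₁ w₂ hs₂ ht₂ w₃ hs₃ ht₃ w₄ hs₄ ht₄⟩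

theorem pr_LR_shift_le (b b' : Bool) {x₀ x₁ y₀ y₁ x₀' x₁' y₀' y₁' : ℤ} (hx : x₁ - x₀ = x₁' - x₀')
    (hy : y₁ - y₀ = y₁' - y₀') : pr (LR b x₀ x₁ y₀ y₁) ≤ pr (LR b' x₀' x₁' y₀' y₁') := by
  unfold LR
  rw [pr_link_bool b b' (rect_finite _ _ _ _)]
  refine pr_link_map (shift (x₀' - x₀) (y₀' - y₀)) (adj_shift _ _) (rect_finite _ _ _ _) ?_ ?_ ?_ <;>
    intro v <;> simp only [rect, shift, Equiv.coe_fn_mk, Set.mem_ofPred_eq] <;> omega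

/-- Two overlapping left-right crossings joined by a top-bottom crossing of the overlap. -/
theorem LR_glue {b : Bool} {a c d e y₀ y₁ : ℤ} (hac : a ≤ c) (hcd : c ≤ d) (hde : d ≤ e)
    {ω : Config} (h₁ : ω ∈ LR b a d y₀ y₁) (h₂ : ω ∈ TB b c d y₀ y₁)
    (h₃ : ω ∈ LR b c e y₀ y₁) : ω ∈ LR b a e y₀ y₁ := by
  obtain ⟨s, hs, t, ht, w⟩ := h₁
  obtain ⟨u, hu, v, hv, w'⟩ := h₂
  obtain ⟨s', hs', t', ht', w''⟩ := h₃
  obtain ⟨A, hA, wA, rA⟩ := w.exists_support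
  obtain ⟨B, hB, wB, rB⟩ := w'.exists_support
  obtain ⟨C, hC, wC, rC⟩ := w''.exists_support
  have hx : ∀ a b : Site, Adj a b → b.1 ≤ a.1 + 1 := fun a b h => by rw [adj_iff] at h; omega
  simp only [Set.mem_ofPred_eq] at hs ht hs' ht'
  obtain ⟨p, hp, k⟩ := wA.cut_ge (f := fun v => v.1) (c := c) hx (by omega) (by omega)
  obtain ⟨p', hp', k'⟩ := wC.cut_le (f := fun v => v.1) (c := d) hx (by omega) (by omega)
  obtain ⟨z, hz, hz'⟩ := rect_cross (x₀ := c) (x₁ := d) (y₀ := y₀) (y₁ := y₁)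
    (fun z hz => by
      have := (hA hz.1).1; have := hz.2; simp only [rect, Set.mem_ofPred_eq] at *; omega)
    (fun z hz => (hB hz).1) k wB hp ht hu hv
  obtain ⟨z₁, hz₁, hz₁'⟩ := rect_cross (x₀ := c) (x₁ := d) (y₀ := y₀) (y₁ := y₁)
    (fun z hz => by
      have := (hC hz.1).1; have := hz.2; simp only [rect, Set.mem_ofPred_eq] at *; omega)
    (fun z hz => (hB hz).1) k' wB hs' hp' hu hv
  have mono : ∀ {x₀ x₁ : ℤ}, a ≤ x₀ → x₁ ≤ e →
      rect x₀ x₁ y₀ y₁ ∩ {v | ω v = b} ⊆ rect a e y₀ y₁ ∩ {v | ω v = b} := fun h h' z hz =>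
    ⟨⟨h.trans hz.1.1, hz.1.2.1.trans h', hz.1.2.2⟩, hz.2⟩
  exact ⟨s, hs, t', ht', ((rA z hz.1).1.mono (mono le_rfl hde)).trans <|
    (((rB z hz').1.symm.trans (rB z₁ hz₁').1).mono (mono hac hde)).trans
    ((rC z₁ hz₁.1).2.mono (mono hac le_rfl))⟩

theorem LR_restrict {b : Bool} {x₀ x₁ x₁' y₀ y₁ y₀' y₁' : ℤ} (h : x₀ ≤ x₁) (hx : x₁ ≤ x₁')
    (h0 : y₀' ≤ y₀) (h1 : y₁ ≤ y₁') : LR b x₀ x₁' y₀ y₁ ⊆ LR b x₀ x₁ y₀' y₁' := by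
  rintro ω ⟨s, hs, t, ht, w⟩
  have hx : ∀ a b : Site, Adj a b → b.1 ≤ a.1 + 1 := fun a b h => by rw [adj_iff] at h; omega
  simp only [Set.mem_ofPred_eq] at hs ht
  obtain ⟨a, ha, k⟩ := w.cut_le (f := fun v => v.1) (c := x₁) hx (by omega) (by omega)
  refine ⟨s, hs, a, ha, k.mono fun z hz => ⟨?_, hz.1.2⟩⟩
  have := hz.1.1; have := hz.2; simp only [rect, Set.mem_ofPred_eq] at *; omega

theorem pr_LR_long (j : ℕ) : ∃ c : ℝ, 0 < c ∧ ∀ m : ℤ, 1 ≤ m →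
    c ≤ pr (LR true 0 ((3 + j) * m) 0 (3 * m)) := by
  induction j with
  | zero =>
    refine ⟨1 / 2, by norm_num, fun m hm => ?_⟩
    have := pr_LR_square true 0 0 (n := 3 * m) (by omega)
    rw [zero_add] at this
    rw [← this]
    exact (pr_LR_shift_le _ _ (by push_cast; ring) (by ring))
  | succ j ih =>
    obtain ⟨c, hc, h⟩ := ih
    refine ⟨c * (1 / 2 * (1 / 64) ^ 4), by positivity, fun m hm => ?_⟩
    have e1 := h m hm
    have hj : (0 : ℤ) ≤ j * m := by positivity
    have e2 : 1 / 2 ≤ pr (TB true (j * m) ((3 + j) * m) 0 (3 * m)) := by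
      rw [pr_TB, ← pr_LR_square true 0 0 (n := 3 * m) (by omega)]
      exact pr_LR_shift_le _ _ (by ring) (by ring)
    have e3 : (1 / 64 : ℝ) ^ 4 ≤ pr (LR true (j * m) ((3 + (j + 1)) * m) 0 (3 * m)) :=
      (pr_LR_start hm).trans (pr_LR_shift_le _ _ (by ring) (by ring))
    have hD := rect_finite 0 ((3 + (j + 1)) * m) 0 (3 * m)
    have hs : ∀ {x x' : ℤ}, 0 ≤ x → x' ≤ (3 + (j + 1)) * m →
        rect x x' 0 (3 * m) ⊆ rect 0 ((3 + (j + 1)) * m) 0 (3 * m) := fun h h' z hz =>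
      ⟨h.trans hz.1, hz.2.1.trans h', hz.2.2⟩
    have l1 : ((3 + j) * m : ℤ) ≤ (3 + (j + 1)) * m := by nlinarith
    have d1 : DepOn _ (LR true 0 ((3 + j) * m) 0 (3 * m)) :=
      (Link.depOn _ _ _ _).mono (hs le_rfl l1)
    have d2 : DepOn _ (TB true (j * m) ((3 + j) * m) 0 (3 * m)) :=
      (Link.depOn _ _ _ _).mono (hs hj l1)
    have d3 : DepOn _ (LR true (j * m) ((3 + (j + 1)) * m) 0 (3 * m)) :=
      (Link.depOn _ _ _ _).mono (hs hj le_rfl)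
    have f1 := pr_inter_of_upper hD d2 d3 (Link.upper _ _ _) (Link.upper _ _ _)
    have f2 := pr_inter_of_upper hD d1 (d2.inter d3) (Link.upper _ _ _)
      ((Link.upper _ _ _).inter (Link.upper _ _ _))
    calc c * (1 / 2 * (1 / 64) ^ 4) ≤ _ := mul_le_mul e1
          ((mul_le_mul e2 e3 (by positivity) (pr_nonneg _)).trans f1) (by positivity) (pr_nonneg _)
      _ ≤ _ := f2
      _ ≤ _ := pr_mono ?_
    rintro ω ⟨h1, h2, h3⟩
    have := LR_glue hj (by nlinarith) l1 h1 h2 h3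
    exact_mod_cast this

/-- Russo–Seymour–Welsh: crossings of rectangles of bounded aspect ratio. -/
theorem rsw (K : ℕ) : ∃ c : ℝ, 0 < c ∧ ∀ (b : Bool) (x₀ x₁ y₀ y₁ : ℤ), x₀ ≤ x₁ → y₀ ≤ y₁ →
    x₁ - x₀ ≤ K * (y₁ - y₀) → c ≤ pr (LR b x₀ x₁ y₀ y₁) := by
  obtain ⟨c, hc, h⟩ := pr_LR_long (5 * K)
  refine ⟨min c ((1 / 2) ^ (2 * K + 1)), by positivity, fun b x₀ x₁ y₀ y₁ hx hy hK => ?_⟩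
  rcases le_or_gt 3 (y₁ - y₀) with h3 | h3
  · refine (min_le_left _ _).trans ?_
    set m := (y₁ - y₀) / 3 with hm
    have hm1 : 1 ≤ m := by omega
    refine (h m hm1).trans (le_trans ?_ (pr_mono
      (LR_restrict (x₁' := x₀ + (3 + (5 * K : ℕ)) * m) (y₀ := y₀) (y₁ := y₀ + 3 * m) hx ?_ le_rfl
      (by omega))))
    · exact pr_LR_shift_le _ _ (by ring) (by ring)
    · have : y₁ - y₀ ≤ 5 * m := by omega
      have hK0 : (0 : ℤ) ≤ K := by positivity
      push_cast
      nlinarith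
  · refine (min_le_right _ _).trans ?_
    set S : Finset Site := (Finset.Icc x₀ x₁).image fun x => (x, y₀) with hS
    have hcard : S.card ≤ 2 * K + 1 := by
      refine Finset.card_image_le.trans ?_
      rw [Int.card_Icc]
      have : (K : ℤ) * (y₁ - y₀) ≤ K * 2 := mul_le_mul_of_nonneg_left (by omega) (by positivity)
      omega
    calc (1 / 2 : ℝ) ^ (2 * K + 1) ≤ (1 / 2) ^ S.card :=
          pow_le_pow_of_le_one (by norm_num) (by norm_num) hcard
      _ = _ := (pr_cylinder S fun _ => b).symm
      _ ≤ _ := pr_mono ?_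
    intro ω hω
    refine ⟨(x₀, y₀), rfl, (x₁, y₀), rfl, Walk.horiz _ fun z h1 h2 => ⟨?_, ?_⟩⟩
    · simp only [rect, Set.mem_ofPred_eq]; omega
    · refine hω _ (Finset.mem_image.2 ⟨z, ?_, rfl⟩)
      rw [Finset.mem_Icc]; omega

theorem rsw_TB (K : ℕ) : ∃ c : ℝ, 0 < c ∧ ∀ (b : Bool) (x₀ x₁ y₀ y₁ : ℤ), x₀ ≤ x₁ → y₀ ≤ y₁ →
    y₁ - y₀ ≤ K * (x₁ - x₀) → c ≤ pr (TB b x₀ x₁ y₀ y₁) := by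
  obtain ⟨c, hc, h⟩ := rsw K
  exact ⟨c, hc, fun b x₀ x₁ y₀ y₁ hx hy hK => by rw [pr_TB]; exact h b _ _ _ _ hy hx hK⟩

end RSW

section Lowest

/-- A walk from the left to the right side of a rectangle meets any walk to the bottom side that
starts above it on the left side. -/
theorem left_cross_bot {x₀ x₁ y₀ y₁ a b : ℤ} {A B : Set Site} {t v : Site}
    (hA : A ⊆ rect x₀ x₁ y₀ y₁) (hB : B ⊆ rect x₀ x₁ y₀ y₁) (w : Walk A (x₀, a) t) (ht : t.1 = x₁)
    (w' : Walk B (x₀, b) v) (hv : v.2 = y₀) (hab : a ≤ b) : ∃ z, z ∈ A ∧ z ∈ B := by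
  rcases hab.eq_or_lt with rfl | hab
  · exact ⟨_, w.start_mem, w'.start_mem⟩
  have ha := hA w.start_mem
  have hb := hB w'.start_mem
  simp only [rect, Set.mem_ofPred_eq] at ha hb
  set A' : Set Site := A ∪ {(x₀ - 1, a)}
  set B' : Set Site := B ∪ {z | z.1 = x₀ - 1 ∧ b ≤ z.2 ∧ z.2 ≤ y₁}
  have k : Walk A' (x₀ - 1, a) t :=
    .head (Or.inr rfl) (adj_iff.2 (by dsimp only; omega)) (w.mono Set.subset_union_left)
  have k' : Walk B' (x₀ - 1, y₁) v := by
    have k1 : Walk B' (x₀ - 1, y₁) (x₀ - 1, b) := Walk.vert (x₀ - 1) fun z h1 h2 =>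
      Or.inr ⟨rfl, by dsimp only; omega, by dsimp only; omega⟩
    exact k1.trans (.head k1.end_mem (adj_iff.2 (by dsimp only; omega))
      (w'.mono Set.subset_union_left))
  obtain ⟨z, h1 | h1, h2 | h2⟩ := rect_cross (x₀ := x₀ - 1) (x₁ := x₁) (y₀ := y₀) (y₁ := y₁)
    (by
      rintro z (h | rfl)
      · have := hA h; simp only [rect, Set.mem_ofPred_eq] at *; omega
      · simp only [rect, Set.mem_ofPred_eq]; omega)
    (by
      rintro z (h | h)
      · have := hB h; simp only [rect, Set.mem_ofPred_eq] at *; omega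
      · simp only [rect, Set.mem_ofPred_eq] at *; omega) k k' rfl ht rfl hv
  · exact ⟨z, h1, h2⟩
  · have := hA h1; simp only [rect, Set.mem_ofPred_eq] at *; omega
  · have := hB h2; obtain rfl : z = _ := h1; simp only [rect, Set.mem_ofPred_eq] at *; omega
  · obtain rfl : z = _ := h1; simp only [Set.mem_ofPred_eq] at *; omega

/-- The lower boundary of a left-right connection is itself a left-right connection. -/
theorem lower_boundary {x₀ x₁ y₀ y₁ y : ℤ} {O : Set Site} {t : Site}
    (w : Walk (rect x₀ x₁ y₀ y₁ ∩ O) (x₀, y) t) (ht : t.1 = x₁) (hO : ∀ z < y, (x₀, z) ∉ O) :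
    ∃ t', t'.1 = x₁ ∧ Walk (rect x₀ x₁ y₀ y₁ ∩ O ∩
      {v | v.2 = y₀ ∨ ∃ a s, s.2 = y₀ ∧ Walk (rect x₀ x₁ y₀ y₁ ∩ Oᶜ) s a ∧ Adj a v})
        (x₀, y) t' := by
  set R := rect x₀ x₁ y₀ y₁ with hR
  set C : Set Site := {a | ∃ s, s.2 = y₀ ∧ Walk (R ∩ Oᶜ) s a} with hC
  set O' : Set Site := {v | v.2 = y₀ ∨ ∃ a s, s.2 = y₀ ∧ Walk (R ∩ Oᶜ) s a ∧ Adj a v} with hO'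
  by_contra hcon
  push Not at hcon
  have hy := w.start_mem.1
  have hyO := w.start_mem.2
  simp only [hR, rect, Set.mem_ofPred_eq] at hy
  have hCO : ∀ {a}, a ∈ C → a ∈ R ∩ Oᶜ := by rintro a ⟨s, _, k⟩; exact k.end_mem
  have hCs : ∀ {a b}, a ∈ C → Adj a b → b ∈ R → b ∉ O → b ∈ C := by
    rintro a b ⟨s, hs, k⟩ e hb hb'; exact ⟨s, hs, k.snoc e ⟨hb, hb'⟩⟩
  have hCl : ∀ z, y₀ ≤ z → z < y → (x₀, z) ∈ C := by
    intro z h1 h2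
    refine ⟨(x₀, y₀), rfl, Walk.vert x₀ fun i h3 h4 => ⟨?_, hO i (by omega)⟩⟩
    simp only [hR, rect, Set.mem_ofPred_eq]; omega
  have hstart : (x₀, y) ∈ R ∩ O ∩ O' := by
    refine ⟨w.start_mem, ?_⟩
    rcases eq_or_lt_of_le hy.2.2.1 with h | h
    · exact Or.inl h.symm
    · obtain ⟨s, hs, k⟩ := hCl (y - 1) (by omega) (by omega)
      exact Or.inr ⟨_, s, hs, k, adj_iff.2 (by dsimp only; omega)⟩
  set U : Set Site := {v | Walk (R ∩ O ∩ O') (x₀, y) v} with hU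
  set U' : Set Site := U ∪ {v | v.1 = x₀ - 1 ∧ v.2 ≤ y} with hU'
  have hUR : ∀ {v}, v ∈ U → v ∈ R := fun h => (Walk.end_mem h).1.1
  -- an open site next to both sides belongs to `U`
  have key : ∀ b ∈ R, b ∈ O → b ∈ O' → b ∉ U' → (∃ u ∈ U', Adj u b) → False := by
    rintro b hb hbO hbO' hbU ⟨u, hu | ⟨hu1, hu2⟩, e⟩
    · exact hbU (Or.inl (Walk.snoc hu e ⟨⟨hb, hbO⟩, hbO'⟩))
    · rw [adj_iff] at e
      simp only [hR, rect, Set.mem_ofPred_eq] at hb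
      have h1 : b.1 = x₀ := by omega
      have h2 : y ≤ b.2 := by
        by_contra h
        exact hO b.2 (by omega) (by rw [← h1]; exact hbO)
      have h3 : b = (x₀, y) := Prod.ext h1 (by dsimp only; omega)
      exact hbU (Or.inl (by rw [h3]; exact .refl hstart))
  set Q : Set Site := {v | v ∉ U' ∧ ∃ u ∈ U', Adj u v} ∪ {v | v.1 = x₀ - 1 ∧ y < v.2} with hQ
  rcases hex_rect (x₀ := x₀ - 1) (x₁ := x₁) (y₀ := y₀) (y₁ := y₁) (by omega) (by omega) Qᶜ with
    ⟨s, r, k, hs, hr⟩ | ⟨s, r, k, hs, hr⟩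
  · have hsU : s ∈ U' := by
      refine Or.inr ⟨hs, ?_⟩
      by_contra h
      exact k.start_mem.2 (Or.inr ⟨hs, by omega⟩)
    have := (k.inter_of_closed hsU (by
      intro a ha _ b hb e
      by_contra h
      exact hb.2 (Or.inl ⟨h, a, ha, e⟩))).end_mem.2
    rcases this with h | ⟨h, _⟩
    · exact hcon r hr h
    · omega
  · rw [compl_compl] at k
    have hrC : r ∈ C := by
      rcases k.end_mem with ⟨h1, ⟨h2, h3⟩ | ⟨h2, h3⟩⟩
      · have hrR : r ∈ R := by
          simp only [hR, rect, Set.mem_ofPred_eq] at h1 ⊢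
          have : r.1 ≠ x₀ - 1 := fun h => h2 (Or.inr ⟨h, by omega⟩)
          omega
        refine ⟨r, hr, .refl ⟨hrR, fun h => key r hrR h (Or.inl hr) h2 h3⟩⟩
      · omega
    by_cases hsC : s ∈ C
    · obtain ⟨s', hs', k'⟩ := hsC
      obtain ⟨z, h1, h2⟩ := rect_cross Set.inter_subset_left Set.inter_subset_left w k'.symm
        rfl ht hs hs'
      exact h2.2 h1.2
    · obtain ⟨a, b, h1, h2, h3, h4⟩ := k.symm.exit hrC hsC
      have haC := h1.end_mem.2
      have haR := (hCO haC).1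
      have e := h2
      rw [adj_iff] at e
      rcases h4.start_mem with ⟨h5, ⟨h6, h7⟩ | ⟨h6, h7⟩⟩
      · have hbR : b ∈ R := by
          simp only [hR, rect, Set.mem_ofPred_eq] at h5 haR ⊢
          have : ¬ (b.1 = x₀ - 1 ∧ b.2 ≤ y) := fun h => h6 (Or.inr h)
          have h8 : b.1 ≠ x₀ - 1 := by
            intro h
            obtain ⟨u, hu | ⟨hu1, hu2⟩, e'⟩ := h7
            · have h9 := hUR hu
              rw [adj_iff] at e'
              have h10 : u.1 = x₀ := by simp only [hR, rect, Set.mem_ofPred_eq] at h9; omega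
              obtain ⟨s', hs', k'⟩ := haC
              have h11 : a = (x₀, a.2) := Prod.ext (by dsimp only; omega) rfl
              rw [h11] at k'
              obtain ⟨z, h12, h13⟩ := left_cross_bot Set.inter_subset_left Set.inter_subset_left
                w ht k'.symm hs' (by omega)
              exact h13.2 h12.2
            · have h9 : b.2 = y + 1 := by rw [adj_iff] at e'; omega
              obtain ⟨s', hs', k'⟩ := haC
              have h11 : a = (x₀, a.2) := Prod.ext (by dsimp only; omega) rfl
              rw [h11] at k'
              obtain ⟨z, h12, h13⟩ := left_cross_bot Set.inter_subset_left Set.inter_subset_left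
                w ht k'.symm hs' (by omega)
              exact h13.2 h12.2
          omega
        obtain ⟨s', hs', k'⟩ := haC
        refine key b hbR ?_ (Or.inr ⟨a, s', hs', k', h2⟩) h6 h7
        by_contra hbO
        exact h3 (hCs ⟨s', hs', k'⟩ h2 hbR hbO)
      · obtain ⟨s', hs', k'⟩ := haC
        have h8 : a = (x₀, a.2) := Prod.ext (by
          simp only [hR, rect, Set.mem_ofPred_eq] at haR; dsimp only; omega) rfl
        rw [h8] at k'
        obtain ⟨z, h12, h13⟩ := left_cross_bot Set.inter_subset_left Set.inter_subset_left
          w ht k'.symm hs' (by simp only [hR, rect, Set.mem_ofPred_eq] at haR; omega)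
        exact h13.2 h12.2

/-- An open connection from `(x₀, y)` to the right side together with a closed connection from
`(x₀, y - 1)` to the bottom side force the lowest crossing to start from `(x₀, y)`. -/
theorem exists_lowest {x₀ x₁ y₀ y₁ y : ℤ} {ω : Config}
    (ho : ω ∈ Link true (rect x₀ x₁ y₀ y₁) {(x₀, y)} {v | v.1 = x₁})
    (hc : ω ∈ Link false (rect x₀ x₁ y₀ y₁) {(x₀, y - 1)} {v | v.2 = y₀}) :
    ∃ p, IsLowestCrossing x₀ x₁ y₀ y₁ ω p ∧ p.head? = some (x₀, y) := by
  set R := rect x₀ x₁ y₀ y₁ with hR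
  obtain ⟨_, rfl, t, ht, w⟩ := ho
  obtain ⟨_, rfl, v, hv, w'⟩ := hc
  set O : Set Site := {u | ω u = true ∧ ¬ (u.1 = x₀ ∧ u.2 < y)} with hO
  -- open connections to the right side avoid the left side below `y`
  have hlow : ∀ {u t : Site}, t.1 = x₁ → Walk (R ∩ {v | ω v = true}) u t →
      ¬ (u.1 = x₀ ∧ u.2 < y) := by
    rintro ⟨_, u⟩ t ht k ⟨rfl, h⟩
    obtain ⟨z, h1, h2⟩ := left_cross_bot Set.inter_subset_left Set.inter_subset_left k ht w' hv
      (by dsimp only at h; omega)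
    have h1 : ω z = true := h1.2
    have h2 : ω z = false := h2.2
    simp_all
  have hsup : ∀ {A : Set Site} {u t : Site}, t.1 = x₁ → A ⊆ R ∩ {v | ω v = true} → Walk A u t →
      Walk (A ∩ (R ∩ O)) u t := by
    intro A u t ht hA k
    obtain ⟨B, hB, k', hk⟩ := k.exists_support
    exact k'.mono fun z hz => ⟨hB hz, (hA (hB hz)).1, (hA (hB hz)).2,
      hlow ht ((hk z hz).2.mono hA)⟩
  obtain ⟨t', ht', k⟩ := lower_boundary ((hsup ht subset_rfl w).mono Set.inter_subset_right) ht
    (fun z hz h => h.2 ⟨rfl, hz⟩)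
  obtain ⟨p, hp, hp1, hp2⟩ := k.exists_path
  have hpR : ∀ z ∈ p, z ∈ R := fun z hz => (hp.2 z hz).1.1
  refine ⟨p, ⟨⟨⟨hp.1, hpR⟩, fun z hz => (hp.2 z hz).1.2.1, ⟨_, ⟨w.start_mem.1, rfl⟩, hp1⟩,
    t', ⟨k.end_mem.1.1, ht'⟩, hp2⟩, ?_⟩, hp1⟩
  rintro q ⟨⟨hq1, hq2⟩, hq3, ⟨s, ⟨_, hs⟩, hqs⟩, r, ⟨_, hr⟩, hqr⟩ z hz
  refine ⟨hpR z hz, ?_⟩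
  by_contra hcon
  push Not at hcon
  obtain ⟨hzq, l, ⟨hl1, hl2⟩, hl3, e, ⟨_, he⟩, hl4⟩ := hcon
  have kl := Walk.of_list hl1.2.2 hl2 hl3 hl4
  have kq := hsup hr (fun z hz => ⟨hq2 z hz, hq3 z hz⟩)
    (Walk.of_list (A := {z | z ∈ q}) hq1.2.2 (fun _ h => h) hqs hqr)
  have hfin : ∃ u, u.2 = y₀ ∧ Walk (R \ ({z | z ∈ q} ∩ (R ∩ O))) e u := by
    have k1 : Walk (R \ ({z | z ∈ q} ∩ (R ∩ O))) e z :=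
      kl.symm.mono fun z hz => ⟨hz.1, fun h => hz.2 h.1⟩
    rcases (hp.2 z hz).2 with h | ⟨a, s, hs, ks, e⟩
    · exact ⟨z, h, k1⟩
    · exact ⟨s, hs, k1.trans (.head k1.end_mem e.symm
        (ks.symm.mono fun z hz => ⟨hz.1, fun h => hz.2 h.2.2⟩))⟩
  obtain ⟨u, hu, ku⟩ := hfin
  obtain ⟨a, h1, h2⟩ := rect_cross (fun z hz => hz.2.1) Set.sdiff_subset kq ku hs hr he hu
  exact h2.2 h1

end Lowest

section LowerBound

/-- The event is preserved when more sites take the colour `b`. -/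
def Favors (b : Bool) (E : Set Config) : Prop :=
  ∀ ω ω' : Config, (∀ v, ω v = b → ω' v = b) → ω ∈ E → ω' ∈ E

theorem Favors.inter {b : Bool} {E F : Set Config} (h : Favors b E) (h' : Favors b F) :
    Favors b (E ∩ F) := fun ω ω' hω hE => ⟨h ω ω' hω hE.1, h' ω ω' hω hE.2⟩

theorem Link.favors (b : Bool) (D I J : Set Site) : Favors b (Link b D I J) := by
  rintro ω ω' h ⟨s, hs, t, ht, w⟩
  exact ⟨s, hs, t, ht, w.mono fun v hv => ⟨hv.1, h v hv.2⟩⟩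

theorem pr_inter_of_favors {b : Bool} {D : Set Site} {E F : Set Config} (hD : D.Finite)
    (hE : DepOn D E) (hF : DepOn D F) (mE : Favors b E) (mF : Favors b F) :
    pr E * pr F ≤ pr (E ∩ F) := by
  cases b
  · have hdep : ∀ {E}, DepOn D E → DepOn D {ω : Config | (fun v => !ω v) ∈ E} :=
      fun h ω ω' hω hE => h _ _ (fun v hv => by rw [hω v hv]) hE
    have hup : ∀ {E}, Favors false E → IsUpperSet {ω : Config | (fun v => !ω v) ∈ E} := by
      intro E h ω ω' hω hE
      refine h _ _ (fun v hv => ?_) hE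
      have h1 : ω v = true := by simpa using hv
      have h2 := hω v
      rw [h1] at h2
      simp [top_le_iff.1 h2]
    rw [← pr_flip (hE.toFinset hD), ← pr_flip (hF.toFinset hD),
      ← pr_flip ((hE.inter hF).toFinset hD)]
    exact pr_inter_of_upper hD (hdep hE) (hdep hF) (hup mE) (hup mF)
  · have hup : ∀ {E}, Favors true E → IsUpperSet E := by
      intro E h ω ω' hω hE
      refine h _ _ (fun v hv => ?_) hE
      have h2 := hω v
      rw [hv] at h2
      exact top_le_iff.1 h2
    exact pr_inter_of_upper hD hE hF (hup mE) (hup mF)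

/-- A vertical crossing of a vertical strip meets any horizontal crossing of it. -/
theorem strip_cross {x₀ x₁ a b : ℤ} {A B : Set Site} {s t u v : Site} (hab : a ≤ b)
    (hA : ∀ z ∈ A, x₀ ≤ z.1 ∧ z.1 ≤ x₁) (hB : B ⊆ rect x₀ x₁ a b) (w : Walk A s t)
    (hs : b ≤ s.2) (ht : t.2 ≤ a) (w' : Walk B u v) (hu : u.1 = x₀) (hv : v.1 = x₁) :
    ∃ z, z ∈ A ∧ z ∈ B := by
  have hf : ∀ a b : Site, Adj a b → -b.2 ≤ -a.2 + 1 := fun a b h => by rw [adj_iff] at h; omega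
  obtain ⟨p, hp, k⟩ := w.cut_ge (f := fun v => -v.2) (c := -b) hf (by omega) (by omega)
  obtain ⟨q, hq, k'⟩ := k.cut_le (f := fun v => -v.2) (c := -a) hf (by omega) (by omega)
  obtain ⟨z, h1, h2⟩ := rect_cross hB (fun z hz => by
    have h1 := hA z hz.1.1
    have h2 : -b ≤ -z.2 := hz.1.2
    have h3 : -z.2 ≤ -a := hz.2
    simp only [rect, Set.mem_ofPred_eq]; omega) w' k' hu hv (by omega) (by omega)
  exact ⟨z, h2.1.1, h1⟩

/-- A closed connection from below the lowest left endpoint of an open connection. -/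
theorem closed_below {x₁ y₀ y₁ m : ℤ} (hx : 0 ≤ x₁) {ω : Config} {t : Site}
    (w : Walk (rect 0 x₁ y₀ y₁ ∩ {v | ω v = true}) (0, m) t) (ht : t.1 = x₁) (hm : y₀ < m)
    (hmin : ∀ z r, Walk (rect 0 x₁ y₀ y₁ ∩ {v | ω v = true}) (0, z) r → r.1 = x₁ → m ≤ z) :
    ∃ u, u.2 = y₀ ∧ Walk (rect 0 x₁ y₀ y₁ ∩ {v | ω v = false}) (0, m - 1) u := by
  have hmR := w.start_mem.1
  simp only [rect, Set.mem_ofPred_eq] at hmR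
  have hcl : ∀ {z}, z ∈ rect (-1) x₁ y₀ y₁ ∩
      {v | (0 ≤ v.1 ∧ ω v = true) ∨ (v.1 = -1 ∧ v.2 < m)}ᶜ →
      (z ∈ rect 0 x₁ y₀ y₁ ∧ ω z = false) ∨ (z.1 = -1 ∧ m ≤ z.2) := by
    rintro z ⟨h1, h2⟩
    simp only [Set.mem_compl_iff, Set.mem_ofPred_eq, not_or, not_and, not_lt,
      Bool.not_eq_true, rect] at h1 h2 ⊢
    by_cases h : 0 ≤ z.1
    · exact Or.inl ⟨by omega, h2.1 h⟩
    · exact Or.inr ⟨by omega, h2.2 (by omega)⟩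
  rcases hex_rect (x₀ := -1) (x₁ := x₁) (y₀ := y₀) (y₁ := y₁) (by omega) (by omega)
    {v | (0 ≤ v.1 ∧ ω v = true) ∨ (v.1 = -1 ∧ v.2 < m)} with
    ⟨s, r, k, hs, hr⟩ | ⟨s, r, k, hs, hr⟩
  · exfalso
    obtain ⟨a, b, h1, h2, h3, h4⟩ := k.last_exit (P := {v | v.1 = -1}) hs
      (by simp only [Set.mem_ofPred_eq]; omega)
    have ha : a.2 < m := by
      have h2 : a.1 = -1 := h2
      rcases h1.end_mem.2 with h | h
      · omega
      · exact h.2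
    have h2 : a.1 = -1 := h2
    have h5 : Walk (rect 0 x₁ y₀ y₁ ∩ {v | ω v = true}) b r := h4.mono (by
      rintro z ⟨⟨h5, h6 | h6⟩, h7⟩
      · refine ⟨?_, h6.2⟩
        simp only [rect, Set.mem_ofPred_eq] at h5 ⊢; omega
      · exact absurd h6.1 h7)
    have h6 := h5.start_mem.1
    rw [adj_iff] at h3
    simp only [rect, Set.mem_ofPred_eq] at h6
    have h7 : b = (0, b.2) := Prod.ext (by dsimp only; omega) rfl
    rw [h7] at h5
    have := hmin _ _ h5 hr
    omega
  · have hcon : ∀ {s : Site}, s.1 = 0 → m ≤ s.2 →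
        Walk (rect 0 x₁ y₀ y₁ ∩ {v | ω v = false}) s r → False := by
      rintro ⟨_, s⟩ rfl h k
      obtain ⟨z, h1, h2⟩ := left_cross_bot Set.inter_subset_left Set.inter_subset_left w ht k hr h
      have h1 : ω z = true := h1.2
      have h2 : ω z = false := h2.2
      simp_all
    by_cases hr1 : r.1 = -1
    · have := hcl k.end_mem
      simp only [rect, Set.mem_ofPred_eq] at this; omega
    · by_cases hs1 : ∃ a, a.1 = -1 ∧ Walk (rect (-1) x₁ y₀ y₁ ∩
          {v | (0 ≤ v.1 ∧ ω v = true) ∨ (v.1 = -1 ∧ v.2 < m)}ᶜ) a r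
      · obtain ⟨p, hp, k⟩ := hs1
        obtain ⟨a, b, h1, h2, h3, h4⟩ := k.last_exit (P := {v | v.1 = -1}) hp hr1
        have h5 : Walk (rect 0 x₁ y₀ y₁ ∩ {v | ω v = false}) b r := h4.mono (by
          rintro z ⟨h5, h6⟩
          rcases hcl h5 with h | h
          · exact h
          · exact absurd h.1 h6)
        have ha : m ≤ a.2 := by
          have h2 : a.1 = -1 := h2
          have := hcl h1.end_mem
          simp only [rect, Set.mem_ofPred_eq] at this; omega
        have h2 : a.1 = -1 := h2
        have h6 := h5.start_mem.1
        rw [adj_iff] at h3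
        simp only [rect, Set.mem_ofPred_eq] at h6
        have h7 : b.2 < m := by
          by_contra h
          exact hcon (by omega) (by omega) h5
        have h8 : b = (0, m - 1) := Prod.ext (by dsimp only; omega) (by dsimp only; omega)
        exact ⟨r, hr, h8 ▸ h5⟩
      · exfalso
        push Not at hs1
        obtain ⟨B, hB, k', hk⟩ := k.exists_support
        obtain ⟨z, h1, h2⟩ := rect_cross (x₀ := 0) (x₁ := x₁) (y₀ := y₀) (y₁ := y₁) (B := B)
          Set.inter_subset_left (fun z hz => by
            rcases hcl (hB hz) with h | h
            · exact h.1
            · exact absurd (hk z hz).2 (hs1 z h.1)) w k' rfl ht hs hr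
        rcases hcl (hB h2) with h | h
        · have h1 : ω z = true := h1.2
          simp_all
        · exact hs1 z h.1 (hk z h2).2

/-- Four crossings of strips produce, in one of the translates of a box by at most `d`, an open
and a closed connection from neighbouring sites at the prescribed place of the left side. -/
theorem exists_shifted_start {N d y x₁ : ℤ} (hx : 0 ≤ x₁) (hd : 1 ≤ d) (hy₀ : -N + 2 * d ≤ y - d)
    (hy₁ : y + d ≤ N - d) {ω : Config} (h₁ : ω ∈ LR true 0 x₁ y (y + d))
    (h₂ : ω ∈ LR false 0 x₁ (y - d) (y - 1)) (h₃ : ω ∈ LR false 0 x₁ (-N + d) (-N + 2 * d))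
    (h₄ : ω ∈ TB false 0 x₁ (-N - d) (y - 1)) :
    ∃ j, -d ≤ j ∧ j ≤ d ∧
      ω ∈ Link true (rect 0 x₁ (-N + j) (N + j)) {(0, y + j)} {v | v.1 = x₁} ∧
      ω ∈ Link false (rect 0 x₁ (-N + j) (N + j)) {(0, y + j - 1)} {v | v.2 = -N + j} := by
  set P : ℤ → Prop := fun z => ∃ r : Site, r.1 = x₁ ∧
    Walk (rect 0 x₁ (-N + d) (N - d) ∩ {v | ω v = true}) (0, z) r with hP
  obtain ⟨s₁, hs₁, t₁, ht₁, w₁⟩ := h₁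
  obtain ⟨s₂, hs₂, t₂, ht₂, w₂⟩ := h₂
  obtain ⟨s₃, hs₃, t₃, ht₃, w₃⟩ := h₃
  obtain ⟨s₄, hs₄, t₄, ht₄, w₄⟩ := h₄
  simp only [Set.mem_ofPred_eq] at hs₁ ht₁ hs₂ ht₂ hs₃ ht₃ hs₄ ht₄
  have hs₁' := w₁.start_mem.1
  have hs₂' := w₂.start_mem.1
  simp only [rect, Set.mem_ofPred_eq] at hs₁' hs₂'
  have hP₁ : P s₁.2 := by
    refine ⟨t₁, ht₁, ?_⟩
    rw [show ((0 : ℤ), s₁.2) = s₁ from Prod.ext hs₁.symm rfl]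
    refine w₁.mono fun z hz => ⟨?_, hz.2⟩
    have := hz.1
    simp only [rect, Set.mem_ofPred_eq] at this ⊢; omega
  obtain ⟨m, ⟨r, hr, wm⟩, hmin⟩ := Int.exists_least_of_bdd (P := P)
    ⟨-N + d, fun z ⟨r, _, k⟩ => by
      have := k.start_mem.1; simp only [rect, Set.mem_ofPred_eq] at this; omega⟩ ⟨_, hP₁⟩
  have hm₁ : m ≤ s₁.2 := hmin _ hP₁
  have hcol : ∀ {a b : ℤ}, ∀ z ∈ rect 0 x₁ a b ∩ {v | ω v = false}, 0 ≤ z.1 ∧ z.1 ≤ x₁ :=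
    fun z hz => ⟨hz.1.1, hz.1.2.1⟩
  obtain ⟨B₂, hB₂, k₂, c₂⟩ := w₂.exists_support
  obtain ⟨B₄, hB₄, k₄, c₄⟩ := w₄.exists_support
  have hm₂ : s₂.2 < m := by
    by_contra hlt
    obtain ⟨z, h1, h2⟩ := strip_cross (by omega) (fun z hz => hcol z (hB₄ hz))
      (fun z hz => (hB₂ hz).1) k₄ (by omega) (by omega) k₂ hs₂ ht₂
    have l1 : rect 0 x₁ (y - d) (y - 1) ∩ {v | ω v = false} ⊆
        rect 0 x₁ (-N - d) (N - d) ∩ {v | ω v = false} := fun z hz => by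
      refine ⟨?_, hz.2⟩
      have := hz.1
      simp only [rect, Set.mem_ofPred_eq] at this ⊢; omega
    have l2 : rect 0 x₁ (-N - d) (y - 1) ∩ {v | ω v = false} ⊆
        rect 0 x₁ (-N - d) (N - d) ∩ {v | ω v = false} := fun z hz => by
      refine ⟨?_, hz.2⟩
      have := hz.1
      simp only [rect, Set.mem_ofPred_eq] at this ⊢; omega
    have k := ((c₂ z h2).1.mono l1).trans ((c₄ z h1).2.mono l2)
    rw [show s₂ = (0, s₂.2) from Prod.ext hs₂ rfl] at k
    obtain ⟨v, e1, e2⟩ := left_cross_bot (A := rect 0 x₁ (-N + d) (N - d) ∩ {v | ω v = true})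
      (fun z hz => by
        have := hz.1
        simp only [rect, Set.mem_ofPred_eq] at this ⊢; omega)
      Set.inter_subset_left wm hr k ht₄ (by omega)
    have e1 : ω v = true := e1.2
    have e2 : ω v = false := e2.2
    simp_all
  obtain ⟨u, hu, ku⟩ := closed_below hx wm hr (by omega) fun z r k hr => hmin z ⟨r, hr, k⟩
  set j := m - y with hj
  refine ⟨j, by omega, by omega, ?_, ?_⟩
  · refine ⟨_, rfl, r, hr, ?_⟩
    rw [show y + j = m by omega]
    refine wm.mono fun z hz => ⟨?_, hz.2⟩
    have := hz.1
    simp only [rect, Set.mem_ofPred_eq] at this ⊢; omega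
  · obtain ⟨Bu, hBu, ku', cu⟩ := ku.exists_support
    obtain ⟨B₃, hB₃, k₃, c₃⟩ := w₃.exists_support
    obtain ⟨z, h1, h2⟩ := strip_cross (by omega) (fun z hz => hcol z (hBu hz))
      (fun z hz => (hB₃ hz).1) ku' (by dsimp only; omega) (by omega) k₃ hs₃ ht₃
    obtain ⟨z', h3, h4⟩ := strip_cross (by omega) (fun z hz => hcol z (hB₄ hz))
      (fun z hz => (hB₃ hz).1) k₄ (by omega) (by omega) k₃ hs₃ ht₃
    have hz' := (hB₃ h4).1
    simp only [rect, Set.mem_ofPred_eq] at hz'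
    obtain ⟨v, hv, kv⟩ := (c₄ z' h3).2.cut_le (f := fun v => -v.2) (c := N - j)
      (fun a b h => by rw [adj_iff] at h; omega) (by omega) (by omega)
    refine ⟨_, rfl, v, by simp only [Set.mem_ofPred_eq]; omega, ?_⟩
    rw [show y + j - 1 = m - 1 by omega]
    refine ((cu z h1).1.mono ?_).trans ((((c₃ z h2).1.symm.trans (c₃ z' h4).1).mono ?_).trans
      (kv.mono ?_))
    · intro z hz
      refine ⟨?_, hz.2⟩
      have := hz.1
      simp only [rect, Set.mem_ofPred_eq] at this ⊢; omega
    · intro z hz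
      refine ⟨?_, hz.2⟩
      have := hz.1
      simp only [rect, Set.mem_ofPred_eq] at this ⊢; omega
    · intro z hz
      refine ⟨?_, hz.1.2⟩
      have h5 := hz.1.1
      have h6 : -z.2 ≤ N - j := hz.2
      simp only [rect, Set.mem_ofPred_eq] at h5 ⊢; omega

theorem Link.of_shift {b : Bool} {D I J D' I' J' : Set Site} {i j : ℤ} {ω : Config}
    (h : ω ∈ Link b D I J) (hD : ∀ v ∈ D, shift (-i) (-j) v ∈ D')
    (hI : ∀ v ∈ D, v ∈ I → shift (-i) (-j) v ∈ I')
    (hJ : ∀ v ∈ D, v ∈ J → shift (-i) (-j) v ∈ J') :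
    (fun v => ω (shift i j v)) ∈ Link b D' I' J' := by
  obtain ⟨s, hs, t, ht, w⟩ := h
  refine ⟨_, hI s w.start_mem.1 hs, _, hJ t w.end_mem.1 ht, w.map (adj_shift (-i) (-j)) ?_⟩
  rintro v ⟨h1, h2⟩
  refine ⟨hD v h1, ?_⟩
  have : shift i j (shift (-i) (-j) v) = v := by ext <;> simp [shift]
  simp only [Set.mem_ofPred_eq, this]
  exact h2

/-- The lowest crossing of `[0, x₁] × [y₀, y₁]` starts at `(0, y)`. -/
def startsAt (x₁ y₀ y₁ y : ℤ) : Set Config :=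
  {ω | ∃ p, IsLowestCrossing 0 x₁ y₀ y₁ ω p ∧ p.head? = some (0, y)}

theorem pr_startsAt_ge : ∃ c : ℝ, 0 < c ∧ ∀ n : ℕ, 1 ≤ n → ∀ y : ℤ, -(16 * n : ℤ) ≤ 2 * y →
    2 * y ≤ 16 * n → c / n ≤ pr (startsAt (2 * (16 * n)) (-(16 * n : ℤ)) (16 * n) y) := by
  obtain ⟨c, hc, hLR⟩ := rsw 32
  obtain ⟨c', hc', hTB⟩ := rsw_TB 1
  refine ⟨c * (c * (c * c')) / 5, by positivity, fun n hn y hy₀ hy₁ => ?_⟩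
  have hn0 : (0 : ℝ) < n := by exact_mod_cast hn
  set N : ℤ := 16 * n with hN
  set d : ℤ := 2 * n with hd
  have hfin : ∀ {a b}, (rect 0 (2 * N) a b).Finite := rect_finite _ _ _ _
  set E : Set Config := Link true (rect 0 (2 * N) (-N) N) {(0, y)} {v | v.1 = 2 * N} ∩
    Link false (rect 0 (2 * N) (-N) N) {(0, y - 1)} {v | v.2 = -N} with hE
  have hEd : DepOn (rect 0 (2 * N) (-N) N) E := (Link.depOn _ _ _ _).inter (Link.depOn _ _ _ _)
  have hEs : E ⊆ startsAt (2 * N) (-N) N y := fun ω h => exists_lowest h.1 h.2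
  set Z : Set Config := LR true 0 (2 * N) y (y + d) ∩ (LR false 0 (2 * N) (y - d) (y - 1) ∩
    (LR false 0 (2 * N) (-N + d) (-N + 2 * d) ∩ TB false 0 (2 * N) (-N - d) (y - 1))) with hZ
  have hZpr : c * (c * (c * c')) ≤ pr Z := by
    set D := rect 0 (2 * N) (-N - d) (y - 1) with hD
    have hsub : ∀ {a b : ℤ}, -N - d ≤ a → b ≤ y - 1 → rect 0 (2 * N) a b ⊆ D := fun ha hb z hz => by
      simp only [hD, rect, Set.mem_ofPred_eq] at hz ⊢; omega
    have d₂ : DepOn D (LR false 0 (2 * N) (y - d) (y - 1)) :=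
      (Link.depOn _ _ _ _).mono (hsub (by omega) le_rfl)
    have d₃ : DepOn D (LR false 0 (2 * N) (-N + d) (-N + 2 * d)) :=
      (Link.depOn _ _ _ _).mono (hsub (by omega) (by omega))
    have d₄ : DepOn D (TB false 0 (2 * N) (-N - d) (y - 1)) := Link.depOn _ _ _ _
    have p₁ : c ≤ pr (LR true 0 (2 * N) y (y + d)) :=
      hLR _ _ _ _ _ (by omega) (by omega) (by push_cast; omega)
    have p₂ : c ≤ pr (LR false 0 (2 * N) (y - d) (y - 1)) :=
      hLR _ _ _ _ _ (by omega) (by omega) (by push_cast; omega)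
    have p₃ : c ≤ pr (LR false 0 (2 * N) (-N + d) (-N + 2 * d)) :=
      hLR _ _ _ _ _ (by omega) (by omega) (by push_cast; omega)
    have p₄ : c' ≤ pr (TB false 0 (2 * N) (-N - d) (y - 1)) :=
      hTB _ _ _ _ _ (by omega) (by omega) (by push_cast; omega)
    have f₃ := pr_inter_of_favors hfin d₃ d₄ (Link.favors _ _ _ _) (Link.favors _ _ _ _)
    have f₂ := pr_inter_of_favors hfin d₂ (d₃.inter d₄) (Link.favors _ _ _ _)
      ((Link.favors _ _ _ _).inter (Link.favors _ _ _ _))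
    have f₁ : pr Z = _ := pr_inter_of_disjoint (D := rect 0 (2 * N) y (y + d)) hfin hfin
      (Link.depOn _ _ _ _) (d₂.inter (d₃.inter d₄)) (Set.disjoint_left.2 fun z hz hz' => by
        simp only [rect, Set.mem_ofPred_eq] at hz hz'; omega)
    rw [f₁]
    exact mul_le_mul p₁ ((mul_le_mul p₂ ((mul_le_mul p₃ p₄ hc'.le (pr_nonneg _)).trans f₃)
      (by positivity) (pr_nonneg _)).trans f₂) (by positivity) (pr_nonneg _)
  have hcov : Z ⊆ ⋃ j ∈ Finset.Icc (-d) d, {ω | (fun v => ω (shift 0 j v)) ∈ E} := by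
    rintro ω ⟨h₁, h₂, h₃, h₄⟩
    obtain ⟨j, hj, hj', e1, e2⟩ := exists_shifted_start (by omega) (by omega) (by omega) (by omega)
      h₁ h₂ h₃ h₄
    simp only [Set.mem_iUnion]
    refine ⟨j, Finset.mem_Icc.2 ⟨hj, hj'⟩, Link.of_shift e1 ?_ ?_ ?_, Link.of_shift e2 ?_ ?_ ?_⟩ <;>
    simp only [shift, rect, Equiv.coe_fn_mk, Set.mem_ofPred_eq, Set.mem_singleton_iff,
      Prod.ext_iff] <;> intro v <;> omega
  have hsum : pr Z ≤ (4 * n + 1) * pr E := by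
    refine (pr_le_sum _ hcov).trans (le_of_eq ?_)
    rw [Finset.sum_congr rfl fun j _ => pr_map_equiv (shift 0 j) (hEd.toFinset hfin)]
    rw [Finset.sum_const, Int.card_Icc, nsmul_eq_mul]
    congr 1
    rw [show d + 1 - -d = ((4 * n + 1 : ℕ) : ℤ) by push_cast; omega, Int.toNat_natCast]
    push_cast; rfl
  have hE0 := pr_nonneg E
  have h1n : (1 : ℝ) ≤ n := by exact_mod_cast hn
  refine le_trans ?_ (pr_mono hEs)
  rw [div_div, div_le_iff₀ (by positivity)]
  nlinarith

end LowerBound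

/-- A walk joining two sites of the left side of a rectangle separates the sites in between from
the three other sides. -/
theorem left_separate {x₀ x₁ y₀ y₁ l w u : ℤ} {A B : Set Site} {v : Site}
    (hA : A ⊆ rect x₀ x₁ y₀ y₁) (hB : B ⊆ rect x₀ x₁ y₀ y₁) (wA : Walk A (x₀, u) (x₀, l))
    (wB : Walk B (x₀, w) v) (hl : l < w) (hu : w < u)
    (hv : v.1 = x₁ ∨ v.2 = y₀ ∨ v.2 = y₁) : ∃ z, z ∈ A ∧ z ∈ B := by
  have hu' := hA wA.start_mem
  have hl' := hA wA.end_mem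
  have hv' := hB wB.end_mem
  simp only [rect, Set.mem_ofPred_eq] at hu' hl' hv'
  set A' : Set Site := A ∪ {z | z.1 = x₀ - 1 ∧ y₀ - 1 ≤ z.2 ∧ z.2 ≤ y₁ + 1 ∧ (u ≤ z.2 ∨ z.2 ≤ l)}
    with hA'
  set B' : Set Site := B ∪ {z | z = (x₀ - 1, w) ∨
    x₀ ≤ z.1 ∧ z.1 ≤ x₁ ∧ (z.2 = y₀ - 1 ∨ z.2 = y₁ + 1)} with hB'
  have w₁ : Walk A' (x₀ - 1, y₁ + 1) (x₀ - 1, y₀ - 1) := by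
    have a₁ : Walk A' (x₀ - 1, y₁ + 1) (x₀ - 1, u) := Walk.vert _ fun z h1 h2 =>
      Or.inr ⟨rfl, by dsimp only; omega, by dsimp only; omega, by dsimp only; omega⟩
    have a₂ : Walk A' (x₀ - 1, l) (x₀ - 1, y₀ - 1) := Walk.vert _ fun z h1 h2 =>
      Or.inr ⟨rfl, by dsimp only; omega, by dsimp only; omega, by dsimp only; omega⟩
    refine (a₁.trans (.head a₁.end_mem ?_ (wA.mono Set.subset_union_left))).trans
      (.head (Or.inl wA.end_mem) ?_ a₂) <;> rw [adj_iff] <;> dsimp only <;> omega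
  have w₂ : ∃ r, r.1 = x₁ ∧ Walk B' (x₀ - 1, w) r := by
    have b₁ : Walk B' (x₀ - 1, w) v := .head (Or.inr (Or.inl rfl))
      (by rw [adj_iff]; dsimp only; omega) (wB.mono Set.subset_union_left)
    obtain hv | hv := hv
    · exact ⟨v, hv, b₁⟩
    obtain ⟨y, hy, hyv⟩ : ∃ y, (y = y₀ - 1 ∨ y = y₁ + 1) ∧ Adj v (v.1, y) := by
      obtain h | h := hv
      · exact ⟨y₀ - 1, Or.inl rfl, by rw [adj_iff]; dsimp only; omega⟩
      · exact ⟨y₁ + 1, Or.inr rfl, by rw [adj_iff]; dsimp only; omega⟩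
    have b₂ : Walk B' (v.1, y) (x₁, y) := Walk.horiz _ fun z h1 h2 =>
      Or.inr (Or.inr ⟨by dsimp only; omega, by dsimp only; omega, hy⟩)
    exact ⟨_, rfl, b₁.trans (.head b₁.end_mem hyv b₂)⟩
  obtain ⟨r, hr, w₂⟩ := w₂
  have hB'r : B' ⊆ rect (x₀ - 1) x₁ (y₀ - 1) (y₁ + 1) := by
    rintro z (hz | hz)
    · have := hB hz
      simp only [rect, Set.mem_ofPred_eq] at this ⊢; omega
    · simp only [rect, Set.mem_ofPred_eq, Prod.ext_iff] at hz ⊢; omega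
  have hA'r : A' ⊆ rect (x₀ - 1) x₁ (y₀ - 1) (y₁ + 1) := by
    rintro z (hz | hz)
    · have := hA hz
      simp only [rect, Set.mem_ofPred_eq] at this ⊢; omega
    · simp only [rect, Set.mem_ofPred_eq] at hz ⊢; omega
  obtain ⟨z, hz, hz'⟩ := rect_cross hB'r hA'r w₂ w₁ rfl hr rfl rfl
  rcases hz' with hz' | hz' <;> rcases hz with hz | hz
  · exact ⟨z, hz', hz⟩
  · have := hA hz'
    simp only [rect, Set.mem_ofPred_eq, Prod.ext_iff] at this hz; omega
  · have := hB hz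
    simp only [rect, Set.mem_ofPred_eq] at this hz'; omega
  · simp only [Set.mem_ofPred_eq, Prod.ext_iff] at hz hz'; omega

/-- The half box of radius `k` around `(0, t)`. -/
def box (k t : ℤ) : Set Site := rect 0 k (t - k) (t + k)

/-- The sides of a half box that do not lie on the axis. -/
def outer (k t : ℤ) : Set Site := {v | v.1 = k ∨ v.2 = t - k ∨ v.2 = t + k}

theorem box_finite (k t : ℤ) : (box k t).Finite := rect_finite _ _ _ _

theorem box_mono {k k' t t' : ℤ} (h : k + |t - t'| ≤ k') : box k t ⊆ box k' t' := by
  have h1 := abs_le.1 (le_refl |t - t'|)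
  intro z hz
  simp only [box, rect, Set.mem_ofPred_eq] at *; omega

theorem box_walk {k t : ℤ} {p : Site} (hp : p ∈ box k t) : Walk (box k t) (0, t) p := by
  have w₁ : Walk (box k t) (0, t) (0, p.2) := Walk.vert _ fun z h1 h2 => by
    simp only [box, rect, Set.mem_ofPred_eq] at *; omega
  have w₂ : Walk (box k t) (0, p.2) (p.1, p.2) := Walk.horiz _ fun z h1 h2 => by
    simp only [box, rect, Set.mem_ofPred_eq] at *; omega
  exact w₁.trans w₂

/-- A half circuit around a half box meets every walk from the half box to the far sides. -/
theorem circuit_meets {x₁ y₀ y₁ k t : ℤ} {A B : Set Site} {a a' p q v : Site}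
    (hA : A ⊆ rect 0 x₁ y₀ y₁ \ box k t) (hB : B ⊆ rect 0 x₁ y₀ y₁)
    (hbox : box k t ⊆ rect 0 x₁ y₀ y₁) (wA : Walk A a a') (ha : a.1 = 0 ∧ t < a.2)
    (ha' : a'.1 = 0 ∧ a'.2 < t) (hq : q ∈ box k t) (hqp : q = p ∨ Adj q p) (wB : Walk B p v)
    (hv : v.1 = x₁ ∨ v.2 = y₀ ∨ v.2 = y₁) : ∃ z, z ∈ A ∧ z ∈ B := by
  obtain ⟨a₁, u⟩ := a
  obtain ⟨a₁', l⟩ := a'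
  obtain ⟨rfl, hu⟩ : a₁ = 0 ∧ t < u := ha
  obtain ⟨rfl, hl⟩ : a₁' = 0 ∧ l < t := ha'
  have w : Walk (B ∪ box k t) (0, t) v := by
    have w₁ : Walk (B ∪ box k t) (0, t) q := (box_walk hq).mono Set.subset_union_right
    have w₂ : Walk (B ∪ box k t) p v := wB.mono Set.subset_union_left
    rcases hqp with rfl | h
    · exact w₁.trans w₂
    · exact w₁.trans (.head w₁.end_mem h w₂)
  obtain ⟨z, hz, hz' | hz'⟩ := left_separate (hA.trans Set.sdiff_subset) (Set.union_subset hB hbox)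
    wA w hl hu hv
  · exact ⟨z, hz, hz'⟩
  · exact absurd hz' (hA hz).2

/-- There is a half circuit of colour `b` in the half annulus of radii `k` and `4 * k`. -/
def circuit (b : Bool) (k t : ℤ) : Set Config :=
  Link b (box (4 * k) t \ box k t) {v | v.1 = 0 ∧ t < v.2} {v | v.1 = 0 ∧ v.2 < t}

theorem circuit_depOn (b : Bool) (k t : ℤ) :
    DepOn (box (4 * k) t \ box k t) (circuit b k t) := Link.depOn _ _ _ _

theorem pr_circuit_ge : ∃ c : ℝ, 0 < c ∧ c < 1 ∧ ∀ b k t, 1 ≤ k → c ≤ pr (circuit b k t) := by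
  obtain ⟨c, hc, hLR⟩ := rsw 2
  obtain ⟨c', hc', hTB⟩ := rsw_TB 4
  refine ⟨min (c * (c * c')) (1 / 2), by positivity, by
    exact lt_of_le_of_lt (min_le_right _ _) (by norm_num), fun b k t hk => ?_⟩
  refine (min_le_left _ _).trans ?_
  have p₁ : c ≤ pr (LR b 0 (4 * k) (t + k + 1) (t + 4 * k)) :=
    hLR _ _ _ _ _ (by omega) (by omega) (by push_cast; omega)
  have p₂ : c ≤ pr (LR b 0 (4 * k) (t - 4 * k) (t - k - 1)) :=
    hLR _ _ _ _ _ (by omega) (by omega) (by push_cast; omega)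
  have p₃ : c' ≤ pr (TB b (k + 1) (4 * k) (t - 4 * k) (t + 4 * k)) :=
    hTB _ _ _ _ _ (by omega) (by omega) (by push_cast; omega)
  have s₁ : rect 0 (4 * k) (t + k + 1) (t + 4 * k) ⊆ box (4 * k) t \ box k t := fun z hz => by
    simp only [box, rect, Set.mem_sdiff, Set.mem_ofPred_eq] at *; omega
  have s₂ : rect 0 (4 * k) (t - 4 * k) (t - k - 1) ⊆ box (4 * k) t \ box k t := fun z hz => by
    simp only [box, rect, Set.mem_sdiff, Set.mem_ofPred_eq] at *; omega
  have s₃ : rect (k + 1) (4 * k) (t - 4 * k) (t + 4 * k) ⊆ box (4 * k) t \ box k t :=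
    fun z hz => by
      simp only [box, rect, Set.mem_sdiff, Set.mem_ofPred_eq] at *; omega
  have d₁ := (Link.depOn b _ {v | v.1 = 0} {v | v.1 = 4 * k}).mono s₁
  have d₂ := (Link.depOn b _ {v | v.1 = 0} {v | v.1 = 4 * k}).mono s₂
  have d₃ := (Link.depOn b _ {v | v.2 = t + 4 * k} {v | v.2 = t - 4 * k}).mono s₃
  have f₂ := pr_inter_of_favors ((box_finite _ _).subset Set.sdiff_subset) d₂ d₃
    (Link.favors _ _ _ _) (Link.favors _ _ _ _)
  have f₁ := pr_inter_of_favors ((box_finite _ _).subset Set.sdiff_subset) d₁ (d₂.inter d₃)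
    (Link.favors _ _ _ _) ((Link.favors _ _ _ _).inter (Link.favors _ _ _ _))
  refine ((mul_le_mul p₁ ((mul_le_mul p₂ p₃ hc'.le (pr_nonneg _)).trans f₂) (by positivity)
    (pr_nonneg _)).trans f₁).trans (pr_mono ?_)
  rintro ω ⟨⟨a, ha, a', ha', w₁⟩, ⟨e, he, e', he', w₂⟩, ⟨g, hg, g', hg', w₃⟩⟩
  obtain ⟨A, hA, wA, hA'⟩ := w₁.exists_support
  obtain ⟨B, hB, wB, hB'⟩ := w₂.exists_support
  obtain ⟨C, hC, wC, hC'⟩ := w₃.exists_support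
  have ba := (hA wA.start_mem).1
  have be := (hB wB.start_mem).1
  simp only [Set.mem_ofPred_eq] at ha ha' he he' hg hg'
  obtain ⟨z, hz, hz'⟩ := strip_cross (x₀ := 0) (x₁ := 4 * k) (a := t + k + 1) (b := t + 4 * k)
    (by omega) (fun z hz => by
      have := (hC hz).1
      simp only [rect, Set.mem_ofPred_eq] at this; omega) (fun z hz => (hA hz).1) wC hg.ge
    (by omega) wA ha ha'
  obtain ⟨y, hy, hy'⟩ := strip_cross (x₀ := 0) (x₁ := 4 * k) (a := t - 4 * k) (b := t - k - 1)
    (by omega) (fun z hz => by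
      have := (hC hz).1
      simp only [rect, Set.mem_ofPred_eq] at this; omega) (fun z hz => (hB hz).1) wC (by omega)
    hg'.le wB he he'
  simp only [rect, Set.mem_ofPred_eq] at ba be
  refine ⟨a, ⟨ha, by omega⟩, e, ⟨he, by omega⟩, ?_⟩
  exact ((((hA' z hz').1.mono (Set.inter_subset_inter_left _ s₁)).trans
    ((hC' z hz).1.symm.mono (Set.inter_subset_inter_left _ s₃))).trans
    ((hC' y hy).1.mono (Set.inter_subset_inter_left _ s₃))).trans
    ((hB' y hy').1.symm.mono (Set.inter_subset_inter_left _ s₂))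

theorem circuit_not_link {b : Bool} {k t : ℤ} (hk : 0 ≤ k) {ω : Config}
    (h : ω ∈ circuit (!b) k t) : ω ∉ Link b (box (4 * k) t) (box k t) (outer (4 * k) t) := by
  rintro ⟨p, hp, v, hv, w⟩
  obtain ⟨a, ha, a', ha', w'⟩ := h
  obtain ⟨z, hz, hz'⟩ := circuit_meets (x₁ := 4 * k) (y₀ := t - 4 * k) (y₁ := t + 4 * k)
    (k := k) (t := t) (fun z hz => hz.1) (fun z hz => hz.1) (box_mono (by simp; omega)) w' ha ha' hp (Or.inl rfl) w hv
  have h1 := hz.2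
  have h2 := hz'.2
  simp only [Set.mem_ofPred_eq] at h1 h2
  simp [h2] at h1

/-- Uniformly over the scale, an arm crosses a half annulus with probability bounded away from
one. -/
theorem pr_arm_le : ∃ lam : ℝ, 0 < lam ∧ lam < 1 ∧ ∀ b k t, 1 ≤ k →
    pr (circuit (!b) k t)ᶜ ≤ lam ∧
    pr (Link b (box (4 * k) t) (box k t) (outer (4 * k) t)) ≤ lam := by
  obtain ⟨c, hc, hc1, h⟩ := pr_circuit_ge
  refine ⟨1 - c, by linarith, by linarith, fun b k t hk => ?_⟩
  have h1 : pr (circuit (!b) k t)ᶜ ≤ 1 - c := by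
    rw [pr_compl ((circuit_depOn _ _ _).toFinset ((box_finite _ _).subset Set.sdiff_subset))]
    linarith [h (!b) k t hk]
  exact ⟨h1, (pr_mono fun ω hω hc => circuit_not_link (by omega) hc hω).trans h1⟩

/-- The probability that the origin of a half box of radius `4 ^ m` has an arm to its far sides
decays geometrically. -/
theorem pr_one_arm_le : ∃ lam : ℝ, 0 < lam ∧ lam < 1 ∧ ∀ (b : Bool) (t : ℤ) (m : ℕ),
    pr (Link b (box (4 ^ m) t) {(0, t)} (outer (4 ^ m) t)) ≤ lam ^ m := by
  obtain ⟨lam, h0, h1, h⟩ := pr_arm_le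
  refine ⟨lam, h0, h1, fun b t m => ?_⟩
  induction m with
  | zero => simpa using pr_le_one _
  | succ m ih =>
    have hk : (1 : ℤ) ≤ 4 ^ m := one_le_pow₀ (by norm_num)
    have hf : (box (4 ^ m * 4) t).Finite := box_finite _ _
    rw [pow_succ, pow_succ]
    refine le_trans (pr_mono (F := Link b (box (4 ^ m) t) {(0, t)} (outer (4 ^ m) t) ∩
      (circuit (!b) (4 ^ m) t)ᶜ) ?_) ?_
    · intro ω hω
      refine ⟨?_, fun hc => circuit_not_link (by omega) hc ?_⟩
      · obtain ⟨s, rfl, v, hv, w⟩ := hω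
        have hv' := w.end_mem.1
        obtain ⟨a, e, w', hae, he, w''⟩ := w.exit (P := box (4 ^ m) t) (by
          simp only [box, rect, Set.mem_ofPred_eq]; omega) (by
          simp only [box, outer, rect, Set.mem_ofPred_eq] at hv hv' ⊢; omega)
        have he' := w''.start_mem.1
        have ha := w'.end_mem.2
        refine ⟨_, rfl, a, ?_, w'.mono fun z hz => ⟨hz.2, hz.1.2⟩⟩
        rw [adj_iff] at hae
        simp only [box, outer, rect, Set.mem_ofPred_eq] at *; omega
      · rw [mul_comm] at hω
        refine Link.mono subset_rfl ?_ (fun v _ h => h) hω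
        rintro v - rfl
        simp only [box, rect, Set.mem_ofPred_eq]; omega
    · rw [pr_inter_of_disjoint (box_finite _ _) ((box_finite _ _).subset Set.sdiff_subset)
        (Link.depOn _ _ _ _) (circuit_depOn _ _ _).compl Set.disjoint_sdiff_right]
      exact mul_le_mul ih (h b _ t hk).1 (pr_nonneg _) (by positivity)

theorem Walk.exit_box {A : Set Site} {K t : ℤ} {s v : Site} (w : Walk A s v)
    (hA : ∀ z ∈ A, 0 ≤ z.1) (hs : s ∈ box K t) (hv : v ∉ box K t \ outer K t) :
    ∃ a ∈ outer K t, Walk (A ∩ box K t) s a := by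
  by_cases hs' : s ∈ outer K t
  · exact ⟨s, hs', .refl (Set.mem_inter w.start_mem hs)⟩
  obtain ⟨a, b, w₁, e, hb, w₂⟩ := w.exit (P := box K t \ outer K t) ⟨hs, hs'⟩ hv
  have hbb : b ∈ box K t := by
    have h1 := w₁.end_mem.2
    have h2 := hA b w₂.start_mem
    rw [adj_iff] at e
    simp only [box, outer, rect, Set.mem_sdiff, Set.mem_ofPred_eq] at h1 ⊢; omega
  have hsub : A ∩ (box K t \ outer K t) ⊆ A ∩ box K t := fun z hz => ⟨hz.1, hz.2.1⟩
  refine ⟨b, ?_, (w₁.mono hsub).snoc e ⟨w₂.start_mem, hbb⟩⟩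
  by_contra h
  exact hb ⟨hbb, h⟩

/-- An open arm from `(0, t)` and a closed arm from `(0, t - 1)`. -/
def twoArm (r t : ℤ) : Set Config :=
  Link true (box (5 * r) t) {(0, t)} (outer (5 * r) t) ∩
    Link false (box (5 * r) t) {(0, t - 1)} (outer (5 * r) t)

theorem twoArm_depOn (r t : ℤ) : DepOn (box (5 * r) t) (twoArm r t) :=
  (Link.depOn _ _ _ _).inter (Link.depOn _ _ _ _)

theorem pr_twoArm_eq (r t t' : ℤ) : pr (twoArm r t) ≤ pr (twoArm r t') := by
  rw [← pr_map_equiv (shift 0 (t - t')) ((twoArm_depOn r t').toFinset (box_finite _ _))]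
  refine pr_mono fun ω ⟨h₁, h₂⟩ => ⟨Link.of_shift h₁ ?_ ?_ ?_, Link.of_shift h₂ ?_ ?_ ?_⟩ <;>
  simp only [shift, box, outer, rect, Equiv.coe_fn_mk, Set.mem_ofPred_eq, Set.mem_singleton_iff,
    Prod.ext_iff] <;> intro v <;> omega

theorem pr_twoArm_le : ∃ C : ℝ, 0 < C ∧ ∀ (r : ℕ) (t : ℤ), 1 ≤ r → pr (twoArm r t) ≤ C / r := by
  obtain ⟨lam, -, h1, h⟩ := pr_arm_le
  refine ⟨(1 - lam)⁻¹, inv_pos.2 (by linarith), fun r t hr => ?_⟩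
  have hr0 : (0 : ℝ) < r := by exact_mod_cast hr
  rw [le_div_iff₀ hr0]
  have key := sum_pr_le_of_clusters (Finset.range r) (T := fun j => twoArm r (j : ℤ)) (b := true)
    (D := box (4 * r) 0) (I := box r 0) (J := outer (4 * r) 0) (box_finite _ _) (box_finite _ _)
    (fun j _ => (twoArm_depOn _ _).measurable (box_finite _ _)) (fun ω => ⟨fun j => (0, (j : ℤ)), ?_, ?_⟩)
    (h true r 0 (by omega)).2 h1
  · refine le_trans ?_ key
    refine le_trans ?_ (Finset.sum_le_sum (f := fun _ => pr (twoArm r t))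
      fun j _ => pr_twoArm_eq r t j)
    simp [mul_comm]
  · rintro j hj ⟨⟨s, rfl, v, hv, w⟩, -⟩
    rw [Finset.mem_range] at hj
    have hs : ((0 : ℤ), (j : ℤ)) ∈ box r 0 := by
      simp only [box, rect, Set.mem_ofPred_eq]; omega
    obtain ⟨a, ha, w'⟩ := w.exit_box (K := 4 * r) (t := 0)
      (fun z hz => by
        have := hz.1
        simp only [box, rect, Set.mem_ofPred_eq] at this; omega)
      (box_mono (by simp; omega) hs) (by
        simp only [outer, box, rect, Set.mem_sdiff, Set.mem_ofPred_eq] at hv ⊢; omega)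
    exact ⟨hs, a, ha, w'.mono fun z hz => ⟨hz.2, hz.1.2⟩⟩
  · have aux : ∀ j ∈ Finset.range r, ∀ j' ∈ Finset.range r, ω ∈ twoArm r (j : ℤ) →
        ω ∈ twoArm r (j' : ℤ) → j < j' →
        ¬ Walk (box (4 * r) 0 ∩ {v | ω v = true}) (0, (j : ℤ)) (0, (j' : ℤ)) := by
      rintro j hj j' hj' - ⟨-, s, rfl, v, hv, w⟩ hjj W
      rw [Finset.mem_range] at hj hj'
      obtain ⟨a, ha, w'⟩ := w.exit_box (K := 4 * r) (t := 0)
        (fun z hz => by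
          have := hz.1
          simp only [box, rect, Set.mem_ofPred_eq] at this; omega)
        (by simp only [box, rect, Set.mem_ofPred_eq]; omega) (by
          simp only [outer, box, rect, Set.mem_sdiff, Set.mem_ofPred_eq] at hv ⊢; omega)
      have hc := w.start_mem.2
      have ho := W.start_mem.2
      simp only [Set.mem_ofPred_eq] at hc ho
      rcases eq_or_lt_of_le (show (j : ℤ) ≤ j' - 1 by omega) with h | h
      · rw [← h, ho] at hc; cases hc
      · obtain ⟨z, hz, hz'⟩ := left_separate (fun z hz => hz.1) (fun z hz => hz.2) W.symm w' h
          (by omega) ha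
        have e1 := hz.2
        have e2 := hz'.1.2
        simp only [Set.mem_ofPred_eq] at e1 e2
        rw [e1] at e2; cases e2
    intro j hj j' hj' hω hω' hne W
    rcases lt_or_gt_of_ne hne with hlt | hlt
    · exact aux j hj j' hj' hω hω' hlt W
    · exact aux j' hj' j hj hω' hω hlt W.symm

/-- The far sides of `[h, h + 5 * r] × [c - 4 * r, c + 4 * r]`. -/
def far (h r c : ℤ) : Set Site := {v | v.1 = h + 5 * r ∨ v.2 = c - 4 * r ∨ v.2 = c + 4 * r}

/-- Three arms, open, open and closed, from the neighbouring sites `(h, z)`, `(h, z - 1)` and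
`(h + 1, z - 1)`, inside the half plane to the right of `h`. -/
def threeArmAt (h r c z : ℤ) : Set Config :=
  Link true (rect h (h + 5 * r) (c - 4 * r) (c + 4 * r) \ {(h, z - 1)}) {(h, z)} (far h r c) ∩
  (Link true (rect h (h + 5 * r) (c - 4 * r) (c + 4 * r) \ {(h, z)}) {(h, z - 1)} (far h r c) ∩
  Link false (rect h (h + 5 * r) (c - 4 * r) (c + 4 * r)) {(h + 1, z - 1)} (far h r c))

def threeArm (h r c : ℤ) : Set Config := {ω | ∃ z, c ≤ z ∧ z < c + r ∧ ω ∈ threeArmAt h r c z}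

theorem threeArm_depOn (h r c : ℤ) :
    DepOn (rect h (h + 5 * r) (c - 4 * r) (c + 4 * r)) (threeArm h r c) := by
  rintro ω ω' hω ⟨z, h₁, h₂, h₃⟩
  exact ⟨z, h₁, h₂, (((Link.depOn _ _ _ _).mono Set.sdiff_subset).inter
    (((Link.depOn _ _ _ _).mono Set.sdiff_subset).inter (Link.depOn _ _ _ _))) ω ω' hω h₃⟩

theorem pr_threeArm_eq (h r c : ℤ) : pr (threeArm 0 r c) ≤ pr (threeArm h r c) := by
  rw [← pr_map_equiv (shift (-h) 0) ((threeArm_depOn h r c).toFinset (rect_finite _ _ _ _))]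
  refine pr_mono fun ω ⟨z, hz, hz', h₁, h₂, h₃⟩ => ⟨z, hz, hz', Link.of_shift h₁ ?_ ?_ ?_,
    Link.of_shift h₂ ?_ ?_ ?_, Link.of_shift h₃ ?_ ?_ ?_⟩ <;>
  simp only [shift, far, rect, Equiv.coe_fn_mk, Set.mem_ofPred_eq, Set.mem_singleton_iff,
    Set.mem_sdiff, Prod.ext_iff] <;> intro v <;> omega

theorem threeArm_separate {r c h h' z z' : ℤ} (hh : 0 ≤ h) (hh' : h' < r) (hlt : h < h') {ω : Config}
    (hz : c ≤ z') (hz' : z' < c + r) (hω : ω ∈ threeArmAt h' r c z') :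
    ¬ Walk (box (4 * r) c ∩ {v | ω v = false}) (h + 1, z - 1) (h' + 1, z' - 1) := by
  intro W
  obtain ⟨⟨s, rfl, v, hv, α⟩, ⟨s', rfl, v', hv', β⟩, -⟩ := hω
  have hα := α.start_mem
  have hβ := β.start_mem
  obtain ⟨a, ha, α'⟩ := α.exit_box (K := 4 * r) (t := c) (fun z hz => by
    have := hz.1
    simp only [rect, Set.mem_ofPred_eq, Set.mem_sdiff] at this; omega)
    (by simp only [box, rect, Set.mem_ofPred_eq]; omega)
    (by simp only [far, outer, box, rect, Set.mem_sdiff, Set.mem_ofPred_eq] at hv ⊢; omega)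
  obtain ⟨a', ha', β'⟩ := β.exit_box (K := 4 * r) (t := c) (fun z hz => by
    have := hz.1
    simp only [rect, Set.mem_ofPred_eq, Set.mem_sdiff] at this; omega)
    (by simp only [box, rect, Set.mem_ofPred_eq]; omega)
    (by simp only [far, outer, box, rect, Set.mem_sdiff, Set.mem_ofPred_eq] at hv' ⊢; omega)
  obtain ⟨p, ⟨q, w⟩, W', e, hq, W''⟩ := W.symm.exit (P := {v | h' < v.1})
    (by simp only [Set.mem_ofPred_eq]; omega) (by simp only [Set.mem_ofPred_eq]; omega)
  have hqc := W''.start_mem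
  have hp := W'.end_mem.2
  rw [adj_iff] at e
  simp only [Set.mem_ofPred_eq] at hq hp
  obtain rfl : q = h' := by omega
  have hD : ∀ {y : Site} {x : ℤ}, x ≤ q → y ∈ box (4 * r) c → q ≤ y.1 →
      y ∈ rect q (4 * r) (c - 4 * r) (c + 4 * r) := fun hx hy hy' => by
    simp only [box, rect, Set.mem_ofPred_eq] at hy ⊢; omega
  have hw1 : w ≠ z' := by
    rintro rfl
    have e1 := hα.2
    have e2 := hqc.2
    simp only [Set.mem_ofPred_eq] at e1 e2
    rw [e1] at e2; cases e2
  have hw2 : w ≠ z' - 1 := by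
    rintro rfl
    have e1 := hβ.2
    have e2 := hqc.2
    simp only [Set.mem_ofPred_eq] at e1 e2
    rw [e1] at e2; cases e2
  have main : ∀ y, y = z' ∨ y = z' - 1 → Walk ({(q, y)} ∪ rect q (4 * r) (c - 4 * r) (c + 4 * r) ∩
      {v | ω v = false}) (q, w) (q, y) := by
    intro y hy
    have w₁ : Walk ({(q, y)} ∪ rect q (4 * r) (c - 4 * r) (c + 4 * r) ∩ {v | ω v = false})
        (q + 1, z' - 1) p := W'.mono fun x hx =>
      Or.inr ⟨hD le_rfl hx.1.1 (le_of_lt hx.2), hx.1.2⟩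
    refine (Walk.head (Or.inr ⟨hD le_rfl hqc.1 le_rfl, hqc.2⟩) ?_ w₁.symm).snoc ?_ (Or.inl rfl) <;>
    rw [adj_iff] <;> dsimp only <;> omega
  have hQ : ∀ y, y = z' ∨ y = z' - 1 → {(q, y)} ∪ rect q (4 * r) (c - 4 * r) (c + 4 * r) ∩
      {v | ω v = false} ⊆ rect q (4 * r) (c - 4 * r) (c + 4 * r) := by
    rintro y hy x (rfl | hx)
    · simp only [rect, Set.mem_ofPred_eq]; omega
    · exact hx.1
  rcases lt_or_gt_of_ne hw1 with hw | hw
  · obtain ⟨x, hx, hx'⟩ := left_separate (hQ z' (Or.inl rfl)) (fun x hx => hD le_rfl hx.2 (by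
      have := hx.1.1.1
      simp only [rect, Set.mem_ofPred_eq] at this; omega)) (main z' (Or.inl rfl)).symm β'
      (by omega) (by omega) ha'
    rcases hx with rfl | hx
    · exact hx'.1.1.2 rfl
    · have e1 := hx.2
      have e2 := hx'.1.2
      simp only [Set.mem_ofPred_eq] at e1 e2
      rw [e1] at e2; cases e2
  · obtain ⟨x, hx, hx'⟩ := left_separate (hQ (z' - 1) (Or.inr rfl)) (fun x hx => hD le_rfl hx.2 (by
      have := hx.1.1.1
      simp only [rect, Set.mem_ofPred_eq] at this; omega)) (main (z' - 1) (Or.inr rfl)) α'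
      (by omega) (by omega) ha
    rcases hx with rfl | hx
    · exact hx'.1.1.2 rfl
    · have e1 := hx.2
      have e2 := hx'.1.2
      simp only [Set.mem_ofPred_eq] at e1 e2
      rw [e1] at e2; cases e2

theorem pr_threeArm_le : ∃ C : ℝ, 0 < C ∧ ∀ (r : ℕ) (c : ℤ), 1 ≤ r →
    pr (threeArm 0 r c) ≤ C / r := by
  obtain ⟨lam, -, h1, h⟩ := pr_arm_le
  refine ⟨(1 - lam)⁻¹, inv_pos.2 (by linarith), fun r c hr => ?_⟩
  have hr0 : (0 : ℝ) < r := by exact_mod_cast hr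
  rw [le_div_iff₀ hr0]
  have key := sum_pr_le_of_clusters (Finset.range r) (T := fun j => threeArm (j : ℤ) r c)
    (b := false) (D := box (4 * r) c) (I := box r c) (J := outer (4 * r) c) (box_finite _ _)
    (box_finite _ _) (fun j _ => (threeArm_depOn _ _ _).measurable (rect_finite _ _ _ _)) (fun ω => ?_)
    (h false r c (by omega)).2 h1
  · refine le_trans ?_ key
    refine le_trans ?_ (Finset.sum_le_sum (f := fun _ => pr (threeArm 0 r c))
      fun j _ => pr_threeArm_eq j r c)
    simp [mul_comm]
  · have hch : ∀ j : ℕ, ∃ z, ω ∈ threeArm (j : ℤ) r c →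
        c ≤ z ∧ z < c + r ∧ ω ∈ threeArmAt j r c z := fun j => by
      by_cases hj : ω ∈ threeArm (j : ℤ) r c
      · obtain ⟨z, hz⟩ := hj
        exact ⟨z, fun _ => hz⟩
      · exact ⟨0, fun h => absurd h hj⟩
    choose z hz using hch
    refine ⟨fun j => ((j : ℤ) + 1, z j - 1), ?_, ?_⟩
    · intro j hj hω
      obtain ⟨hz₀, hz₁, -, -, s, rfl, v, hv, w⟩ := hz j hω
      rw [Finset.mem_range] at hj
      have hs : ((j : ℤ) + 1, z j - 1) ∈ box r c := by
        simp only [box, rect, Set.mem_ofPred_eq]; omega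
      obtain ⟨a, ha, w'⟩ := w.exit_box (K := 4 * r) (t := c)
        (fun z hz => by
          have := hz.1
          simp only [rect, Set.mem_ofPred_eq] at this; omega)
        (box_mono (by simp; omega) hs) (by
          simp only [far, outer, box, rect, Set.mem_sdiff, Set.mem_ofPred_eq] at hv ⊢; omega)
      exact ⟨hs, a, ha, w'.mono fun z hz => ⟨hz.2, hz.1.2⟩⟩
    · intro j hj j' hj' hω hω' hne W
      rw [Finset.mem_range] at hj hj'
      obtain ⟨a₁, a₂, a₃⟩ := hz j hω
      obtain ⟨b₁, b₂, b₃⟩ := hz j' hω'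
      rcases lt_or_gt_of_ne hne with hlt | hlt
      · exact threeArm_separate (by omega) (by omega) (by omega) b₁ b₂ b₃ W
      · exact threeArm_separate (by omega) (by omega) (by omega) a₁ a₂ a₃ W.symm

/-- A walk joining the left side to the top separates the left side above it from the right side
and the bottom. -/
theorem left_top_separate {x₀ x₁ y₀ y₁ l w : ℤ} {A B : Set Site} {u v : Site}
    (hA : A ⊆ rect x₀ x₁ y₀ y₁) (hB : B ⊆ rect x₀ x₁ y₀ y₁) (wA : Walk A u (x₀, l))
    (hu : u.2 = y₁) (wB : Walk B (x₀, w) v) (hl : l < w)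
    (hv : v.1 = x₁ ∨ v.2 = y₀) : ∃ z, z ∈ A ∧ z ∈ B := by
  have hl' := hA wA.end_mem
  have hv' := hB wB.end_mem
  simp only [rect, Set.mem_ofPred_eq] at hl' hv'
  set A' : Set Site := A ∪ {z | z.1 = x₀ - 1 ∧ y₀ - 1 ≤ z.2 ∧ z.2 ≤ l} with hA'
  set B' : Set Site := B ∪ {z | z = (x₀ - 1, w) ∨ x₀ ≤ z.1 ∧ z.1 ≤ x₁ ∧ z.2 = y₀ - 1} with hB'
  have w₁ : Walk A' u (x₀ - 1, y₀ - 1) := by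
    have a₂ : Walk A' (x₀ - 1, l) (x₀ - 1, y₀ - 1) := Walk.vert _ fun z h1 h2 =>
      Or.inr ⟨rfl, by dsimp only; omega, by dsimp only; omega⟩
    exact (wA.mono Set.subset_union_left).trans
      (.head (Or.inl wA.end_mem) (by rw [adj_iff]; dsimp only; omega) a₂)
  have w₂ : ∃ r, r.1 = x₁ ∧ Walk B' (x₀ - 1, w) r := by
    have b₁ : Walk B' (x₀ - 1, w) v := .head (Or.inr (Or.inl rfl))
      (by rw [adj_iff]; dsimp only; omega) (wB.mono Set.subset_union_left)
    obtain hv | hv := hv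
    · exact ⟨v, hv, b₁⟩
    have b₂ : Walk B' (v.1, y₀ - 1) (x₁, y₀ - 1) := Walk.horiz _ fun z h1 h2 =>
      Or.inr (Or.inr ⟨by dsimp only; omega, by dsimp only; omega, rfl⟩)
    exact ⟨_, rfl, b₁.trans (.head b₁.end_mem (by rw [adj_iff]; dsimp only; omega) b₂)⟩
  obtain ⟨r, hr, w₂⟩ := w₂
  have hB'r : B' ⊆ rect (x₀ - 1) x₁ (y₀ - 1) y₁ := by
    rintro z (hz | hz)
    · have := hB hz
      simp only [rect, Set.mem_ofPred_eq] at this ⊢; omega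
    · have := hB wB.start_mem
      simp only [rect, Set.mem_ofPred_eq, Prod.ext_iff] at this hz ⊢; omega
  have hA'r : A' ⊆ rect (x₀ - 1) x₁ (y₀ - 1) y₁ := by
    rintro z (hz | hz)
    · have := hA hz
      simp only [rect, Set.mem_ofPred_eq] at this ⊢; omega
    · simp only [rect, Set.mem_ofPred_eq] at hz ⊢; omega
  obtain ⟨z, hz, hz'⟩ := rect_cross hB'r hA'r w₂ w₁ rfl hr hu rfl
  rcases hz' with hz' | hz' <;> rcases hz with hz | hz
  · exact ⟨z, hz', hz⟩
  · have := hA hz'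
    simp only [rect, Set.mem_ofPred_eq, Prod.ext_iff] at this hz; omega
  · have := hB hz
    simp only [rect, Set.mem_ofPred_eq] at this hz'; omega
  · simp only [Set.mem_ofPred_eq, Prod.ext_iff] at hz hz'; omega

/-- Let `a₁, …, a₅` be boundary arcs of `D` and `E` an event providing a fresh connection of
colour `c` from `a₁` to the cluster of `a₄` of the other colour. Exploring that cluster shows that,
at the cost of a factor `pr E`, the arcs `a₁` and `a₃` can be required to be linked. -/
theorem pr_mul_le_of_explore {D : Set Site} (hD : D.Finite) (c : Bool)
    {a₁ a₂ a₃ a₄ a₅ touch Y : Set Site} {E : Set Config} (hY : Y ⊆ D)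
    (hcirc : ∀ ω ∈ E, ∀ B ⊆ D, ∀ p ∈ a₄, ∀ q ∈ touch, Walk B p q →
      ∃ s ∈ a₁, ∃ z ∈ B, Walk (Y ∩ {v | ω v = c}) s z)
    (hex : ∀ O : Set Site, (∃ s ∈ a₁, ∃ t ∈ a₃, Walk (D ∩ O) s t) ∨
      ∃ s ∈ a₂, ∃ t ∈ a₄ ∪ a₅, Walk (D ∩ Oᶜ) s t)
    (cross : ∀ A ⊆ D, ∀ B ⊆ D, ∀ s ∈ a₁, ∀ t ∈ a₄, ∀ u ∈ a₂, ∀ v ∈ a₅, Walk A s t → Walk B u v →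
      ∃ z, z ∈ A ∧ z ∈ B) :
    pr E * pr {ω | cluster (!c) D a₄ ω ∈ {S | (S ∩ touch).Nonempty ∧ Disjoint S a₂}} ≤
      pr (Link (!c) D a₄ touch ∩ Link c D a₁ a₃) := by
  refine explore hD (Y := fun S => Y \ explored D a₄ S)
    (F := fun S => {ω | ∃ s ∈ a₁, ∃ w ∈ explored D a₄ S,
      Walk (((Y \ explored D a₄ S) ∩ {v | ω v = c}) ∪ {w}) s w}) (pr_nonneg E) ?_ ?_
  · rintro ω ⟨⟨q, hqS, hq⟩, -⟩
    refine ⟨(hD.subset hY).subset Set.sdiff_subset, ?_, Set.disjoint_sdiff_right, pr_mono ?_⟩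
    · rintro ω₁ ω₂ h ⟨s, hs, w, hw, W⟩
      refine ⟨s, hs, w, hw, W.mono ?_⟩
      rintro z (⟨hz, hz'⟩ | hz)
      · exact Or.inl ⟨hz, (h z hz).symm.trans hz'⟩
      · exact Or.inr hz
    · intro ω' hω'
      obtain ⟨p, hp, W⟩ := cluster_walk hqS
      obtain ⟨s, hs, z, hz, W'⟩ := hcirc ω' hω' _ (cluster_subset _ _ _ _) p hp q hq W
      by_cases hse : s ∈ explored D a₄ (cluster (!c) D a₄ ω)
      · exact ⟨s, hs, s, hse, .refl (Or.inr rfl)⟩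
      · obtain ⟨a, b, W₁, e, hb, W₂⟩ := W'.exit (P := (explored D a₄ (cluster (!c) D a₄ ω))ᶜ) hse
          (fun h => h (Or.inl hz))
        rw [Set.notMem_compl_iff] at hb
        exact ⟨s, hs, b, hb, (W₁.mono fun x hx => Or.inl ⟨⟨hx.1.1, hx.2⟩, hx.1.2⟩).snoc e
          (Or.inr rfl)⟩
  · rintro ω ⟨⟨q, ⟨p, hp, W⟩, hq⟩, hdis⟩ ⟨s, hs, w, hw, f⟩
    refine ⟨⟨p, hp, q, hq, W⟩, ?_⟩
    set S := cluster (!c) D a₄ ω with hS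
    set O : Set Site := {z | (z ∈ explored D a₄ S ∧ z ∉ S) ∨
      (z ∈ Y \ explored D a₄ S ∧ ω z = c)} with hO
    obtain ⟨s', hs', t, ht, W'⟩ | ⟨u, hu, v, hv, W'⟩ := hex O
    · refine ⟨s', hs', t, ht, W'.mono fun z hz => ⟨hz.1, ?_⟩⟩
      rcases hz.2 with ⟨h1, h2⟩ | ⟨-, h2⟩
      · simpa using explored_color h1 h2
      · exact h2
    · exfalso
      have W₁ : Walk (D ∩ Oᶜ ∩ Sᶜ) u v := W'.inter_of_closed (Set.disjoint_right.1 hdis hu) <| by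
        intro a ha haD b hb e hbS
        exact haD.2 (Or.inl ⟨Or.inr ⟨haD.1, Or.inr ⟨b, hbS, e.symm⟩⟩, ha⟩)
      rcases hv with hv | hv
      · have := W₁.end_mem
        exact this.1.2 (Or.inl ⟨Or.inr ⟨this.1.1, Or.inl hv⟩, this.2⟩)
      · have hwp : ∃ p ∈ a₄, Walk (S ∪ {w}) w p := by
          rcases hw with hw | ⟨-, hw | ⟨a, ha, e⟩⟩
          · obtain ⟨p, hp, W₂⟩ := cluster_walk hw
            exact ⟨p, hp, W₂.symm.mono Set.subset_union_left⟩
          · exact ⟨w, hw, .refl (Or.inr rfl)⟩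
          · obtain ⟨p, hp, W₂⟩ := cluster_walk ha
            exact ⟨p, hp, .head (Or.inr rfl) e.symm (W₂.symm.mono Set.subset_union_left)⟩
        obtain ⟨p', hp', W₂⟩ := hwp
        have hwD : w ∈ D := explored_subset hw
        have hSD : S ⊆ D := cluster_subset _ _ _ _
        obtain ⟨z, hz, hz'⟩ := cross (((Y \ explored D a₄ S) ∩ {v | ω v = c}) ∪ (S ∪ {w}))
          (by
            rintro z (hz | hz | rfl)
            · exact hY hz.1.1
            · exact hSD hz
            · exact hwD) _ (fun z hz => hz.1.1) s hs p' hp' u hu v hv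
          ((f.mono (Set.union_subset_union_right _ Set.subset_union_right)).trans
            (W₂.mono Set.subset_union_right)) W₁
        rcases hz with hz | hz | rfl
        · exact hz'.1.2 (Or.inr hz)
        · exact hz'.2 hz
        · exact hz'.1.2 (Or.inl ⟨hw, hz'.2⟩)

/-- The sites next to `box k t`. -/
def nearBox (k t : ℤ) : Set Site := {v | ∃ q ∈ box k t, Adj q v}

/-- The half box `[0, 2 * N] × [-N, N]` with `box k t` removed. -/
def slit (N k t : ℤ) : Set Site := rect 0 (2 * N) (-N) N \ box k t

theorem slit_finite (N k t : ℤ) : (slit N k t).Finite := (rect_finite _ _ _ _).subset Set.sdiff_subset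

/-- A walk of the slit half box that ends next to the removed box can be continued through it. -/
theorem Walk.through_box {k t : ℤ} {A : Set Site} {s v : Site} (w : Walk A s v)
    (hv : v ∈ nearBox k t) : Walk (A ∪ box k t) s (0, t) := by
  obtain ⟨q, hq, e⟩ := hv
  exact ((w.mono Set.subset_union_left).snoc e.symm (Or.inr hq)).trans
    ((box_walk hq).symm.mono Set.subset_union_right)

theorem union_box_subset {N k t : ℤ} (h₁ : -N < t - 16 * k) (h₂ : t + 16 * k < N)
    {A : Set Site} (hA : A ⊆ slit N k t) : A ∪ box k t ⊆ rect 0 (2 * N) (-N) N := by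
  rintro z (hz | hz)
  · exact (hA hz).1
  · simp only [box, rect, Set.mem_ofPred_eq] at hz ⊢; omega

theorem slit_upper_hex {N k t : ℤ} (hk : 1 ≤ k) (h₁ : -N < t - 16 * k) (h₂ : t + 16 * k < N)
    (O : Set Site) :
    (∃ s ∈ {v : Site | v.1 = 0 ∧ t + k < v.2 ∧ v.2 ≤ t + 4 * k}, ∃ u ∈ {v : Site | v.1 = 2 * N},
      Walk (slit N k t ∩ O) s u) ∨
    ∃ s ∈ {v : Site | v.2 = N ∨ v.1 = 0 ∧ t + 4 * k ≤ v.2},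
      ∃ u ∈ {v : Site | v.2 = -N} ∪ {v | v ∈ nearBox k t ∨ v.1 = 0 ∧ v.2 < t},
      Walk (slit N k t ∩ Oᶜ) s u := by
  set O' : Set Site := slit N k t ∩ O ∪ {v | v.1 = -1 ∧ t + k < v.2 ∧ v.2 ≤ t + 4 * k} with hO'
  have hmem : ∀ z, z ∈ slit N k t ↔ (0 ≤ z.1 ∧ z.1 ≤ 2 * N ∧ -N ≤ z.2 ∧ z.2 ≤ N) ∧
      ¬ (0 ≤ z.1 ∧ z.1 ≤ k ∧ t - k ≤ z.2 ∧ z.2 ≤ t + k) := fun z => Iff.rfl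
  rcases hex_rect (x₀ := -1) (x₁ := 2 * N) (y₀ := -N) (y₁ := N) (by omega) (by omega) O' with
    ⟨s, u, w, hs, hu⟩ | ⟨s, u, w, hs, hu⟩
  · left
    obtain ⟨a, b, W, ha, e, W'⟩ := w.last_exit (P := {v | v.1 < 0})
      (by simp only [Set.mem_ofPred_eq]; omega) (by simp only [Set.mem_ofPred_eq]; omega)
    have hsub : (rect (-1) (2 * N) (-N) N ∩ O') \ {v | v.1 < 0} ⊆ slit N k t ∩ O := by
      rintro z ⟨⟨-, hz | hz⟩, hz'⟩
      · exact hz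
      · simp only [Set.mem_ofPred_eq] at hz hz'; omega
    have W' := W'.mono hsub
    refine ⟨b, ?_, u, hu, W'⟩
    have hb := (hmem _).1 W'.start_mem.1
    rw [adj_iff] at e
    simp only [Set.mem_ofPred_eq] at ha ⊢
    rcases W.end_mem.2 with h | h
    · have := (hmem _).1 h.1; omega
    · simp only [Set.mem_ofPred_eq] at h; omega
  · right
    obtain ⟨a, b, W, ha, e, W'⟩ := w.last_exit (P := {v | v.1 = -1 ∧ t + 4 * k < v.2 ∨ v.2 = N})
      (by simp only [Set.mem_ofPred_eq]; omega) (by simp only [Set.mem_ofPred_eq]; omega)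
    set P : Set Site := {v | v.1 = -1 ∧ t + 4 * k < v.2 ∨ v.2 = N} with hP
    have hstart : ∃ c, (c.2 = N ∨ c.1 = 0 ∧ t + 4 * k ≤ c.2) ∧ c ∈ slit N k t ∧ c ∈ O'ᶜ ∧
        Walk ((rect (-1) (2 * N) (-N) N ∩ O'ᶜ) \ P ∪ {c}) c u := by
      have ha' := W.end_mem.1
      have hb := W'.start_mem
      have hb₁ := hb.1.1
      have hb₂ := hb.1.2
      have hb₃ := hb.2
      have e' := e
      rw [adj_iff] at e'
      simp only [rect, hP, Set.mem_ofPred_eq] at ha ha' hb₁ hb₃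
      by_cases h0 : 0 ≤ a.1
      · exact ⟨a, by omega, (hmem _).2 (by omega), W.end_mem.2, .head (Or.inr rfl) e
          (W'.mono Set.subset_union_left)⟩
      · have hb0 : b.1 = 0 := by
          by_contra hne
          exact hb₂ (Or.inr ⟨by omega, by omega, by omega⟩)
        exact ⟨b, by omega, (hmem _).2 (by omega), hb₂, W'.mono Set.subset_union_left⟩
    obtain ⟨c, hc, hcD, hcO, V⟩ := hstart
    have hc' := (hmem _).1 hcD
    obtain ⟨a', b', V₁, e', hb', V₂⟩ := V.exit (P := slit N k t \ {v | v.2 = -N})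
      ⟨hcD, by simp only [Set.mem_ofPred_eq]; omega⟩ (fun h => h.2 hu)
    have hsub : ∀ z ∈ (rect (-1) (2 * N) (-N) N ∩ O'ᶜ) \ P ∪ {c},
        z ∈ slit N k t → z ∈ slit N k t ∩ Oᶜ := by
      rintro z (hz | rfl) hzD
      · exact ⟨hzD, fun h => hz.1.2 (Or.inl ⟨hzD, h⟩)⟩
      · exact ⟨hzD, fun h => hcO (Or.inl ⟨hzD, h⟩)⟩
    have V₁' : Walk (slit N k t ∩ Oᶜ) c a' := V₁.mono fun z hz => hsub z hz.1 hz.2.1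
    refine ⟨c, hc, ?_⟩
    have hbm := V₂.start_mem
    by_cases hbD : b' ∈ slit N k t
    · exact ⟨b', Or.inl (by_contra fun h => hb' ⟨hbD, h⟩), V₁'.snoc e' (hsub _ hbm hbD)⟩
    refine ⟨a', Or.inr ?_, V₁'⟩
    by_cases hbb : b' ∈ box k t
    · exact Or.inl ⟨b', hbb, e'.symm⟩
    rcases hbm with hbm | rfl
    · right
      have i₁ := hbm.1.1
      have i₂ := hbm.1.2
      have i₃ := hbm.2
      have ha := (hmem _).1 V₁'.end_mem.1
      have i₄ : ¬ (b'.1 = -1 ∧ t + k < b'.2 ∧ b'.2 ≤ t + 4 * k) := fun h => i₂ (Or.inr h)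
      rw [hmem] at hbD
      rw [adj_iff] at e'
      simp only [box, rect, hP, Set.mem_ofPred_eq] at i₁ i₃ hbb ⊢
      omega
    · exact absurd hcD hbD

theorem slit_upper_cross {N k t : ℤ} (h₁ : -N < t - 16 * k) (h₂ : t + 16 * k < N)
    {A B : Set Site} (hA : A ⊆ slit N k t) (hB : B ⊆ slit N k t) {s p u v : Site}
    (hs : s.1 = 0 ∧ t + k < s.2 ∧ s.2 ≤ t + 4 * k) (hp : p.2 = -N)
    (hu : u.2 = N ∨ u.1 = 0 ∧ t + 4 * k ≤ u.2) (hv : v ∈ nearBox k t ∨ v.1 = 0 ∧ v.2 < t)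
    (wA : Walk A s p) (wB : Walk B u v) : ∃ z, z ∈ A ∧ z ∈ B := by
  obtain ⟨s₁, s₂⟩ := s
  obtain ⟨rfl, hs⟩ := hs
  have hbox : ∃ y ≤ t, Walk (B ∪ box k t) u (0, y) := by
    rcases hv with hv | ⟨hv, hv'⟩
    · exact ⟨t, le_rfl, wB.through_box hv⟩
    · exact ⟨v.2, hv'.le, by rw [← hv]; exact wB.mono Set.subset_union_left⟩
  obtain ⟨y, hy, w⟩ := hbox
  have hmeet : ∃ z, z ∈ B ∪ box k t ∧ z ∈ A := by
    rcases hu with hu | ⟨hu, hu'⟩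
    · exact left_top_separate (union_box_subset h₁ h₂ hB) (hA.trans Set.sdiff_subset) w hu wA
        (by omega) (Or.inr hp)
    · rcases eq_or_lt_of_le (show s₂ ≤ u.2 by dsimp only at hs; omega) with h | h
      · exact ⟨u, w.start_mem, by rw [show u = (0, s₂) from Prod.ext hu h.symm]; exact wA.start_mem⟩
      · rw [show u = (0, u.2) from Prod.ext hu rfl] at w
        exact left_separate (union_box_subset h₁ h₂ hB) (hA.trans Set.sdiff_subset) w wA
          (by omega) h (Or.inr (Or.inl hp))
  obtain ⟨z, hz | hz, hz'⟩ := hmeet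
  · exact ⟨z, hz', hz⟩
  · exact absurd hz (hA hz').2

theorem slit_lower_hex {N k t : ℤ} (hk : 1 ≤ k) (h₁ : -N < t - 16 * k) (h₂ : t + 16 * k < N)
    (O : Set Site) :
    (∃ s ∈ {v : Site | v.1 = 0 ∧ t - 16 * k ≤ v.2 ∧ v.2 < t - 4 * k},
      ∃ u ∈ {v : Site | v.2 = -N}, Walk (slit N k t ∩ O) s u) ∨
    ∃ s ∈ {v : Site | v.1 = 0 ∧ v.2 ≤ t - 16 * k}, ∃ u ∈ {v : Site | v.1 = 2 * N} ∪
        {v | v ∈ nearBox k t ∨ v.2 = N ∨ v.1 = 0 ∧ t - 4 * k - 1 ≤ v.2},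
      Walk (slit N k t ∩ Oᶜ) s u := by
  set O' : Set Site := slit N k t ∩ O ∪ {v | v.1 = -2 ∧ t - 16 * k < v.2 ∨
    v.1 = -1 ∧ t - 16 * k < v.2 ∧ v.2 < t - 4 * k} with hO'
  have hmem : ∀ z, z ∈ slit N k t ↔ (0 ≤ z.1 ∧ z.1 ≤ 2 * N ∧ -N ≤ z.2 ∧ z.2 ≤ N) ∧
      ¬ (0 ≤ z.1 ∧ z.1 ≤ k ∧ t - k ≤ z.2 ∧ z.2 ≤ t + k) := fun z => Iff.rfl
  rcases hex_rect (x₀ := -2) (x₁ := 2 * N) (y₀ := -N) (y₁ := N + 1) (by omega) (by omega) O'ᶜ with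
    ⟨s, u, w, hs, hu⟩ | ⟨s, u, w, hs, hu⟩
  · right
    have hsO := w.start_mem.2
    have hs' : s.2 ≤ t - 16 * k := by
      by_contra h
      exact hsO (Or.inr (Or.inl ⟨hs, by omega⟩))
    set P : Set Site := {v | v.1 < 0 ∧ v.2 ≤ t - 16 * k} with hP
    obtain ⟨a, c, W, ha, e, V⟩ := w.last_exit (P := P)
      (by simp only [hP, Set.mem_ofPred_eq]; omega) (by simp only [hP, Set.mem_ofPred_eq]; omega)
    have hout : ∀ z ∈ (rect (-2) (2 * N) (-N) (N + 1) ∩ O'ᶜ) \ P, z.1 < 0 →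
        z.1 = -1 ∧ t - 4 * k ≤ z.2 := by
      intro z hz hz0
      have i₁ := hz.1.1
      have i₂ := hz.2
      have i₃ : ¬ (z.1 = -2 ∧ t - 16 * k < z.2 ∨
        z.1 = -1 ∧ t - 16 * k < z.2 ∧ z.2 < t - 4 * k) := fun h => hz.1.2 (Or.inr h)
      simp only [rect, hP, Set.mem_ofPred_eq] at i₁ i₂
      omega
    have hsub : ∀ z ∈ (rect (-2) (2 * N) (-N) (N + 1) ∩ O'ᶜ) \ P,
        z ∈ slit N k t → z ∈ slit N k t ∩ Oᶜ :=
      fun z hz hzD => ⟨hzD, fun h => hz.1.2 (Or.inl ⟨hzD, h⟩)⟩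
    have hc₀ := V.start_mem.1.1
    have hc₁ := hout c V.start_mem
    rw [adj_iff] at e
    simp only [rect, hP, Set.mem_ofPred_eq] at ha hc₀
    have hc : c.1 = 0 ∧ c.2 ≤ t - 16 * k := by omega
    have hcD : c ∈ slit N k t := (hmem _).2 (by omega)
    obtain ⟨a', b', V₁, e', hb', V₂⟩ := V.exit (P := slit N k t \ {v | v.1 = 2 * N})
      ⟨hcD, by simp only [Set.mem_ofPred_eq]; omega⟩ (fun h => h.2 hu)
    have V₁' : Walk (slit N k t ∩ Oᶜ) c a' := V₁.mono fun z hz => hsub z hz.1 hz.2.1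
    refine ⟨c, hc, ?_⟩
    have hbm := V₂.start_mem
    by_cases hbD : b' ∈ slit N k t
    · exact ⟨b', Or.inl (by_contra fun h => hb' ⟨hbD, h⟩), V₁'.snoc e' (hsub _ hbm hbD)⟩
    refine ⟨a', Or.inr ?_, V₁'⟩
    by_cases hbb : b' ∈ box k t
    · exact Or.inl ⟨b', hbb, e'.symm⟩
    right
    have i₁ := hbm.1.1
    have i₂ := hout _ hbm
    have ha := (hmem _).1 V₁'.end_mem.1
    rw [hmem] at hbD
    rw [adj_iff] at e'
    simp only [box, rect, Set.mem_ofPred_eq] at i₁ hbb ⊢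
    omega
  · left
    rw [compl_compl] at w
    have hmem' : ∀ z ∈ O', 0 ≤ z.1 ∧ z ∈ slit N k t ∩ O ∨ (z.1 = -2 ∧ t - 16 * k < z.2 ∨
        z.1 = -1 ∧ t - 16 * k < z.2 ∧ z.2 < t - 4 * k) := by
      rintro z (hz | hz)
      · exact Or.inl ⟨((hmem _).1 hz.1).1.1, hz⟩
      · exact Or.inr hz
    have hs0 : s.1 < 0 := by
      rcases hmem' _ w.start_mem.2 with h | h
      · have := (hmem _).1 h.2.1; omega
      · omega
    have hu0 : 0 ≤ u.1 := by
      rcases hmem' _ w.end_mem.2 with h | h <;> omega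
    obtain ⟨a, b, W, ha, e, W'⟩ := w.last_exit (P := {v | v.1 < 0}) hs0
      (by simp only [Set.mem_ofPred_eq]; omega)
    have W'' := W'.mono (B := slit N k t ∩ O) fun z hz => by
      have h0 := hz.2
      simp only [Set.mem_ofPred_eq] at h0
      rcases hmem' _ hz.1.2 with h | h
      · exact h.2
      · omega
    have hb := (hmem _).1 W''.start_mem.1
    have ha' := hmem' _ W.end_mem.2
    rw [adj_iff] at e
    simp only [Set.mem_ofPred_eq] at ha
    exact ⟨b, by simp only [Set.mem_ofPred_eq]; omega, u, hu, W''⟩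

theorem slit_lower_cross {N k t : ℤ} (h₁ : -N < t - 16 * k) (h₂ : t + 16 * k < N)
    {A B : Set Site} (hA : A ⊆ slit N k t) (hB : B ⊆ slit N k t) {s p u v : Site}
    (hs : s.1 = 0 ∧ t - 16 * k ≤ s.2 ∧ s.2 < t - 4 * k) (hp : p.1 = 2 * N)
    (hu : u.1 = 0 ∧ u.2 ≤ t - 16 * k)
    (hv : v ∈ nearBox k t ∨ v.2 = N ∨ v.1 = 0 ∧ t - 4 * k - 1 ≤ v.2)
    (wA : Walk A s p) (wB : Walk B u v) : ∃ z, z ∈ A ∧ z ∈ B := by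
  obtain ⟨s₁, s₂⟩ := s
  obtain ⟨u₁, u₂⟩ := u
  obtain ⟨rfl, hs⟩ := hs
  obtain ⟨rfl, hu⟩ := hu
  dsimp only at hs hu
  have hAr := hA.trans (Set.sdiff_subset (s := rect 0 (2 * N) (-N) N))
  have hBr := union_box_subset h₁ h₂ hB
  have hmeet : ∃ z, z ∈ B ∪ box k t ∧ z ∈ A := by
    rcases eq_or_lt_of_le (show u₂ ≤ s₂ by omega) with h | h
    · exact ⟨_, Or.inl wB.start_mem, by rw [h]; exact wA.start_mem⟩
    rcases hv with hv | hv | ⟨hv, hv'⟩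
    · exact left_separate hBr hAr (wB.through_box hv).symm wA h (by omega) (Or.inl hp)
    · exact left_top_separate hBr hAr (wB.symm.mono Set.subset_union_left) hv wA h (Or.inl hp)
    · have wB' := wB.symm.mono (B := B ∪ box k t) Set.subset_union_left
      rw [show v = (0, v.2) from Prod.ext hv rfl] at wB'
      rcases eq_or_lt_of_le (show s₂ ≤ v.2 by omega) with h' | h'
      · exact ⟨_, wB'.start_mem, by rw [← h']; exact wA.start_mem⟩
      · exact left_separate hBr hAr wB' wA h h' (Or.inl hp)
  obtain ⟨z, hz | hz, hz'⟩ := hmeet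
  · exact ⟨z, hz', hz⟩
  · exact absurd hz (hA hz').2

/-- Two arms, closed and open, from the box of radius `k` around `(0, t)` to the bottom and to the
right side of `[0, 2 * N] × [-N, N]`. -/
def boxArm (N k t : ℤ) : Set Config :=
  Link false (slit N k t) {v | v.2 = -N} (nearBox k t) ∩
    Link true (slit N k t) {v | v.1 = 2 * N} (nearBox k t)

theorem boxArm_depOn (N k t : ℤ) : DepOn (slit N k t) (boxArm N k t) :=
  (Link.depOn _ _ _ _).inter (Link.depOn _ _ _ _)

theorem circuit_subset_slit {N k t j : ℤ} (hk : k ≤ j) (h₁ : -N < t - 4 * j)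
    (h₂ : t + 4 * j < N) : box (4 * j) t \ box j t ⊆ slit N k t := by
  intro z hz
  simp only [slit, box, rect, Set.mem_ofPred_eq, Set.mem_sdiff] at hz ⊢
  omega

theorem pr_boxArm_step {N k t : ℤ} (hk : 1 ≤ k) (h₁ : -N < t - 16 * k) (h₂ : t + 16 * k < N) :
    pr (circuit true k t) * pr (boxArm N k t) ≤
      pr (Link false (slit N k t) {v | v.2 = -N} (nearBox k t) ∩
        Link true (slit N k t) {v | v.1 = 0 ∧ t + k < v.2 ∧ v.2 ≤ t + 4 * k} {v | v.1 = 2 * N}) := by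
  have hY := circuit_subset_slit (N := N) (t := t) (le_refl k) (by omega) (by omega)
  refine le_trans (mul_le_mul_of_nonneg_left (pr_mono ?_) (pr_nonneg _))
    (pr_mul_le_of_explore (slit_finite N k t) true hY (E := circuit true k t) ?_
      (slit_upper_hex hk h₁ h₂) fun A hA B hB s hs p hp u hu v hv wA wB =>
        slit_upper_cross h₁ h₂ hA hB hs hp hu hv wA wB)
  · rintro ω ⟨⟨p, hp, q, hq, w⟩, ⟨r, hr, q', hq', w'⟩⟩
    refine ⟨⟨q, ⟨p, hp, w⟩, hq⟩, Set.disjoint_left.2 ?_⟩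
    rintro x ⟨p', hp', W⟩ hx
    have W' := (w'.through_box hq').symm
    have hsub : slit N k t ∩ {v | ω v = true} ∪ box k t ⊆ rect 0 (2 * N) (-N) N :=
      union_box_subset h₁ h₂ Set.inter_subset_left
    have hsub' : slit N k t ∩ {v | ω v = false} ⊆ rect 0 (2 * N) (-N) N :=
      Set.inter_subset_left.trans Set.sdiff_subset
    have hmeet : ∃ z, z ∈ slit N k t ∩ {v | ω v = true} ∪ box k t ∧
        z ∈ slit N k t ∩ {v | ω v = false} := by
      rcases hx with hx | ⟨hx, hx'⟩
      · exact rect_cross hsub hsub' W' W.symm rfl hr hx hp'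
      · have W := W.symm
        rw [show x = (0, x.2) from Prod.ext hx rfl] at W
        exact left_cross_bot hsub hsub' W' hr W hp' (by omega)
    obtain ⟨z, hz | hz, hz'⟩ := hmeet
    · have e1 := hz.2
      have e2 := hz'.2
      simp only [Set.mem_ofPred_eq] at e1 e2
      rw [e1] at e2; cases e2
    · exact hz'.1.2 hz
  · rintro ω ⟨a, ha, a', ha', W⟩ B hB p hp q ⟨q', hq', e⟩ w
    obtain ⟨X, hX, V, hV⟩ := W.exists_support
    obtain ⟨z, hz, hz'⟩ := circuit_meets (k := k) (t := t) (x₁ := 2 * N) (y₀ := -N) (y₁ := N)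
      (fun z hz => hY (hX hz).1) (hB.trans Set.sdiff_subset)
      (Set.subset_union_right.trans (union_box_subset h₁ h₂ hB)) V ha ha' hq' (Or.inr e)
      w.symm (Or.inr (Or.inl hp))
    have hab := W.start_mem.1
    simp only [box, rect, Set.mem_ofPred_eq, Set.mem_sdiff] at hab ha
    exact ⟨a, by simp only [Set.mem_ofPred_eq]; omega, z, hz', (hV z hz).1⟩

theorem pr_boxArm_step_two {N k t : ℤ} (hk : 1 ≤ k) (h₁ : -N < t - 16 * k) (h₂ : t + 16 * k < N) :
    pr (circuit false (4 * k) t) * pr (Link false (slit N k t) {v | v.2 = -N} (nearBox k t) ∩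
        Link true (slit N k t) {v | v.1 = 0 ∧ t + k < v.2 ∧ v.2 ≤ t + 4 * k} {v | v.1 = 2 * N}) ≤
      pr (Link true (slit N k t) {v | v.1 = 2 * N} {v | v.1 = 0 ∧ t + k < v.2 ∧ v.2 ≤ t + 4 * k} ∩
        Link false (slit N k t) {v | v.1 = 0 ∧ t - 16 * k ≤ v.2 ∧ v.2 < t - 4 * k}
          {v | v.2 = -N}) := by
  have hY := circuit_subset_slit (N := N) (t := t) (j := 4 * k) (k := k) (by omega) (by omega)
    (by omega)
  refine le_trans (mul_le_mul_of_nonneg_left (pr_mono ?_) (pr_nonneg _))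
    (pr_mul_le_of_explore (slit_finite N k t) false hY (E := circuit false (4 * k) t) ?_
      (slit_lower_hex hk h₁ h₂) fun A hA B hB s hs p hp u hu v hv wA wB =>
        slit_lower_cross h₁ h₂ hA hB hs hp hu hv wA wB)
  · rintro ω ⟨⟨p, hp, q, hq, w⟩, ⟨x, hx, r, hr, w'⟩⟩
    refine ⟨⟨x, ⟨r, hr, w'.symm⟩, hx⟩, Set.disjoint_left.2 ?_⟩
    rintro y ⟨r', hr', W⟩ ⟨hy, hy'⟩
    have W := W.symm
    rw [show y = (0, y.2) from Prod.ext hy rfl] at W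
    obtain ⟨z, hz', hz | hz⟩ := left_cross_bot (Set.inter_subset_left.trans Set.sdiff_subset)
      (union_box_subset h₁ h₂ Set.inter_subset_left) W hr' (w.through_box hq).symm hp (by omega)
    · have e1 := hz.2
      have e2 := hz'.2
      simp only [Set.mem_ofPred_eq] at e1 e2
      rw [e1] at e2; cases e2
    · exact hz'.1.2 hz
  · rintro ω ⟨a, ha, a', ha', W⟩ B hB p hp q hq w
    obtain ⟨X, hX, V, hV⟩ := W.exists_support
    obtain ⟨z, hz, hz'⟩ := circuit_meets (k := 4 * k) (t := t) (x₁ := 2 * N) (y₀ := -N) (y₁ := N)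
      (fun z hz => ⟨(hY (hX hz).1).1, (hX hz).1.2⟩) (hB.trans Set.sdiff_subset)
      (fun z hz => by
        simp only [box, rect, Set.mem_ofPred_eq] at hz ⊢; omega) V ha ha' (q := q) (by
        simp only [box, rect, Set.mem_ofPred_eq] at hq ⊢; omega) (Or.inl rfl)
      w.symm (Or.inl hp)
    have hab := W.end_mem.1
    simp only [box, rect, Set.mem_ofPred_eq, Set.mem_sdiff] at hab ha'
    exact ⟨a', by simp only [Set.mem_ofPred_eq]; omega, z, hz', (hV z hz).2.symm⟩

theorem exists_twoArm {N k t r : ℤ} (hk : 1 ≤ k) (hr : 1 ≤ r) (h₁ : -N ≤ t - 16 * k - 5 * r)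
    (h₂ : t + 16 * k < N) (h₃ : 5 * r ≤ 2 * N) :
    Link true (slit N k t) {v | v.1 = 2 * N} {v | v.1 = 0 ∧ t + k < v.2 ∧ v.2 ≤ t + 4 * k} ∩
        Link false (slit N k t) {v | v.1 = 0 ∧ t - 16 * k ≤ v.2 ∧ v.2 < t - 4 * k}
          {v | v.2 = -N} ⊆ ⋃ z ∈ Finset.Icc (t - 16 * k) (t + 4 * k), twoArm r z := by
  rintro ω ⟨⟨p, hp, x, hx, w⟩, ⟨y, hy, u, hu, w'⟩⟩
  obtain ⟨x₁, x₂⟩ := x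
  obtain ⟨y₁, y₂⟩ := y
  obtain ⟨rfl, hx⟩ := hx
  obtain ⟨rfl, hy⟩ := hy
  set P : ℤ → Prop := fun z => ∃ r : Site, r.1 = 2 * N ∧
    Walk (rect 0 (2 * N) (-N) N ∩ {v | ω v = true}) (0, z) r with hP
  have hsub : ∀ {b}, slit N k t ∩ {v | ω v = b} ⊆ rect 0 (2 * N) (-N) N ∩ {v | ω v = b} :=
    @fun _ _ hz => ⟨hz.1.1, hz.2⟩
  have hPx : P x₂ := ⟨p, hp, w.symm.mono hsub⟩
  obtain ⟨m, ⟨q, hq, wm⟩, hmin⟩ := Int.exists_least_of_bdd (P := P)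
    ⟨-N, fun z ⟨r, _, k⟩ => by
      have := k.start_mem.1; simp only [rect, Set.mem_ofPred_eq] at this; omega⟩ ⟨_, hPx⟩
  have hm := hmin _ hPx
  have hym : y₂ < m := by
    by_contra hlt
    obtain ⟨v, e1, e2⟩ := left_cross_bot Set.inter_subset_left Set.inter_subset_left wm hq
      (w'.mono hsub) hu (by omega)
    have e1 : ω v = true := e1.2
    have e2 : ω v = false := e2.2
    simp_all
  dsimp only at hx hy
  obtain ⟨v, hv, wv⟩ := closed_below (by omega) wm hq (by omega) fun z r k hr => hmin z ⟨r, hr, k⟩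
  obtain ⟨a, ha, α⟩ := wm.exit_box (K := 5 * r) (t := m) (fun z hz => hz.1.1)
    (by simp only [box, rect, Set.mem_ofPred_eq]; omega)
    (by simp only [outer, box, rect, Set.mem_sdiff, Set.mem_ofPred_eq]; omega)
  obtain ⟨b, hb, β⟩ := wv.exit_box (K := 5 * r) (t := m) (fun z hz => hz.1.1)
    (by simp only [box, rect, Set.mem_ofPred_eq]; omega)
    (by simp only [outer, box, rect, Set.mem_sdiff, Set.mem_ofPred_eq]; omega)
  refine Set.mem_iUnion₂.2 ⟨m, Finset.mem_Icc.2 (by omega), ⟨_, rfl, a, ha, ?_⟩, _, rfl, b, hb, ?_⟩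
  · exact α.mono fun z hz => ⟨hz.2, hz.1.2⟩
  · exact β.mono fun z hz => ⟨hz.2, hz.1.2⟩

theorem pr_boxArm_le : ∃ C : ℝ, 0 < C ∧ ∀ (n k : ℕ) (t : ℤ), 1 ≤ k → 64 * k ≤ n →
    -(n : ℤ) ≤ 2 * t → 2 * t ≤ n → pr (boxArm n k t) ≤ C * k / n := by
  obtain ⟨c, hc, -, hcirc⟩ := pr_circuit_ge
  obtain ⟨C, hC, htwo⟩ := pr_twoArm_le
  refine ⟨21 * 48 * C / (c * c), by positivity, fun n k t hk hkn ht ht' => ?_⟩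
  have hn0 : (0 : ℝ) < n := by exact_mod_cast (by omega : 0 < n)
  have hk1 : (1 : ℤ) ≤ k := by omega
  have s₁ := pr_boxArm_step (N := n) (t := t) hk1 (by omega) (by omega)
  have s₂ := pr_boxArm_step_two (N := n) (t := t) hk1 (by omega) (by omega)
  have s₃ := pr_le_sum _ (exists_twoArm (N := n) (t := t) (r := (n / 24 : ℕ)) hk1 (by omega)
    (by omega) (by omega) (by omega))
  have s₄ : pr (twoArm (n / 24 : ℕ) t) ≤ C * 48 / n := by
    refine (htwo _ _ (by omega)).trans ?_
    have h0 : (0 : ℝ) < (n / 24 : ℕ) := by exact_mod_cast (by omega : 0 < n / 24)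
    have h1 : (n : ℝ) ≤ 48 * (n / 24 : ℕ) := by exact_mod_cast (by omega : n ≤ 48 * (n / 24))
    rw [div_le_div_iff₀ h0 hn0]
    nlinarith
  have s₅ : ∑ z ∈ Finset.Icc (t - 16 * k) (t + 4 * k), pr (twoArm (n / 24 : ℕ) z) ≤
      21 * k * (C * 48 / n) := by
    refine (Finset.sum_le_card_nsmul _ _ _ fun z _ => (pr_twoArm_eq _ z t).trans s₄).trans ?_
    rw [nsmul_eq_mul, Int.card_Icc]
    refine mul_le_mul_of_nonneg_right ?_ (by positivity)
    exact_mod_cast (by omega : (t + 4 * k + 1 - (t - 16 * k)).toNat ≤ 21 * k)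
  have c₁ := hcirc true k t hk1
  have c₂ := hcirc false (4 * k) t (by omega)
  have key : c * c * pr (boxArm n k t) ≤ 21 * k * (C * 48 / n) := by
    refine le_trans ?_ ((s₂.trans s₃).trans s₅)
    rw [mul_assoc]
    refine mul_le_mul c₂ (le_trans (mul_le_mul_of_nonneg_right c₁ (pr_nonneg _)) s₁)
      (mul_nonneg hc.le (pr_nonneg _)) (pr_nonneg _)
  rw [← le_div_iff₀' (by positivity)] at key
  refine key.trans (le_of_eq ?_)
  field_simp

/-- No site of the lowest crossing can reach the top without hitting a given open crossing. -/
theorem IsLowestCrossing.not_walk {x₀ x₁ y₀ y₁ : ℤ} {ω : Config} {p : List Site}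
    (h : IsLowestCrossing x₀ x₁ y₀ y₁ ω p) {A : Set Site}
    (hA : A ⊆ rect x₀ x₁ y₀ y₁ ∩ {v | ω v = true}) {s e : Site} (w : Walk A s e)
    (hs : s.1 = x₀) (he : e.1 = x₁) {v u : Site} (hv : v ∈ p) (hu : u.2 = y₁) :
    ¬ Walk (rect x₀ x₁ y₀ y₁ \ A) v u := by
  intro W
  obtain ⟨q, hq, hq₁, hq₂⟩ := w.exists_path
  obtain ⟨-, hv' | hv'⟩ := h.2 q ⟨⟨hq.1, fun v hv => (hA (hq.2 v hv)).1⟩,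
    fun v hv => (hA (hq.2 v hv)).2, ⟨s, ⟨(hA w.start_mem).1, hs⟩, hq₁⟩,
    ⟨e, ⟨(hA w.end_mem).1, he⟩, hq₂⟩⟩ v hv
  · exact W.start_mem.2 (hq.2 v hv')
  · obtain ⟨r, hr, hr₁, hr₂⟩ := W.exists_path
    exact hv' ⟨r, ⟨hr.1, fun v hv => ⟨(hr.2 v hv).1, fun h => (hr.2 v hv).2 (hq.2 v h)⟩⟩, hr₁,
      u, ⟨W.end_mem.1, hu⟩, hr₂⟩

/-- If the lowest crossing starts from `(0, t)` and `(0, z)` is its last site on the left side,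
then `(0, z)` is joined to the right side away from the left side, a neighbour of `(0, z)` is
joined to the bottom by a closed walk, and, unless `z = t`, `(0, t)` is joined to `(0, z - 1)`. -/
theorem exists_last_left {x₁ y₀ y₁ t : ℤ} (hx : 0 < x₁) (hy : y₀ < t) {ω : Config}
    (h : ω ∈ startsAt x₁ y₀ y₁ t) :
    ∃ z e u b, t ≤ z ∧ z ≤ y₁ ∧ e.1 = x₁ ∧ u.2 = y₀ ∧ (b = (0, z - 1) ∨ b = (1, z - 1)) ∧
      Walk ((rect 0 x₁ y₀ y₁ ∩ {v | ω v = true}) \ {v | v.1 = 0 ∧ v.2 ≠ z}) (0, z) e ∧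
      Walk (rect 0 x₁ y₀ y₁ ∩ {v | ω v = false}) b u ∧
      (t < z → b = (1, z - 1) ∧
        Walk ((rect 0 x₁ y₀ y₁ ∩ {v | ω v = true}) \ {(0, z)}) (0, t) (0, z - 1)) := by
  obtain ⟨p, hp, hpt⟩ := h
  obtain ⟨⟨⟨-, -, hchain⟩, hpR⟩, hpo, -, e, ⟨-, he⟩, hpe⟩ := hp.1
  have w : Walk {v | v ∈ p} (0, t) e := Walk.of_list hchain (fun v hv => hv) hpt hpe
  obtain ⟨⟨a₁, z⟩, b, W, ha, hab, W'⟩ := w.last_exit (P := {v | v.1 = 0}) rfl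
    (by simp only [Set.mem_ofPred_eq]; omega)
  obtain rfl : a₁ = 0 := ha
  set Q : Set Site := {(0, z)} ∪ {v | v ∈ p} \ {v | v.1 = 0} with hQ
  have hzp : (0, z) ∈ p := W.end_mem
  have hpRo : ∀ v ∈ p, v ∈ rect 0 x₁ y₀ y₁ ∩ {v | ω v = true} := fun v hv => ⟨hpR v hv, hpo v hv⟩
  have hQp : ∀ v ∈ Q, v ∈ p := by
    rintro v (rfl | hv)
    · exact hzp
    · exact hv.1
  have hQz : ∀ v ∈ Q, v.1 = 0 → v.2 = z := by
    rintro v (rfl | hv) h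
    · rfl
    · exact absurd h hv.2
  have q : Walk Q (0, z) e := .head (Or.inl rfl) hab (W'.mono Set.subset_union_right)
  have hQR : Q ⊆ rect 0 x₁ y₀ y₁ ∩ {v | ω v = true} := fun v hv => hpRo v (hQp v hv)
  have hzR := hpR _ hzp
  have htp : (0, t) ∈ p := w.start_mem
  have htR := hpR _ htp
  simp only [rect, Set.mem_ofPred_eq] at hzR htR
  have hup : ∀ v, z < v → (0, v) ∉ p := by
    intro v hv hvp
    have hvR := hpR _ hvp
    simp only [rect, Set.mem_ofPred_eq] at hvR
    refine hp.not_walk hQR q rfl he hvp (u := (0, y₁)) rfl (Walk.vert 0 fun y h1 h2 => ⟨?_, ?_⟩)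
    · simp only [rect, Set.mem_ofPred_eq]; omega
    · intro h
      have := hQz _ h rfl
      dsimp only at this; omega
  have htz : t ≤ z := by
    by_contra hlt
    exact hup t (by omega) htp
  set O : Set Site := (rect 0 x₁ y₀ y₁ ∩ {v | ω v = true}) \ {v | v.1 = 0 ∧ z ≤ v.2} with hO
  have hTB : ∃ s u, Walk (rect 0 x₁ y₀ y₁ ∩ Oᶜ) s u ∧ s.2 = y₁ ∧ u.2 = y₀ := by
    rcases hex_rect (x₀ := 0) (x₁ := x₁) (y₀ := y₀) (y₁ := y₁) hx.le (by omega) O with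
      ⟨s, u, V, hs, hu⟩ | h
    · refine (hp.not_walk (A := O) Set.sdiff_subset (V.mono Set.inter_subset_right) hs hu hzp
        (u := (0, y₁)) rfl (Walk.vert 0 fun y h1 h2 => ⟨?_, ?_⟩)).elim
      · simp only [rect, Set.mem_ofPred_eq]; omega
      · exact fun h => h.2 ⟨rfl, by dsimp only; omega⟩
    · exact h
  obtain ⟨s, u, V, hs, hu⟩ := hTB
  obtain ⟨B, hB, V', hBV⟩ := V.exists_support
  obtain ⟨x, hx₁, hx₂⟩ := rect_cross (fun v hv => (hQR hv).1) (fun v hv => (hB hv).1) q V' rfl he hs hu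
  have hxz : x = (0, z) := by
    by_contra hne
    refine (hB hx₂).2 ⟨hQR hx₁, fun h => hne (Prod.ext h.1 (hQz _ hx₁ h.1))⟩
  subst hxz
  obtain ⟨⟨c₁, w'⟩, b', U, hc, hcb, U'⟩ := (hBV _ hx₂).2.last_exit (P := {v | v.1 = 0 ∧ z ≤ v.2})
    ⟨rfl, le_rfl⟩ (by simp only [Set.mem_ofPred_eq]; omega)
  obtain ⟨rfl, hzw⟩ : c₁ = 0 ∧ z ≤ w' := hc
  have U'' : Walk (rect 0 x₁ y₀ y₁ ∩ {v | ω v = false}) b' u := U'.mono fun v hv =>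
    ⟨hv.1.1, by
      have : ¬ ω v = true := fun h => hv.1.2 ⟨⟨hv.1.1, h⟩, hv.2⟩
      simpa using this⟩
  have hb' := U'.start_mem
  have hQc : ∀ v ∈ Q, ω v ≠ false := fun v hv h => by
    have h' := (hQR hv).2
    simp only [Set.mem_ofPred_eq] at h'
    rw [h'] at h; cases h
  have hblock : ∀ y, z ≤ y → Adj (0, y) b' → y = z := by
    intro y hy e
    by_contra hne
    obtain ⟨x, hx, rfl | hx'⟩ := left_cross_bot (x₀ := 0) (x₁ := x₁) (y₀ := y₀) (y₁ := max y₁ y)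
      (B := {(0, y)} ∪ rect 0 x₁ y₀ y₁ ∩ {v | ω v = false}) (fun v hv => by
        have := (hQR hv).1
        simp only [rect, Set.mem_ofPred_eq] at this ⊢; omega) (by
        rintro v (rfl | hv)
        · simp only [rect, Set.mem_ofPred_eq]; omega
        · have := hv.1
          simp only [rect, Set.mem_ofPred_eq] at this ⊢; omega) q he
      (.head (Or.inl rfl) e (U''.mono Set.subset_union_right)) hu hy
    · exact hne (hQz _ hx rfl)
    · exact hQc _ hx hx'.2
  obtain rfl : w' = z := hblock w' hzw hcb
  have hbb : b' = (0, w' - 1) ∨ b' = (1, w' - 1) := by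
    have h1 := hb'.1.1
    have h2 := hb'.2
    have h3 : ¬ Adj (0, w' + 1) b' := fun h => by
      have := hblock (w' + 1) (by omega) h
      omega
    rw [adj_iff] at hcb h3
    simp only [rect, Set.mem_ofPred_eq, Prod.ext_iff] at h1 h2 h3 hcb ⊢
    omega
  refine ⟨w', e, u, b', htz, hzR.2.2.2, he, hu, hbb, q.mono fun v hv => ⟨hQR hv, fun h =>
    h.2 (hQz v hv h.1)⟩, U'', fun hlt => ?_⟩
  obtain ⟨a', c, T, e', hc, -⟩ := W.exit (P := {(0, w')}ᶜ)
    (fun h => by simp only [Set.mem_singleton_iff, Prod.ext_iff] at h; omega) (fun h => h rfl)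
  obtain rfl : c = (0, w') := by simpa using hc
  obtain ⟨X, hX, T', hXT⟩ := T.exists_support
  have hmeet : (0, w' - 1) ∈ X := by
    rcases eq_or_lt_of_le (show t ≤ w' - 1 by omega) with h | h
    · rw [← h]; exact T'.start_mem
    have V₁ : Walk ({(0, w' - 1)} ∪ rect 0 x₁ y₀ y₁ ∩ {v | ω v = false}) (0, w' - 1) u := by
      have U₁ := U''.mono (B := {(0, w' - 1)} ∪ rect 0 x₁ y₀ y₁ ∩ {v | ω v = false})
        Set.subset_union_right
      rcases hbb with rfl | rfl
      · exact U₁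
      · exact .head (Or.inl rfl) (by rw [adj_iff]; dsimp only; omega) U₁
    have T₁ : Walk (X ∪ {(0, w')}) (0, t) (0, w') :=
      (T'.mono Set.subset_union_left).snoc e' (Or.inr rfl)
    have hXp : ∀ v ∈ X ∪ {(0, w')}, v ∈ p := by
      rintro v (hv | rfl)
      · exact (hX hv).1
      · exact hzp
    obtain ⟨x, hx, rfl | hx'⟩ := left_separate (x₀ := 0) (x₁ := x₁) (y₀ := y₀) (y₁ := y₁)
      (fun v hv => hpR v (hXp v hv)) (by
        rintro v (rfl | hv)
        · simp only [rect, Set.mem_ofPred_eq]; omega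
        · exact hv.1) T₁.symm V₁ h (by omega) (Or.inr (Or.inl hu))
    · rcases hx with hx | hx
      · exact hx
      · simp only [Set.mem_singleton_iff, Prod.ext_iff] at hx; omega
    · have h1 := hpo x (hXp x hx)
      have h2 := hx'.2
      simp only [Set.mem_ofPred_eq] at h2
      rw [h1] at h2; cases h2
  refine ⟨?_, (hXT _ hmeet).1.mono fun v hv => ⟨hpRo v hv.1, hv.2⟩⟩
  rcases hbb with rfl | h
  · have h1 := hpo _ (hX hmeet).1
    have h2 := U''.start_mem.2
    simp only [Set.mem_ofPred_eq] at h2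
    rw [h1] at h2; cases h2
  · exact h

theorem Link.to_nearBox {N K t : ℤ} {c : Bool} {ω : Config} {a e : Site} {J : Set Site}
    (w : Walk (rect 0 (2 * N) (-N) N ∩ {v | ω v = c}) a e) (ha : a ∈ box K t) (he : e ∉ box K t)
    (hJ : e ∈ J) : ω ∈ Link c (slit N K t) J (nearBox K t) := by
  obtain ⟨a', b', -, ha', e', W⟩ := w.last_exit ha he
  exact ⟨e, hJ, b', ⟨a', ha', e'⟩, W.symm.mono fun z hz => ⟨⟨hz.1.1, hz.2⟩, hz.1.2⟩⟩

theorem Link.to_far {r c : ℤ} {b : Bool} {A D : Set Site} {ω : Config} {s v : Site}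
    (w : Walk A s v) (hA : ∀ z ∈ A, 0 ≤ z.1 ∧ ω z = b)
    (hD : ∀ z ∈ A, z ∈ rect 0 (0 + 5 * r) (c - 4 * r) (c + 4 * r) → z ∈ D)
    (hs : s ∈ rect 0 (0 + 5 * r) (c - 4 * r) (c + 4 * r))
    (hv : v.1 ≥ 5 * r ∨ v.2 ≤ c - 4 * r) : ω ∈ Link b D {s} (far 0 r c) := by
  by_cases hsf : s ∈ far 0 r c
  · exact ⟨s, rfl, s, hsf, .refl (Set.mem_inter (hD s w.start_mem hs) (hA s w.start_mem).2)⟩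
  obtain ⟨a, a', W, e, ha', W'⟩ := w.exit
    (P := rect 0 (0 + 5 * r) (c - 4 * r) (c + 4 * r) \ far 0 r c) ⟨hs, hsf⟩ (by
      simp only [rect, far, Set.mem_sdiff, Set.mem_ofPred_eq]; omega)
  have h1 := (hA a' W'.start_mem).1
  have h2 := W.end_mem.2
  have e' := e
  rw [adj_iff] at e'
  simp only [rect, far, Set.mem_sdiff, Set.mem_ofPred_eq] at h2 ha'
  have W₁ : Walk (D ∩ {v | ω v = b}) s a := W.mono fun z hz => ⟨hD z hz.1 hz.2.1, (hA z hz.1).2⟩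
  refine ⟨s, rfl, a', ?_, W₁.snoc e ⟨hD a' W'.start_mem ?_, (hA a' W'.start_mem).2⟩⟩ <;>
  simp only [rect, far, Set.mem_ofPred_eq] <;> omega

/-- Around the last site on the left side of the lowest crossing, three arms emanate. -/
theorem mem_threeArm {n r c t z : ℤ} {ω : Config} {e u : Site} (hr : 1 ≤ r) (h5 : 5 * r ≤ 2 * n)
    (hn : -n ≤ c - 4 * r) (htc : t ≤ c - 4 * r) (hz : c ≤ z) (hz' : z < c + r)
    (he : e.1 = 2 * n) (hu : u.2 = -n)
    (q : Walk ((rect 0 (2 * n) (-n) n ∩ {v | ω v = true}) \ {v | v.1 = 0 ∧ v.2 ≠ z}) (0, z) e)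
    (U : Walk (rect 0 (2 * n) (-n) n ∩ {v | ω v = false}) (1, z - 1) u)
    (T : Walk ((rect 0 (2 * n) (-n) n ∩ {v | ω v = true}) \ {(0, z)}) (0, t) (0, z - 1)) :
    ω ∈ threeArm 0 r c := by
  refine ⟨z, hz, hz', Link.to_far q (fun v hv => ⟨hv.1.1.1, hv.1.2⟩) (fun v hv hv' => ⟨hv', ?_⟩)
    ?_ (by omega), Link.to_far T.symm (fun v hv => ⟨hv.1.1.1, hv.1.2⟩)
    (fun v hv hv' => ⟨hv', hv.2⟩) ?_ (by dsimp only; omega),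
    Link.to_far U (fun v hv => ⟨hv.1.1, hv.2⟩) (fun v _ hv' => hv') ?_ (by omega)⟩
  · rintro rfl
    exact hv.2 ⟨rfl, by dsimp only; omega⟩
  all_goals simp only [rect, Set.mem_ofPred_eq]; omega

/-- The three independent requirements used to bound the lowest crossing at scale `r`. -/
def hangs (n r c t : ℤ) : Set Config :=
  Link true (box r t) {(0, t)} (outer r t) ∩ (threeArm 0 r c ∩ boxArm n (36 * r) t)

theorem startsAt_cases {n t : ℤ} (hn : 2304 ≤ n) (ht : -n ≤ 2 * t) (ht' : 2 * t ≤ n) {ω : Config}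
    (h : ω ∈ startsAt (2 * n) (-n) n t) :
    ω ∈ boxArm n 36 t ∨ ∃ d, 8 ≤ d ∧ 2 * d ≤ 3 * n ∧ ∀ r j : ℤ, 1 ≤ r → 5 * r ≤ 2 * n → 4 ≤ j →
      j * r ≤ d → d < j * r + r →
        ω ∈ threeArm 0 r (t + j * r) ∧ (72 * r < n → j < 32 → ω ∈ hangs n r (t + j * r) t) := by
  obtain ⟨z, e, u, b, htz, hzn, he, hu, hb, q, U, hT⟩ :=
    exists_last_left (by omega) (by omega) h
  have hbox : ∀ K, z - t ≤ K → 1 ≤ K → 2 * K < n → ω ∈ boxArm n K t := by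
    intro K hK hK1 hKn
    refine ⟨Link.to_nearBox U ?_ ?_ hu, Link.to_nearBox (q.mono Set.sdiff_subset) ?_ ?_ he⟩
    · rcases hb with rfl | rfl <;> simp only [box, rect, Set.mem_ofPred_eq] <;> omega
    all_goals simp only [box, rect, Set.mem_ofPred_eq]; omega
  rcases lt_or_ge (z - t) 8 with hd | hd
  · exact Or.inl (hbox 36 (by omega) (by omega) (by omega))
  refine Or.inr ⟨z - t, hd, by omega, fun r j hr hrn hj h1 h2 => ?_⟩
  obtain ⟨rfl, T⟩ := hT (by omega)
  have hjr : 4 * r ≤ j * r := mul_le_mul_of_nonneg_right hj (by omega)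
  have h3 : ω ∈ threeArm 0 r (t + j * r) :=
    mem_threeArm hr hrn (by omega) (by omega) (by omega) (by omega) he hu q U T
  refine ⟨h3, fun hr' hj' => ⟨?_, h3, hbox _ ?_ (by omega) (by omega)⟩⟩
  · obtain ⟨a, ha, W⟩ := T.exit_box (K := r) (t := t) (fun v hv => hv.1.1.1)
      (by simp only [box, rect, Set.mem_ofPred_eq]; omega)
      (by simp only [outer, box, rect, Set.mem_sdiff, Set.mem_ofPred_eq]; omega)
    exact ⟨_, rfl, a, ha, W.mono fun v hv => ⟨hv.2, hv.1.1.2⟩⟩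
  · have : j * r ≤ 31 * r := mul_le_mul_of_nonneg_right (by omega) (by omega)
    omega

theorem pr_hangs_le : ∃ C lam : ℝ, 0 < C ∧ 0 < lam ∧ lam < 1 ∧ ∀ (n i : ℕ) (j t : ℤ),
    2304 * 4 ^ i ≤ n → -(n : ℤ) ≤ 2 * t → 2 * t ≤ n → 8 ≤ j → j < 32 →
      pr (hangs n (4 ^ i) (t + j * 4 ^ i) t) ≤ C / n * lam ^ i := by
  obtain ⟨lam, hlam, hlam1, h₁⟩ := pr_one_arm_le
  obtain ⟨C₂, hC₂, h₂⟩ := pr_threeArm_le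
  obtain ⟨C₃, hC₃, h₃⟩ := pr_boxArm_le
  refine ⟨36 * C₂ * C₃, lam, by positivity, hlam, hlam1, fun n i j t hn ht ht' hj hj' => ?_⟩
  have hr0 : 1 ≤ 4 ^ i := Nat.one_le_pow _ _ (by norm_num)
  have a₁ := h₁ true t i
  have a₂ := h₂ (4 ^ i) (t + j * 4 ^ i) hr0
  have a₃ := h₃ n (36 * 4 ^ i) t (by omega) (by omega) ht ht'
  push_cast at a₂ a₃
  have hr : (1 : ℤ) ≤ 4 ^ i := by exact_mod_cast hr0
  have hn' : 2304 * (4 : ℤ) ^ i ≤ n := by exact_mod_cast hn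
  generalize hrr : (4 : ℤ) ^ i = r at *
  have hj1 : 8 * r ≤ j * r := mul_le_mul_of_nonneg_right hj (by omega)
  have hj2 : j * r ≤ 31 * r := mul_le_mul_of_nonneg_right (by omega) (by omega)
  have i₁ : pr (threeArm 0 r (t + j * r) ∩ boxArm n (36 * r) t) =
      pr (threeArm 0 r (t + j * r)) * pr (boxArm n (36 * r) t) := by
    refine pr_inter_of_disjoint (rect_finite _ _ _ _) (slit_finite _ _ _) (threeArm_depOn _ _ _)
      (boxArm_depOn _ _ _) (Set.disjoint_left.2 fun v hv hv' => hv'.2 ?_)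
    simp only [box, rect, Set.mem_ofPred_eq] at hv ⊢
    omega
  have i₂ : pr (hangs n r (t + j * r) t) = pr (Link true (box r t) {(0, t)} (outer r t)) *
      (pr (threeArm 0 r (t + j * r)) * pr (boxArm n (36 * r) t)) := by
    rw [← i₁]
    refine pr_inter_of_disjoint (D' := (box r t)ᶜ ∩ rect 0 (2 * n) (-n) n) (box_finite _ _)
      ((rect_finite _ _ _ _).subset Set.inter_subset_right) (Link.depOn _ _ _ _)
      (((threeArm_depOn _ _ _).mono fun v hv => ?_).inter ((boxArm_depOn _ _ _).mono
        fun v hv => ?_)) (Set.disjoint_left.2 fun v hv hv' => hv'.1 hv)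
    all_goals
      simp only [slit, box, rect, Set.mem_inter_iff, Set.mem_compl_iff, Set.mem_sdiff,
        Set.mem_ofPred_eq] at hv ⊢
      omega
  have hn0 : (0 : ℝ) < n := by exact_mod_cast (by omega : 0 < n)
  rw [i₂]
  calc _ ≤ lam ^ i * (C₂ / 4 ^ i * (C₃ * (36 * 4 ^ i) / n)) := by
        refine mul_le_mul a₁ (mul_le_mul a₂ a₃ (pr_nonneg _) (by positivity))
          (mul_nonneg (pr_nonneg _) (pr_nonneg _)) (by positivity)
    _ = _ := by field_simp

theorem startsAt_subset {n L : ℕ} {t : ℤ} (hL : 2304 * 4 ^ L ≤ n) (hL' : n < 2304 * 4 ^ (L + 1))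
    (ht : -(n : ℤ) ≤ 2 * t) (ht' : 2 * t ≤ n) :
    startsAt (2 * n) (-(n : ℤ)) n t ⊆ boxArm n 36 t ∪
      ((⋃ x ∈ Finset.range (L + 1) ×ˢ Finset.Ico (8 : ℤ) 32, hangs n (4 ^ x.1) (t + x.2 * 4 ^ x.1) t) ∪
      ⋃ j ∈ Finset.range 13824, threeArm 0 (4 ^ L) (t + (j : ℤ) * 4 ^ L)) := by
  intro ω hω
  have h4 : ∀ i : ℕ, 1 ≤ 4 ^ i := fun i => Nat.one_le_pow _ _ (by norm_num)
  have hL1 := h4 L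
  rcases startsAt_cases (by omega) ht ht' hω with h | ⟨d, hd, hdn, h⟩
  · exact Or.inl h
  right
  lift d to ℕ using by omega
  have key : ∀ i : ℕ, 8 * 4 ^ i ≤ d → i ≤ L →
      ω ∈ threeArm 0 (4 ^ i) (t + (d / 4 ^ i : ℕ) * 4 ^ i) ∧
      (d / 4 ^ i < 32 → ω ∈ hangs n (4 ^ i) (t + (d / 4 ^ i : ℕ) * 4 ^ i) t) ∧ 8 ≤ d / 4 ^ i := by
    intro i hi hiL
    have hpow : 4 ^ i ≤ 4 ^ L := Nat.pow_le_pow_right (by norm_num) hiL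
    have h8 : 8 ≤ d / 4 ^ i := (Nat.le_div_iff_mul_le (h4 i)).2 hi
    have e1 := Nat.div_add_mod d (4 ^ i)
    have e2 := Nat.mod_lt d (h4 i)
    rw [mul_comm] at e1
    have h1 := h4 i
    have := h ((4 ^ i : ℕ) : ℤ) ((d / 4 ^ i : ℕ) : ℤ) (by exact_mod_cast h1) (by omega) (by omega)
      (by rw [← Nat.cast_mul]; omega) (by rw [← Nat.cast_mul]; omega)
    push_cast at this ⊢
    refine ⟨this.1, fun hlt => this.2 ?_ (by exact_mod_cast hlt), h8⟩
    have : 72 * 4 ^ i < n := by omega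
    exact_mod_cast this
  rcases lt_or_ge d (8 * 4 ^ (L + 1)) with hdL | hdL
  · left
    have hd0 : d / 8 ≠ 0 := by omega
    have g1 := Nat.pow_log_le_self 4 hd0
    have g2 := Nat.lt_pow_succ_log_self (b := 4) (by norm_num) (d / 8)
    set i := Nat.log 4 (d / 8) with hi
    have hiL : i < L + 1 := by
      rw [← Nat.pow_lt_pow_iff_right (a := 4) (by norm_num)]; omega
    obtain ⟨-, k₂, k₃⟩ := key i (by omega) (by omega)
    have hlt : d / 4 ^ i < 32 := by
      rw [Nat.div_lt_iff_lt_mul (h4 i)]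
      rw [pow_succ] at g2; omega
    refine Set.mem_iUnion₂.2 ⟨(i, ((d / 4 ^ i : ℕ) : ℤ)), ?_, k₂ hlt⟩
    rw [Finset.mem_product, Finset.mem_range, Finset.mem_Ico]
    dsimp only
    exact ⟨hiL, by exact_mod_cast k₃, by exact_mod_cast hlt⟩
  · right
    rw [pow_succ] at hdL hL'
    refine Set.mem_iUnion₂.2 ⟨d / 4 ^ L, ?_, (key L (by omega) le_rfl).1⟩
    rw [Finset.mem_range, Nat.div_lt_iff_lt_mul (h4 L)]
    omega

theorem pr_startsAt_le : ∃ C : ℝ, 0 < C ∧ ∀ n : ℕ, 1 ≤ n → ∀ t : ℤ, -(n : ℤ) ≤ 2 * t → 2 * t ≤ n →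
    pr (startsAt (2 * n) (-(n : ℤ)) n t) ≤ C / n := by
  obtain ⟨C₁, lam, hC₁, hlam, hlam1, h₁⟩ := pr_hangs_le
  obtain ⟨C₂, hC₂, h₂⟩ := pr_threeArm_le
  obtain ⟨C₃, hC₃, h₃⟩ := pr_boxArm_le
  have hgap : 0 < 1 - lam := by linarith
  refine ⟨2304 + (C₃ * 36 + (24 * C₁ / (1 - lam) + 13824 * (C₂ * 9216))), by positivity,
    fun n hn t ht ht' => ?_⟩
  have hn0 : (0 : ℝ) < n := by exact_mod_cast hn
  rcases lt_or_ge n 2304 with hlt | hge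
  · refine (pr_le_one _).trans ?_
    rw [le_div_iff₀ hn0]
    have : (n : ℝ) ≤ 2304 := by exact_mod_cast hlt.le
    have : 0 < C₃ * 36 + (24 * C₁ / (1 - lam) + 13824 * (C₂ * 9216)) := by positivity
    linarith
  have hd0 : n / 2304 ≠ 0 := by omega
  have g1 := Nat.pow_log_le_self 4 hd0
  have g2 := Nat.lt_pow_succ_log_self (b := 4) (by norm_num) (n / 2304)
  set L := Nat.log 4 (n / 2304) with hL
  have hL₁ : 2304 * 4 ^ L ≤ n := by omega
  have hL₂ : n < 2304 * 4 ^ (L + 1) := by omega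
  have b₁ : pr (boxArm n 36 t) ≤ C₃ * 36 / n := by
    have := h₃ n 36 t (by norm_num) (by omega) ht ht'
    exact_mod_cast this
  have b₂ : pr (⋃ x ∈ Finset.range (L + 1) ×ˢ Finset.Ico (8 : ℤ) 32,
      hangs n (4 ^ x.1) (t + x.2 * 4 ^ x.1) t) ≤ 24 * C₁ / (1 - lam) / n := by
    refine (pr_le_sum _ subset_rfl).trans ?_
    calc _ ≤ ∑ x ∈ Finset.range (L + 1) ×ˢ Finset.Ico (8 : ℤ) 32, C₁ / n * lam ^ x.1 := by
          refine Finset.sum_le_sum fun x hx => ?_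
          rw [Finset.mem_product, Finset.mem_range, Finset.mem_Ico] at hx
          refine h₁ n x.1 x.2 t (le_trans ?_ hL₁) ht ht' hx.2.1 hx.2.2
          exact Nat.mul_le_mul_left _ (Nat.pow_le_pow_right (by norm_num) (by omega))
      _ = 24 * C₁ / n * ∑ i ∈ Finset.range (L + 1), lam ^ i := by
          rw [Finset.sum_product, Finset.mul_sum]
          refine Finset.sum_congr rfl fun i _ => ?_
          dsimp only
          rw [Finset.sum_const, Int.card_Ico, nsmul_eq_mul,
            show ((32 : ℤ) - 8).toNat = 24 from rfl]
          push_cast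
          ring
      _ ≤ 24 * C₁ / n * (1 - lam)⁻¹ := by
          refine mul_le_mul_of_nonneg_left ?_ (by positivity)
          rw [← tsum_geometric_of_lt_one hlam.le hlam1]
          exact (summable_geometric_of_lt_one hlam.le hlam1).sum_le_tsum _ fun i _ => by positivity
      _ = _ := by field_simp
  have b₃ : pr (⋃ j ∈ Finset.range 13824, threeArm 0 (4 ^ L) (t + (j : ℤ) * 4 ^ L)) ≤
      13824 * (C₂ * 9216) / n := by
    refine (pr_le_sum _ subset_rfl).trans ((Finset.sum_le_card_nsmul _ _ (C₂ * 9216 / n)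
      fun j _ => ?_).trans (le_of_eq ?_))
    · have := h₂ (4 ^ L) (t + (j : ℤ) * 4 ^ L) (Nat.one_le_pow _ _ (by norm_num))
      push_cast at this
      refine this.trans ?_
      rw [div_le_div_iff₀ (by positivity) hn0]
      have h9 : (n : ℝ) ≤ 9216 * 4 ^ L := by
        rw [pow_succ] at hL₂
        exact_mod_cast (by omega : n ≤ 9216 * 4 ^ L)
      nlinarith
    · rw [Finset.card_range, nsmul_eq_mul]
      push_cast
      ring
  refine (pr_mono (startsAt_subset hL₁ hL₂ ht ht')).trans ((pr_union_le _ _).trans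
    ((add_le_add b₁ ((pr_union_le _ _).trans (add_le_add b₂ b₃))).trans ?_))
  rw [← add_div, ← add_div]
  exact div_le_div_of_nonneg_right (by linarith) hn0.le

/-- There exists a constant `C < ∞` such that for all integers `n ≥ 1`, all
`y = (0,t) ∈ Γ_{H(n)}` and all `ỹ = (0,s) ∈ Γ_{H(16n)}`,
`P(L(y, H(n))) ≤ C·P(L(ỹ, H(16n)))`. -/
theorem statement14 :
    ∃ C : ℝ≥0∞, C < ⊤ ∧
      ∀ μ : Measure Config, IsBernoulliHalf μ →
        ∀ n : ℕ, 1 ≤ n →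
          ∀ t s : ℤ, -(n : ℤ) ≤ 2 * t → 2 * t ≤ (n : ℤ) →
            -(16 * n : ℤ) ≤ 2 * s → 2 * s ≤ (16 * n : ℤ) →
            μ {ω | ∃ p, IsLowestCrossing 0 (2 * n) (-(n : ℤ)) n ω p ∧
                p.head? = some (0, t)} ≤
              C * μ {ω | ∃ p,
                  IsLowestCrossing 0 (2 * (16 * n)) (-(16 * n : ℤ)) (16 * n) ω p ∧
                    p.head? = some (0, s)} := by
  obtain ⟨C, hC, hle⟩ := pr_startsAt_le
  obtain ⟨c, hc, hge⟩ := pr_startsAt_ge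
  refine ⟨ENNReal.ofReal (C / c), ENNReal.ofReal_lt_top, fun μ hμ n hn t s ht ht' hs hs' => ?_⟩
  have hn0 : (0 : ℝ) < n := by exact_mod_cast hn
  rw [hμ.eq_perc]
  change perc (startsAt (2 * n) (-(n : ℤ)) n t) ≤
    ENNReal.ofReal (C / c) * perc (startsAt (2 * (16 * n)) (-(16 * n : ℤ)) (16 * n) s)
  rw [← ofReal_measureReal, ← ofReal_measureReal, ← ENNReal.ofReal_mul (by positivity)]
  refine ENNReal.ofReal_le_ofReal ((hle n hn t ht ht').trans ?_)
  have h := mul_le_mul_of_nonneg_left (hge n hn s hs hs') (by positivity : 0 ≤ C / c)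
  refine le_trans (le_of_eq ?_) h
  field_simp
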